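/- Let M be a II₁ factor with faithful tracial state τ, let I be a countable index set, and let {M_i}_{i∈I} be a family of von Neumann subalgebras of M, each an infinite-dimensional factor, such that: xy = yx whenever x ∈ M_i, y ∈ M_j with i ≠ j; M = vN(⋃_i M_i); and for any finitely many distinct indices i₁,…,iₖ and elements x_j ∈ M_{i_j}, τ(x₁ x₂ ⋯ xₖ) = τ(x₁)τ(x₂)⋯τ(xₖ) (these conditions realize M as the infinite tensor product ⊗̄_{i∈I} M_i). For each i let A_i be a MASA in M_i, and let A := vN(⋃_i A_i). Then vN(⋃_i N_{M_i}(A_i)'') = N_M(A)''. -/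

import Mathlib

open scoped ComplexOrder

noncomputable section

variable {H : Type*} [NormedAddCommGroup H] [InnerProductSpace ℂ H] [CompleteSpace H]

/-- The von Neumann algebra generated by a set of bounded operators `S`:
the double commutant of `S ∪ S*`. -/
def vNgen (S : Set (H →L[ℂ] H)) : Set (H →L[ℂ] H) :=
  Set.centralizer (Set.centralizer (S ∪ star '' S))

/-- `M` is a von Neumann algebra acting on `H`: a unital *-subalgebra of `B(H)`
equal to its double commutant. -/
structure IsVonNeumannAlgebra (M : Set (H →L[ℂ] H)) : Prop where
  one_mem : (1 : H →L[ℂ] H) ∈ M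
  add_mem : ∀ x ∈ M, ∀ y ∈ M, x + y ∈ M
  mul_mem : ∀ x ∈ M, ∀ y ∈ M, x * y ∈ M
  smul_mem : ∀ (c : ℂ), ∀ x ∈ M, c • x ∈ M
  star_mem : ∀ x ∈ M, star x ∈ M
  double_commutant : Set.centralizer (Set.centralizer M) = M

/-- `τ` is a faithful tracial state on `M`. -/
structure IsFaithfulTracialState (M : Set (H →L[ℂ] H)) (τ : (H →L[ℂ] H) → ℂ) : Prop where
  map_add : ∀ x ∈ M, ∀ y ∈ M, τ (x + y) = τ x + τ y
  map_smul : ∀ (c : ℂ), ∀ x ∈ M, τ (c • x) = c * τ x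
  map_one : τ 1 = 1
  nonneg : ∀ x ∈ M, 0 ≤ τ (star x * x)
  tracial : ∀ x ∈ M, ∀ y ∈ M, τ (x * y) = τ (y * x)
  faithful : ∀ x ∈ M, τ (star x * x) = 0 → x = 0

/-- `M` is infinite dimensional: it is not contained in the span of finitely many operators. -/
def IsInfiniteDimensionalSet (M : Set (H →L[ℂ] H)) : Prop :=
  ∀ s : Finset (H →L[ℂ] H),
    ¬ (M ⊆ (Submodule.span ℂ (s : Set (H →L[ℂ] H)) : Set (H →L[ℂ] H)))

/-- `M` is a factor: its center consists of scalar multiples of the identity. -/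
def IsFactor (M : Set (H →L[ℂ] H)) : Prop :=
  ∀ x ∈ M, (∀ y ∈ M, x * y = y * x) → ∃ c : ℂ, x = c • (1 : H →L[ℂ] H)

/-- `M` is a II₁ factor with faithful tracial state `τ`. -/
structure IsII1Factor (M : Set (H →L[ℂ] H)) (τ : (H →L[ℂ] H) → ℂ) : Prop where
  vna : IsVonNeumannAlgebra M
  factor : IsFactor M
  infdim : IsInfiniteDimensionalSet M
  trace : IsFaithfulTracialState M τ

/-- The 2-norm `‖x‖₂ = τ(x*x)^{1/2}` associated to the trace `τ`. -/
def norm2 (τ : (H →L[ℂ] H) → ℂ) (x : H →L[ℂ] H) : ℝ :=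
  Real.sqrt (τ (star x * x)).re

/-- `E` is the `τ`-preserving conditional expectation of `M` onto `B`. -/
def IsCondExp (M B : Set (H →L[ℂ] H)) (τ : (H →L[ℂ] H) → ℂ)
    (E : (H →L[ℂ] H) → (H →L[ℂ] H)) : Prop :=
  (∀ x ∈ M, E x ∈ B) ∧ (∀ x ∈ M, ∀ b ∈ B, τ ((x - E x) * b) = 0)

/-- `A` is a maximal abelian *-subalgebra (MASA) of `M`. -/
def IsMasa (M A : Set (H →L[ℂ] H)) : Prop :=
  A ⊆ M ∧ (∀ a ∈ A, star a ∈ A) ∧ {x ∈ M | ∀ a ∈ A, x * a = a * x} = A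

/-- `u` is a unitary operator. -/
def IsUnitary (u : H →L[ℂ] H) : Prop :=
  star u * u = 1 ∧ u * star u = 1

/-- The set of normalizing unitaries of `A` in `M`: unitaries `u ∈ M` with `uAu* = A`. -/
def normalizerSet (M A : Set (H →L[ℂ] H)) : Set (H →L[ℂ] H) :=
  {u | u ∈ M ∧ IsUnitary u ∧ (fun a => u * a * star u) '' A = A}

/-- The normalizing algebra `N_M(A)''` of `A` in `M`. -/
def normAlg (M A : Set (H →L[ℂ] H)) : Set (H →L[ℂ] H) :=
  vNgen (normalizerSet M A)

/-- The triple `B ⊆ N ⊆ M` satisfies the relative weak asymptotic homomorphism property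
relative to the trace `τ` and the conditional expectations `EB` and `EN`. -/
def RelWAHP (M N B : Set (H →L[ℂ] H)) (τ : (H →L[ℂ] H) → ℂ)
    (EB EN : (H →L[ℂ] H) → (H →L[ℂ] H)) : Prop :=
  ∀ (n : ℕ) (x : Fin n → (H →L[ℂ] H)), (∀ i, x i ∈ M) →
    ∀ ε : ℝ, 0 < ε → ∃ u ∈ B, IsUnitary u ∧
      ∀ i j, norm2 τ (EB (x i * u * x j) - EB (EN (x i) * u * EN (x j))) < ε

namespace VNA

open Filter Topology

/-- A von Neumann algebra as a star subalgebra of the bounded operators. -/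
def toStarSubalgebra {M : Set (H →L[ℂ] H)} (hM : IsVonNeumannAlgebra M) :
    StarSubalgebra ℂ (H →L[ℂ] H) where
  carrier := M
  mul_mem' := fun ha hb => hM.mul_mem _ ha _ hb
  one_mem' := hM.one_mem
  add_mem' := fun ha hb => hM.add_mem _ ha _ hb
  zero_mem' := by simpa using hM.smul_mem 0 1 hM.one_mem
  algebraMap_mem' := fun c => by
    rw [Algebra.algebraMap_eq_smul_one]; exact hM.smul_mem c 1 hM.one_mem
  star_mem' := fun ha => hM.star_mem _ ha

theorem zero_mem {M : Set (H →L[ℂ] H)} (hM : IsVonNeumannAlgebra M) : (0 : H →L[ℂ] H) ∈ M :=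
  (toStarSubalgebra hM).zero_mem

theorem mul_mem {M : Set (H →L[ℂ] H)} (hM : IsVonNeumannAlgebra M) {x y : H →L[ℂ] H}
    (hx : x ∈ M) (hy : y ∈ M) : x * y ∈ M := hM.mul_mem x hx y hy

theorem add_mem {M : Set (H →L[ℂ] H)} (hM : IsVonNeumannAlgebra M) {x y : H →L[ℂ] H}
    (hx : x ∈ M) (hy : y ∈ M) : x + y ∈ M := hM.add_mem x hx y hy

theorem star_mem {M : Set (H →L[ℂ] H)} (hM : IsVonNeumannAlgebra M) {x : H →L[ℂ] H}
    (hx : x ∈ M) : star x ∈ M := hM.star_mem x hx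

theorem sub_mem {M : Set (H →L[ℂ] H)} (hM : IsVonNeumannAlgebra M) {x y : H →L[ℂ] H}
    (hx : x ∈ M) (hy : y ∈ M) : x - y ∈ M := (toStarSubalgebra hM).sub_mem hx hy

theorem sum_mem {M : Set (H →L[ℂ] H)} (hM : IsVonNeumannAlgebra M) {ι : Type*} {s : Finset ι}
    {x : ι → H →L[ℂ] H} (hx : ∀ i ∈ s, x i ∈ M) : ∑ i ∈ s, x i ∈ M :=
  (toStarSubalgebra hM).sum_mem hx

theorem smul_mem {M : Set (H →L[ℂ] H)} (hM : IsVonNeumannAlgebra M) (c : ℂ) {x : H →L[ℂ] H}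
    (hx : x ∈ M) : c • x ∈ M := hM.smul_mem c x hx

theorem star_centralizer {S : Set (H →L[ℂ] H)} (hS : ∀ x ∈ S, star x ∈ S) {x : H →L[ℂ] H}
    (hx : x ∈ S.centralizer) : star x ∈ S.centralizer := by
  intro y hy
  have := hx (star y) (hS y hy)
  simpa using (congrArg star this).symm

theorem isVNA_centralizer {S : Set (H →L[ℂ] H)} (hS : ∀ x ∈ S, star x ∈ S) :
    IsVonNeumannAlgebra S.centralizer where
  one_mem := Set.one_mem_centralizer
  add_mem := fun _ hx _ hy => Set.add_mem_centralizer hx hy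
  mul_mem := fun _ hx _ hy => Set.mul_mem_centralizer hx hy
  smul_mem := fun c x hx y hy => by
    simp only [mul_smul_comm, smul_mul_assoc, hx y hy]
  star_mem := fun _ hx => star_centralizer hS hx
  double_commutant := Set.centralizer_centralizer_centralizer S

theorem star_mem_union_star {S : Set (H →L[ℂ] H)} (x : H →L[ℂ] H) (hx : x ∈ S ∪ star '' S) :
    star x ∈ S ∪ star '' S := by
  rcases hx with hx | ⟨y, hy, rfl⟩
  · exact Or.inr ⟨x, hx, rfl⟩
  · exact Or.inl (by simpa using hy)

theorem isVNA_vNgen (S : Set (H →L[ℂ] H)) : IsVonNeumannAlgebra (vNgen S) :=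
  isVNA_centralizer fun _ hx => star_centralizer star_mem_union_star hx

theorem subset_vNgen (S : Set (H →L[ℂ] H)) : S ⊆ vNgen S := fun _ hx _ hy =>
  (hy _ (Or.inl hx)).symm

theorem vNgen_subset {S N : Set (H →L[ℂ] H)} (hN : IsVonNeumannAlgebra N) (h : S ⊆ N) :
    vNgen S ⊆ N := by
  have h' : S ∪ star '' S ⊆ N := by
    rintro x (hx | ⟨y, hy, rfl⟩)
    exacts [h hx, hN.star_mem _ (h hy)]
  rw [← hN.double_commutant]
  exact Set.centralizer_subset (Set.centralizer_subset h')

theorem isVNA_commutant {M : Set (H →L[ℂ] H)} (hM : IsVonNeumannAlgebra M) :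
    IsVonNeumannAlgebra M.centralizer := isVNA_centralizer hM.star_mem

/-- Membership in a von Neumann algebra through the commutant. -/
theorem mem_of_commute {M : Set (H →L[ℂ] H)} (hM : IsVonNeumannAlgebra M) {x : H →L[ℂ] H}
    (h : ∀ t ∈ M.centralizer, t * x = x * t) : x ∈ M := by
  rw [← hM.double_commutant]; exact h

/-- An operator commuting with everything an element of `M` commutes with lies in `M`. -/
theorem mem_of_commute_of {M : Set (H →L[ℂ] H)} (hM : IsVonNeumannAlgebra M) {x y : H →L[ℂ] H}
    (hx : x ∈ M) (h : ∀ t, Commute t x → Commute t y) : y ∈ M :=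
  mem_of_commute hM fun t ht => h t (ht x hx).symm

theorem isVNA_inter {M N : Set (H →L[ℂ] H)} (hM : IsVonNeumannAlgebra M)
    (hN : IsVonNeumannAlgebra N) : IsVonNeumannAlgebra (M ∩ N) where
  one_mem := ⟨hM.one_mem, hN.one_mem⟩
  add_mem := fun _ hx _ hy => ⟨hM.add_mem _ hx.1 _ hy.1, hN.add_mem _ hx.2 _ hy.2⟩
  mul_mem := fun _ hx _ hy => ⟨hM.mul_mem _ hx.1 _ hy.1, hN.mul_mem _ hx.2 _ hy.2⟩
  smul_mem := fun _ _ hx => ⟨hM.smul_mem _ _ hx.1, hN.smul_mem _ _ hx.2⟩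
  star_mem := fun _ hx => ⟨hM.star_mem _ hx.1, hN.star_mem _ hx.2⟩
  double_commutant := by
    refine subset_antisymm (fun x hx => ⟨?_, ?_⟩) Set.subset_centralizer_centralizer
    · rw [← hM.double_commutant]
      exact Set.centralizer_subset (Set.centralizer_subset Set.inter_subset_left) hx
    · rw [← hN.double_commutant]
      exact Set.centralizer_subset (Set.centralizer_subset Set.inter_subset_right) hx

/-- Bounded nets of operators have limits along ultrafilters in the weak operator topology. -/
theorem exists_wot_limit {ι : Type*} (U : Ultrafilter ι) (x : ι → H →L[ℂ] H) {r : ℝ}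
    (hr : 0 ≤ r) (hx : ∀ i, ‖x i‖ ≤ r) :
    ∃ y : H →L[ℂ] H, ‖y‖ ≤ r ∧
      ∀ ξ η, Tendsto (fun i => inner ℂ ξ (x i η)) U (𝓝 (inner ℂ ξ (y η))) := by
  have key : ∀ v w : H, ∃ b : ℂ, ‖b‖ ≤ r * ‖v‖ * ‖w‖ ∧
      Tendsto (fun i => inner ℂ (x i v) w) U (𝓝 b) := by
    intro v w
    have hc : IsCompact (Metric.closedBall (0 : ℂ) (r * ‖v‖ * ‖w‖)) := isCompact_closedBall _ _
    have hle : ((U.map fun i => inner ℂ (x i v) w : Ultrafilter ℂ) : Filter ℂ) ≤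
        𝓟 (Metric.closedBall (0 : ℂ) (r * ‖v‖ * ‖w‖)) := by
      rw [Ultrafilter.coe_map, le_principal_iff, mem_map]
      refine univ_mem' fun i => ?_
      simp only [Set.mem_preimage, mem_closedBall_zero_iff]
      calc _ ≤ ‖x i v‖ * ‖w‖ := norm_inner_le_norm _ _
        _ ≤ _ := by
          gcongr
          exact ((x i).le_opNorm v).trans (by gcongr; exact hx i)
    obtain ⟨b, hb, hlim⟩ := hc.ultrafilter_le_nhds _ hle
    exact ⟨b, by simpa using hb, hlim⟩
  choose b hb hlim using key
  have uniq : ∀ {f : ι → ℂ} {a c : ℂ}, Tendsto f U (𝓝 a) → Tendsto f U (𝓝 c) → a = c :=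
    fun h1 h2 => tendsto_nhds_unique h1 h2
  let B : H →L⋆[ℂ] H →L[ℂ] ℂ := LinearMap.mkContinuous₂
    (LinearMap.mk₂'ₛₗ (starRingEnd ℂ) (RingHom.id ℂ) b
      (fun v v' w => uniq (hlim _ _) (by
        simpa [inner_add_left] using (hlim v w).add (hlim v' w)))
      (fun c v w => uniq (hlim _ _) (by
        simpa [inner_smul_left, mul_comm] using (hlim v w).const_mul (starRingEnd ℂ c)))
      (fun v w w' => uniq (hlim _ _) (by
        simpa [inner_add_right] using (hlim v w).add (hlim v w')))
      (fun c v w => uniq (hlim _ _) (by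
        simpa [inner_smul_right] using (hlim v w).const_mul c)))
    r (fun v w => hb v w)
  have hB : ∀ v w, inner ℂ (InnerProductSpace.continuousLinearMapOfBilin B v) w = b v w :=
    fun v w => InnerProductSpace.continuousLinearMapOfBilin_apply B v w
  refine ⟨InnerProductSpace.continuousLinearMapOfBilin B, ?_, ?_⟩
  · refine ContinuousLinearMap.opNorm_le_bound _ hr fun v => ?_
    set y := InnerProductSpace.continuousLinearMapOfBilin B v with hy
    have h1 : ‖y‖ * ‖y‖ ≤ r * ‖v‖ * ‖y‖ := by
      have h := hb v y
      rw [← hB, ← hy, inner_self_eq_norm_sq_to_K] at h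
      simpa [sq] using h
    rcases (norm_nonneg y).eq_or_lt with h0 | h0
    · rw [← h0]; positivity
    · exact le_of_mul_le_mul_right h1 h0
  · intro ξ η
    have h := (hlim η ξ).star
    rw [← hB] at h
    simpa only [RCLike.star_def, inner_conj_symm] using h

theorem rsmul_mem {M : Set (H →L[ℂ] H)} (hM : IsVonNeumannAlgebra M) (c : ℝ) {x : H →L[ℂ] H}
    (hx : x ∈ M) : c • x ∈ M := by
  rw [← Complex.coe_smul]; exact hM.smul_mem _ x hx

theorem conj_nonneg {x : H →L[ℂ] H} (hx : 0 ≤ x) (y : H →L[ℂ] H) : 0 ≤ star y * x * y :=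
  star_left_conjugate_nonneg hx y

theorem proj_nonneg {e : H →L[ℂ] H} (he : IsStarProjection e) : 0 ≤ e := by
  have := star_mul_self_nonneg e
  rwa [he.isSelfAdjoint.star_eq, he.isIdempotentElem.eq] at this

theorem mul_proj_nonneg {x e : H →L[ℂ] H} (hx : 0 ≤ x) (he : IsStarProjection e)
    (h : Commute x e) : 0 ≤ x * e := by
  have := conj_nonneg hx e
  rwa [he.isSelfAdjoint.star_eq, ← h.eq, mul_assoc, he.isIdempotentElem.eq] at this

/-- Positive operators have positive square roots commuting with the same operators. -/
theorem exists_sqrt {x : H →L[ℂ] H} (hx : 0 ≤ x) :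
    ∃ k : H →L[ℂ] H, star k = k ∧ k * k = x ∧ ∀ t, Commute t x → Commute t k := by
  have hsa : IsSelfAdjoint x := hx.isSelfAdjoint
  refine ⟨cfc Real.sqrt x, (cfc_predicate Real.sqrt x : IsSelfAdjoint _).star_eq, ?_, fun t ht =>
    (hsa.commute_cfc ht.symm _).symm⟩
  rw [← cfc_mul Real.sqrt Real.sqrt x]
  conv_rhs => rw [← cfc_id ℝ x]
  exact cfc_congr fun r hr => Real.mul_self_sqrt (spectrum_nonneg_of_nonneg hx hr)

theorem exists_sqrt_mem {M : Set (H →L[ℂ] H)} (hM : IsVonNeumannAlgebra M) {x : H →L[ℂ] H}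
    (hxM : x ∈ M) (hx : 0 ≤ x) : ∃ k ∈ M, star k = k ∧ k * k = x := by
  obtain ⟨k, h1, h2, h3⟩ := exists_sqrt hx
  exact ⟨k, mem_of_commute_of hM hxM h3, h1, h2⟩

/-- The projection onto a closed subspace commutes with an operator leaving the subspace
invariant together with its adjoint. -/
theorem commute_starProjection (K : Submodule ℂ H) [K.HasOrthogonalProjection] {t : H →L[ℂ] H}
    (h : ∀ v ∈ K, t v ∈ K) (h' : ∀ v ∈ K, star t v ∈ K) : Commute t K.starProjection := by
  have key : ∀ s : H →L[ℂ] H, (∀ v ∈ K, s v ∈ K) →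
      K.starProjection * s * K.starProjection = s * K.starProjection := by
    intro s hs
    ext v
    simp only [mul_apply_eq_comp]
    exact Submodule.starProjection_eq_self_iff.2 (hs _ (K.starProjection_apply_mem v))
  have h1 := key t h
  have h2 := congrArg star (key (star t) h')
  have hp : star K.starProjection = K.starProjection :=
    (isStarProjection_starProjection (U := K)).isSelfAdjoint.star_eq
  simp only [star_mul, star_star, hp, ← mul_assoc] at h2
  exact h1.symm.trans h2

/-- The projection onto the closure of a subspace invariant under the commutant lies in the
von Neumann algebra. -/
theorem starProjection_mem {M : Set (H →L[ℂ] H)} (hM : IsVonNeumannAlgebra M)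
    (K : Submodule ℂ H) (h : ∀ t ∈ M.centralizer, ∀ v ∈ K, t v ∈ K) :
    K.topologicalClosure.starProjection ∈ M := by
  have key : ∀ t ∈ M.centralizer, ∀ v ∈ K.topologicalClosure, t v ∈ K.topologicalClosure := by
    intro t ht v hv
    exact map_mem_closure t.continuous hv (h t ht)
  refine mem_of_commute hM fun t ht => ?_
  exact (commute_starProjection _ (key t ht) (key _ (star_mem (isVNA_commutant hM) ht))).eq

/-- Spectral projection of a self-adjoint operator for the positive half line. -/
theorem exists_spectral_proj {a : H →L[ℂ] H} (ha : IsSelfAdjoint a) :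
    ∃ e p n : H →L[ℂ] H, IsStarProjection e ∧ 0 ≤ p ∧ 0 ≤ n ∧ a = p - n ∧ a * e = p ∧
      e * p = p ∧ e * n = 0 ∧ n * e = 0 ∧
      ∀ t, Commute t a → Commute t e ∧ Commute t p ∧ Commute t n := by
  obtain ⟨p, n, hp, hn, hpn, hmul, hc⟩ : ∃ p n : H →L[ℂ] H, 0 ≤ p ∧ 0 ≤ n ∧ a = p - n ∧
      n * p = 0 ∧ ∀ t, Commute t a → Commute t p ∧ Commute t n := by
    refine ⟨a⁺, a⁻, CFC.posPart_nonneg a, CFC.negPart_nonneg a,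
      (CFC.posPart_sub_negPart a ha).symm, CFC.negPart_mul_posPart a, fun t ht => ?_⟩
    have h1 : Commute a⁺ t := by
      rw [CFC.posPart_def]; exact ha.commute_cfcₙ ht.symm _
    have h2 : Commute a⁻ t := by
      rw [CFC.negPart_def]; exact ha.commute_cfcₙ ht.symm _
    exact ⟨h1.symm, h2.symm⟩
  set K : Submodule ℂ H := p.range.topologicalClosure with hK
  set e := K.starProjection with he
  have heP : IsStarProjection e := isStarProjection_starProjection
  have hep : e * p = p := by
    ext v
    exact Submodule.starProjection_eq_self_iff.2
      (Submodule.le_topologicalClosure _ (LinearMap.mem_range_self _ v))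
  have hne : n * e = 0 := by
    ext v
    have hker : ∀ w ∈ K, n w = 0 := by
      intro w hw
      have hcl : IsClosed {w : H | n w = 0} := isClosed_eq n.continuous continuous_const
      refine closure_minimal (t := {w : H | n w = 0}) ?_ hcl hw
      rintro _ ⟨u, rfl⟩
      exact congrArg (fun f : H →L[ℂ] H => f u) hmul
    exact hker _ (K.starProjection_apply_mem v)
  have hen : e * n = 0 := by
    have := congrArg star hne
    simpa [heP.isSelfAdjoint.star_eq, hn.isSelfAdjoint.star_eq] using this
  have hpe : p * e = p := by
    have := congrArg star hep
    simpa [heP.isSelfAdjoint.star_eq, hp.isSelfAdjoint.star_eq] using this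
  refine ⟨e, p, n, heP, hp, hn, hpn, by rw [hpn, sub_mul, hpe, hne, sub_zero], hep, hen, hne,
    fun t ht => ⟨?_, hc t ht⟩⟩
  have key : ∀ t, Commute t p → ∀ v ∈ K, t v ∈ K := by
    intro t ht v hv
    refine map_mem_closure t.continuous hv ?_
    rintro _ ⟨u, rfl⟩
    exact ⟨t u, (congrArg (fun f : H →L[ℂ] H => f u) ht.eq).symm⟩
  have hts : Commute (star t) a := by
    have := ht.star_star
    rwa [ha.star_eq] at this
  exact commute_starProjection K (key t (hc t ht).1) (key _ (hc _ hts).1)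

theorem exists_dyadic_proj {x : H →L[ℂ] H} (hx : 0 ≤ x) {c : ℝ} (hxc : x ≤ c • 1) :
    ∃ e : H →L[ℂ] H, IsStarProjection e ∧ (∀ t, Commute t x → Commute t e) ∧
      0 ≤ x - (c / 2) • e ∧ x - (c / 2) • e ≤ (c / 2) • 1 := by
  have hsa : IsSelfAdjoint (x - (c / 2) • (1 : H →L[ℂ] H)) :=
    hx.isSelfAdjoint.sub (IsSelfAdjoint.smul (IsSelfAdjoint.all _) (IsSelfAdjoint.one _))
  have hsc : ∀ t : H →L[ℂ] H, Commute t ((c / 2) • (1 : H →L[ℂ] H)) := fun t =>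
    (Commute.one_right t).smul_right _
  obtain ⟨e, p, n, he, hp, hn, hpn, hae, hep, hen, hne, hcomm⟩ := exists_spectral_proj hsa
  have hce : ∀ t, Commute t x → Commute t e := fun t ht => (hcomm t (ht.sub_right (hsc t))).1
  have hxe := hce x (Commute.refl x)
  refine ⟨e, he, hce, ?_, ?_⟩
  · have h1 := mul_proj_nonneg hx he.one_sub ((Commute.one_right x).sub_right hxe)
    have : x - (c / 2) • e = p + x * (1 - e) := by
      rw [← hae]; simp only [sub_mul, mul_sub, smul_mul_assoc, one_mul, mul_one]; abel
    rw [this]; exact add_nonneg hp h1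
  · have h1 : 0 ≤ (c • 1 - x) * e :=
      mul_proj_nonneg (sub_nonneg.2 hxc) he
        (((Commute.one_left e).smul_left _).sub_left hxe)
    rw [← sub_nonneg]
    have : (c / 2) • (1 : H →L[ℂ] H) - (x - (c / 2) • e) = n + (c • 1 - x) * e := by
      have h2 : n = p - (x - (c / 2) • 1) := by rw [hpn]; abel
      have h3 : c • e = (c / 2) • e + (c / 2) • e := by rw [← add_smul]; congr 1; ring
      rw [h2, ← hae]; simp only [sub_mul, smul_mul_assoc, one_mul]; rw [h3]; abel
    rw [this]; exact add_nonneg hn h1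

/-- Projections in a set of operators. -/
def projSet (B : Set (H →L[ℂ] H)) : Set (H →L[ℂ] H) := {e | e ∈ B ∧ IsStarProjection e}

theorem le_norm_smul_one {x : H →L[ℂ] H} (hx : 0 ≤ x) : x ≤ ‖x‖ • 1 := by
  have := hx.isSelfAdjoint.le_algebraMap_norm_self
  rwa [Algebra.algebraMap_eq_smul_one] at this

theorem exists_span_proj_approx {B : Set (H →L[ℂ] H)} (hB : IsVonNeumannAlgebra B)
    {x : H →L[ℂ] H} (hxB : x ∈ B) (hx : 0 ≤ x) {ε : ℝ} (hε : 0 < ε) :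
    ∃ y ∈ Submodule.span NNReal (projSet B), 0 ≤ x - y ∧ x - y ≤ ε • 1 := by
  have key : ∀ k : ℕ, ∀ c : ℝ, 0 ≤ c → ∀ x ∈ B, 0 ≤ x → x ≤ c • 1 →
      ∃ y ∈ Submodule.span NNReal (projSet B), 0 ≤ x - y ∧ x - y ≤ (c / 2 ^ k) • 1 := by
    intro k
    induction k with
    | zero => intro c _ x _ hx hxc; exact ⟨0, Submodule.zero_mem _, by simpa, by simpa⟩
    | succ k ih =>
      intro c hc x hxB hx hxc
      obtain ⟨e, he, hce, h0, h1⟩ := exists_dyadic_proj hx hxc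
      have heB : e ∈ B := mem_of_commute_of hB hxB hce
      obtain ⟨y, hy, h2, h3⟩ := ih (c / 2) (by positivity) (x - (c / 2) • e)
        (sub_mem hB hxB (rsmul_mem hB _ heB)) h0 h1
      refine ⟨(c / 2) • e + y, Submodule.add_mem _ ?_ hy, ?_, ?_⟩
      · exact Submodule.smul_mem (Submodule.span NNReal (projSet B)) ⟨c / 2, by positivity⟩
          (Submodule.subset_span (s := projSet B) ⟨heB, he⟩)
      · rwa [← sub_sub]
      · rw [← sub_sub, pow_succ', ← div_div]; exact h3
  obtain ⟨k, hk⟩ := pow_unbounded_of_one_lt (‖x‖ / ε) (one_lt_two)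
  obtain ⟨y, hy, h1, h2⟩ := key k ‖x‖ (norm_nonneg x) x hxB hx (le_norm_smul_one hx)
  refine ⟨y, hy, h1, h2.trans ?_⟩
  have : ‖x‖ / 2 ^ k ≤ ε := by
    rw [div_le_iff₀ (by positivity)]
    rw [div_lt_iff₀ hε] at hk
    linarith
  exact smul_le_smul_of_nonneg_right this zero_le_one

theorem norm_le_of_le_smul_one {x : H →L[ℂ] H} (hx : 0 ≤ x) {c : ℝ} (hc : 0 ≤ c)
    (h : x ≤ c • 1) : ‖x‖ ≤ c := by
  rw [CStarAlgebra.norm_le_iff_le_algebraMap x hc hx, Algebra.algebraMap_eq_smul_one]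
  exact h

/-- A von Neumann algebra is the norm closed linear span of its projections. -/
theorem mem_of_projSet {B : Set (H →L[ℂ] H)} (hB : IsVonNeumannAlgebra B)
    (V : Submodule ℂ (H →L[ℂ] H)) (hV : IsClosed (V : Set (H →L[ℂ] H)))
    (h : projSet B ⊆ V) : B ⊆ V := by
  have hspan : ∀ y ∈ Submodule.span NNReal (projSet B), y ∈ V := by
    intro y hy
    induction hy using Submodule.span_induction with
    | mem y hy => exact h hy
    | zero => exact V.zero_mem
    | add y z _ _ hy hz => exact V.add_mem hy hz
    | smul c y _ hy =>
      have : c • y = (c : ℂ) • y := by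
        rw [NNReal.smul_def, ← Complex.coe_smul]
      rw [this]; exact V.smul_mem _ hy
  have hpos : ∀ x ∈ B, 0 ≤ x → x ∈ V := by
    intro x hxB hx
    refine hV.closure_subset_iff.2 subset_rfl (Metric.mem_closure_iff.2 fun ε hε => ?_)
    obtain ⟨y, hy, h1, h2⟩ := exists_span_proj_approx hB hxB hx (half_pos hε)
    refine ⟨y, hspan y hy, ?_⟩
    rw [dist_eq_norm]
    have := norm_le_of_le_smul_one h1 (by positivity) h2
    linarith
  have hsa : ∀ x ∈ B, IsSelfAdjoint x → x ∈ V := by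
    intro x hxB hx
    obtain ⟨e, p, n, -, hp, hn, hpn, -, -, -, -, hcomm⟩ := exists_spectral_proj hx
    rw [hpn]
    exact V.sub_mem (hpos p (mem_of_commute_of hB hxB fun t ht => (hcomm t ht).2.1) hp)
      (hpos n (mem_of_commute_of hB hxB fun t ht => (hcomm t ht).2.2) hn)
  intro x hx
  rw [← realPart_add_I_smul_imaginaryPart x]
  refine V.add_mem (hsa _ ?_ (realPart x).2) (V.smul_mem _ (hsa _ ?_ (imaginaryPart x).2))
  · rw [realPart_apply_coe]
    exact rsmul_mem hB _ (add_mem hB hx (star_mem hB hx))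
  · rw [imaginaryPart_apply_coe]
    exact smul_mem hB _ (rsmul_mem hB _ (sub_mem hB hx (star_mem hB hx)))

theorem commute_of_projSet {B : Set (H →L[ℂ] H)} (hB : IsVonNeumannAlgebra B) {x : H →L[ℂ] H}
    (h : ∀ e ∈ projSet B, x * e = e * x) {b : H →L[ℂ] H} (hb : b ∈ B) : x * b = b * x := by
  let f : (H →L[ℂ] H) →L[ℂ] (H →L[ℂ] H) :=
    ContinuousLinearMap.mul ℂ _ x - (ContinuousLinearMap.mul ℂ (H →L[ℂ] H)).flip x
  have := mem_of_projSet hB f.ker f.isClosed_ker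
    (fun e he => sub_eq_zero.2 (h e he)) hb
  exact sub_eq_zero.1 this

/-- `τ` is a linear functional restricting to a faithful tracial state on the von Neumann
algebra `M`. -/
structure IsTrace (M : Set (H →L[ℂ] H)) (τ : (H →L[ℂ] H) →ₗ[ℂ] ℂ) : Prop where
  vna : IsVonNeumannAlgebra M
  map_one : τ 1 = 1
  nonneg : ∀ x ∈ M, 0 ≤ τ (star x * x)
  tracial : ∀ x ∈ M, ∀ y ∈ M, τ (x * y) = τ (y * x)
  faithful : ∀ x ∈ M, τ (star x * x) = 0 → x = 0

theorem exists_isTrace {M : Set (H →L[ℂ] H)} {τ : (H →L[ℂ] H) → ℂ} (hM : IsVonNeumannAlgebra M)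
    (h : IsFaithfulTracialState M τ) :
    ∃ σ : (H →L[ℂ] H) →ₗ[ℂ] ℂ, (∀ x ∈ M, σ x = τ x) ∧ IsTrace M σ := by
  let S : Submodule ℂ (H →L[ℂ] H) :=
    { carrier := M
      add_mem' := fun ha hb => hM.add_mem _ ha _ hb
      zero_mem' := zero_mem hM
      smul_mem' := fun c _ hx => hM.smul_mem c _ hx }
  let f : S →ₗ[ℂ] ℂ :=
    { toFun := fun x => τ x
      map_add' := fun x y => h.map_add _ x.2 _ y.2
      map_smul' := fun c x => h.map_smul c _ x.2 }
  obtain ⟨σ, hσ⟩ := f.exists_extend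
  have hσ' : ∀ x ∈ M, σ x = τ x := fun x hx => LinearMap.congr_fun hσ ⟨x, hx⟩
  refine ⟨σ, hσ', hM, ?_, ?_, ?_, ?_⟩
  · rw [hσ' _ hM.one_mem, h.map_one]
  · intro x hx
    rw [hσ' _ (mul_mem hM (star_mem hM hx) hx)]; exact h.nonneg x hx
  · intro x hx y hy
    rw [hσ' _ (mul_mem hM hx hy), hσ' _ (mul_mem hM hy hx)]; exact h.tracial x hx y hy
  · intro x hx h0
    rw [hσ' _ (mul_mem hM (star_mem hM hx) hx)] at h0; exact h.faithful x hx h0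

/-- The square of the `2`-norm associated with `τ`. -/
def sqNorm (τ : (H →L[ℂ] H) →ₗ[ℂ] ℂ) (x : H →L[ℂ] H) : ℝ := (τ (star x * x)).re

namespace IsTrace

variable {M : Set (H →L[ℂ] H)} {τ : (H →L[ℂ] H) →ₗ[ℂ] ℂ} (h : IsTrace M τ)
include h

theorem eq_sqNorm {x : H →L[ℂ] H} (hx : x ∈ M) : τ (star x * x) = (sqNorm τ x : ℂ) := by
  have := h.nonneg x hx
  rw [Complex.nonneg_iff] at this
  exact Complex.ext rfl (by simp [← this.2])

theorem sqNorm_nonneg {x : H →L[ℂ] H} (hx : x ∈ M) : 0 ≤ sqNorm τ x :=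
  (Complex.nonneg_iff.1 (h.nonneg x hx)).1

theorem pos {x : H →L[ℂ] H} (hxM : x ∈ M) (hx : 0 ≤ x) : 0 ≤ τ x := by
  obtain ⟨k, hk, hks, rfl⟩ := exists_sqrt_mem h.vna hxM hx
  have := h.nonneg k hk
  rwa [hks] at this

theorem mono {x y : H →L[ℂ] H} (hx : x ∈ M) (hy : y ∈ M) (hxy : x ≤ y) : (τ x).re ≤ (τ y).re := by
  have := h.pos (sub_mem h.vna hy hx) (sub_nonneg.2 hxy)
  rw [map_sub, Complex.nonneg_iff] at this
  simpa using this.1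

theorem eq_zero_of_nonneg {x : H →L[ℂ] H} (hxM : x ∈ M) (hx : 0 ≤ x) (h0 : τ x = 0) :
    x = 0 := by
  obtain ⟨k, hk, hks, rfl⟩ := exists_sqrt_mem h.vna hxM hx
  have := h.faithful k hk (by rw [hks, h0])
  rw [this, mul_zero]

theorem im_eq_zero {x : H →L[ℂ] H} (hxM : x ∈ M) (hx : IsSelfAdjoint x) : (τ x).im = 0 := by
  obtain ⟨e, p, n, -, hp, hn, hpn, -, -, -, -, hcomm⟩ := exists_spectral_proj hx
  have h1 := h.pos (mem_of_commute_of h.vna hxM fun t ht => (hcomm t ht).2.1) hp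
  have h2 := h.pos (mem_of_commute_of h.vna hxM fun t ht => (hcomm t ht).2.2) hn
  rw [Complex.nonneg_iff] at h1 h2
  rw [hpn, map_sub, Complex.sub_im, ← h1.2, ← h2.2, sub_zero]

theorem map_star {x : H →L[ℂ] H} (hx : x ∈ M) : τ (star x) = star (τ x) := by
  have h1 := h.im_eq_zero (add_mem h.vna hx (star_mem h.vna hx)) (IsSelfAdjoint.add_star_self x)
  have h2 := h.im_eq_zero (smul_mem h.vna Complex.I (sub_mem h.vna hx (star_mem h.vna hx)))
    (by
      rw [IsSelfAdjoint, star_smul, star_sub, star_star, Complex.star_def, Complex.conj_I, neg_smul,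
        ← smul_neg, neg_sub])
  simp only [map_add, map_smul, map_sub, Complex.add_im, smul_eq_mul, Complex.mul_im,
    Complex.I_re, Complex.I_im, Complex.sub_re, zero_mul, one_mul, zero_add] at h1 h2
  apply Complex.ext
  · simp; linarith
  · simp; linarith

theorem sqNorm_star {x : H →L[ℂ] H} (hx : x ∈ M) : sqNorm τ (star x) = sqNorm τ x := by
  rw [sqNorm, star_star, h.tracial _ hx _ (star_mem h.vna hx), sqNorm]

/-- Cauchy–Schwarz inequality. -/
theorem cauchy {x y : H →L[ℂ] H} (hx : x ∈ M) (hy : y ∈ M) :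
    ‖τ (star x * y)‖ ^ 2 ≤ sqNorm τ x * sqNorm τ y := by
  have hs := fun {z : H →L[ℂ] H} (hz : z ∈ M) => star_mem h.vna hz
  have hm := fun {z w : H →L[ℂ] H} (hz : z ∈ M) (hw : w ∈ M) => mul_mem h.vna hz hw
  let c : PreInnerProductSpace.Core ℂ (toStarSubalgebra h.vna) :=
    { inner := fun x y => τ (star (x : H →L[ℂ] H) * y)
      conj_inner_symm := fun x y => by
        have := h.map_star (hm (hs y.2) x.2)
        rw [star_mul, star_star] at this
        exact this.symm
      re_inner_nonneg := fun x => h.sqNorm_nonneg x.2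
      add_left := fun x y z => by simp [add_mul]
      smul_left := fun x y r => by simp }
  have key := @InnerProductSpace.Core.inner_mul_inner_self_le ℂ _ _ _ _ c ⟨x, hx⟩ ⟨y, hy⟩
  change ‖τ (star x * y)‖ * ‖τ (star y * x)‖ ≤ sqNorm τ x * sqNorm τ y at key
  have e : ‖τ (star y * x)‖ = ‖τ (star x * y)‖ := by
    have := h.map_star (hm (hs hx) hy)
    rw [star_mul, star_star] at this
    rw [this, norm_star]
  rw [e, ← sq] at key
  exact key

theorem sqNorm_mul_le {x y : H →L[ℂ] H} (hx : x ∈ M) (hy : y ∈ M) :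
    sqNorm τ (x * y) ≤ ‖x‖ ^ 2 * sqNorm τ y := by
  have h1 : star x * x ≤ (‖x‖ ^ 2) • (1 : H →L[ℂ] H) := by
    have := CStarAlgebra.star_mul_le_algebraMap_norm_sq (a := x)
    rwa [Algebra.algebraMap_eq_smul_one] at this
  have h2 := conj_nonneg (sub_nonneg.2 h1) y
  have hv := h.vna
  have h3 := h.pos (mul_mem hv (mul_mem hv (star_mem hv hy) (sub_mem hv (rsmul_mem hv _ hv.one_mem)
    (mul_mem hv (star_mem hv hx) hx))) hy) h2
  rw [mul_sub, sub_mul, map_sub, Complex.nonneg_iff] at h3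
  have h4 := h3.1
  have e : τ (star y * (‖x‖ ^ 2) • (1 : H →L[ℂ] H) * y) = ((‖x‖ ^ 2 : ℝ) : ℂ) * τ (star y * y) := by
    rw [← Complex.coe_smul, mul_smul_comm, smul_mul_assoc, mul_one, map_smul, smul_eq_mul]
  rw [e, Complex.sub_re, Complex.re_ofReal_mul] at h4
  simp only [sqNorm, star_mul, mul_assoc] at h4 ⊢
  linarith

theorem sqNorm_mul_le' {x y : H →L[ℂ] H} (hx : x ∈ M) (hy : y ∈ M) :
    sqNorm τ (x * y) ≤ ‖y‖ ^ 2 * sqNorm τ x := by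
  rw [← h.sqNorm_star (mul_mem h.vna hx hy), star_mul, ← h.sqNorm_star hx, ← norm_star y]
  exact h.sqNorm_mul_le (star_mem h.vna hy) (star_mem h.vna hx)

end IsTrace

theorem inner_proj_self {e : H →L[ℂ] H} (he : IsStarProjection e) (ξ : H) :
    inner ℂ ξ (e ξ) = ((‖e ξ‖ ^ 2 : ℝ) : ℂ) := by
  have h1 : inner ℂ (e ξ) (e ξ) = inner ℂ ξ (e ξ) := by
    conv_rhs => rw [← he.isIdempotentElem.eq]
    conv_lhs => rw [← he.isSelfAdjoint.star_eq]
    rw [ContinuousLinearMap.star_eq_adjoint, ContinuousLinearMap.adjoint_inner_left,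
      ← ContinuousLinearMap.star_eq_adjoint, he.isSelfAdjoint.star_eq]
    rfl
  rw [← h1, inner_self_eq_norm_sq_to_K]; simp

theorem inner_star_left (x : H →L[ℂ] H) (ξ η : H) :
    inner ℂ (star x ξ) η = inner ℂ ξ (x η) := by
  rw [ContinuousLinearMap.star_eq_adjoint, ContinuousLinearMap.adjoint_inner_left]

theorem inner_star_right (x : H →L[ℂ] H) (ξ η : H) :
    inner ℂ ξ (star x η) = inner ℂ (x ξ) η := by
  rw [ContinuousLinearMap.star_eq_adjoint, ContinuousLinearMap.adjoint_inner_right]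

theorem inner_star_mul_self (x : H →L[ℂ] H) (ξ : H) :
    inner ℂ ξ ((star x * x) ξ) = ((‖x ξ‖ ^ 2 : ℝ) : ℂ) := by
  rw [mul_apply_eq_comp, inner_star_right, inner_self_eq_norm_sq_to_K]; simp

theorem re_inner_nonneg {x : H →L[ℂ] H} (hx : 0 ≤ x) (ξ : H) : 0 ≤ (inner ℂ ξ (x ξ)).re := by
  obtain ⟨k, hk, rfl, -⟩ := exists_sqrt hx
  nth_rw 1 [← hk]
  rw [inner_star_mul_self, Complex.ofReal_re]; positivity

/-- A functional dominated by the norm of a vector valued map is given by a vector in the closure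
of the range. -/
theorem exists_riesz_vector {E : Type*} [AddCommGroup E] [Module ℂ E] (T : E →ₗ[ℂ] H)
    (f : E →ₗ[ℂ] ℂ) (C : ℝ) (h : ∀ y, ‖f y‖ ≤ C * ‖T y‖) :
    ∃ ζ ∈ T.range.topologicalClosure, ∀ y, f y = inner ℂ ζ (T y) := by
  obtain ⟨S, hS⟩ := T.rangeRestrict.exists_rightInverse_of_surjective T.range_rangeRestrict
  have hS' : ∀ y, T (S (T.rangeRestrict y)) = T y := fun y =>
    congrArg Subtype.val (LinearMap.congr_fun hS (T.rangeRestrict y))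
  have hfS : ∀ y, f (S (T.rangeRestrict y)) = f y := by
    intro y
    have := h (S (T.rangeRestrict y) - y)
    rw [map_sub, map_sub, hS', sub_self, norm_zero, mul_zero] at this
    exact sub_eq_zero.1 (norm_le_zero_iff.1 this)
  let g : T.range →L[ℂ] ℂ := LinearMap.mkContinuous (f ∘ₗ S) C (by
    rintro ⟨_, y, rfl⟩
    have := hfS y
    have h2 := h y
    rw [← this] at h2
    exact h2)
  obtain ⟨G, hG, -⟩ := exists_extension_norm_eq T.range g
  set ζ := (InnerProductSpace.toDual ℂ H).symm G with hζ
  have hGζ : ∀ w, inner ℂ ζ w = G w := fun w => by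
    rw [hζ, InnerProductSpace.toDual_symm_apply]
  set K := T.range.topologicalClosure with hK
  refine ⟨K.starProjection ζ, K.starProjection_apply_mem ζ, fun y => ?_⟩
  have hTy : K.starProjection (T y) = T y := Submodule.starProjection_eq_self_iff.2
    (Submodule.le_topologicalClosure _ (LinearMap.mem_range_self _ y))
  rw [Submodule.inner_starProjection_left_eq_right, hTy, hGζ]
  have := hG (T.rangeRestrict y)
  rw [show (G (T y) = _) from this]
  exact (hfS y).symm

/-- The vectors on which `M` acts boundedly with respect to the `2`-norm. -/
def bddVec {M : Set (H →L[ℂ] H)} {τ : (H →L[ℂ] H) →ₗ[ℂ] ℂ} (h : IsTrace M τ) :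
    Submodule ℂ H where
  carrier := {η | ∃ C : ℝ, 0 ≤ C ∧ ∀ x ∈ M, ‖x η‖ ^ 2 ≤ C * sqNorm τ x}
  zero_mem' := ⟨0, le_rfl, by simp⟩
  add_mem' := by
    rintro a b ⟨C, hC0, hC⟩ ⟨D, hD0, hD⟩
    refine ⟨2 * C + 2 * D, by positivity, fun x hx => ?_⟩
    have h1 := hC x hx
    have h2 := hD x hx
    have h3 : ‖x (a + b)‖ ≤ ‖x a‖ + ‖x b‖ := by rw [map_add]; exact norm_add_le _ _
    have h4 : ‖x (a + b)‖ ^ 2 ≤ (‖x a‖ + ‖x b‖) ^ 2 := by gcongr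
    nlinarith [sq_nonneg (‖x a‖ - ‖x b‖)]
  smul_mem' := by
    rintro c a ⟨C, hC0, hC⟩
    refine ⟨‖c‖ ^ 2 * C, by positivity, fun x hx => ?_⟩
    rw [map_smul, norm_smul, mul_pow, mul_assoc]
    gcongr
    exact hC x hx

theorem bddVec_apply_mem {M : Set (H →L[ℂ] H)} {τ : (H →L[ℂ] H) →ₗ[ℂ] ℂ} (h : IsTrace M τ)
    {η : H} (hη : η ∈ bddVec h) {m : H →L[ℂ] H} (hm : m ∈ M) : m η ∈ bddVec h := by
  obtain ⟨C, hC0, hC⟩ := hη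
  refine ⟨C * ‖m‖ ^ 2, by positivity, fun x hx => (hC _ (mul_mem h.vna hx hm)).trans ?_⟩
  rw [mul_assoc]
  gcongr
  exact h.sqNorm_mul_le' hx hm

theorem bddVec_apply_mem' {M : Set (H →L[ℂ] H)} {τ : (H →L[ℂ] H) →ₗ[ℂ] ℂ} (h : IsTrace M τ)
    {η : H} (hη : η ∈ bddVec h) {t : H →L[ℂ] H} (ht : t ∈ M.centralizer) : t η ∈ bddVec h := by
  obtain ⟨C, hC0, hC⟩ := hη
  refine ⟨‖t‖ ^ 2 * C, by positivity, fun x hx => ?_⟩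
  have : x (t η) = t (x η) := congrArg (fun f : H →L[ℂ] H => f η) (ht x hx)
  rw [this, mul_assoc]
  calc ‖t (x η)‖ ^ 2 ≤ (‖t‖ * ‖x η‖) ^ 2 := by gcongr; exact t.le_opNorm _
    _ ≤ _ := by rw [mul_pow]; gcongr; exact hC x hx

/-- In a factor, a nonzero subspace invariant under the factor and its commutant is dense. -/
theorem dense_of_invariant {M : Set (H →L[ℂ] H)} (hM : IsVonNeumannAlgebra M) (hf : IsFactor M)
    (K : Submodule ℂ H) (h1 : ∀ m ∈ M, ∀ v ∈ K, m v ∈ K)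
    (h2 : ∀ t ∈ M.centralizer, ∀ v ∈ K, t v ∈ K) {v : H} (hv : v ∈ K) (hv0 : v ≠ 0) :
    Dense (K : Set H) := by
  have hp1 := starProjection_mem hM K h2
  have hp2 := starProjection_mem (isVNA_commutant hM) K
    (by rw [hM.double_commutant]; exact h1)
  obtain ⟨c, hc⟩ := hf _ hp1 fun y hy => (hp2 y hy).symm
  have hpv : K.topologicalClosure.starProjection v = v :=
    Submodule.starProjection_eq_self_iff.2 (Submodule.le_topologicalClosure _ hv)
  have hc1 : c = 1 := by
    rw [hc] at hpv
    have : (c - 1) • v = 0 := by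
      rw [sub_smul, one_smul, sub_eq_zero]; exact hpv
    rcases smul_eq_zero.1 this with h | h
    · exact sub_eq_zero.1 h
    · exact absurd h hv0
  intro w
  rw [hc1, one_smul] at hc
  have : K.topologicalClosure.starProjection w = w := by rw [hc]; rfl
  exact Submodule.starProjection_eq_self_iff.1 this

namespace IsTrace

variable {M : Set (H →L[ℂ] H)} {τ : (H →L[ℂ] H) →ₗ[ℂ] ℂ} (h : IsTrace M τ)
include h

theorem re_pos_of_proj {e : H →L[ℂ] H} (he : e ∈ projSet M) : 0 ≤ (τ e).re :=
  (Complex.nonneg_iff.1 (h.pos he.1 (proj_nonneg he.2))).1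

theorem exists_maximal_proj (ξ : H) :
    ∃ q, Maximal (· ∈ {q | q ∈ projSet M ∧ ‖q ξ‖ ^ 2 ≤ (τ q).re}) q := by
  refine zorn_le₀ _ fun c hcs hc => ?_
  rcases c.eq_empty_or_nonempty with rfl | ⟨q₀, hq₀⟩
  · exact ⟨0, ⟨⟨zero_mem h.vna, IsStarProjection.zero _⟩, by simp⟩, by simp⟩
  have hdir : ∀ q ∈ c, ∀ q' ∈ c, ∃ q'' ∈ c, q'' * q = q ∧ q'' * q' = q' := by
    intro q hq q' hq'
    have hP := (hcs hq).1.2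
    have hP' := (hcs hq').1.2
    rcases hc.total hq hq' with hle | hle
    · exact ⟨q', hq', (hP.le_iff_mul_eq_right hP').1 hle, hP'.isIdempotentElem.eq⟩
    · exact ⟨q, hq, hP.isIdempotentElem.eq, (hP'.le_iff_mul_eq_right hP).1 hle⟩
  let K : Submodule ℂ H :=
    { carrier := {v | ∃ q ∈ c, q v = v}
      zero_mem' := ⟨q₀, hq₀, map_zero _⟩
      add_mem' := by
        rintro a b ⟨q, hq, ha⟩ ⟨q', hq', hb⟩
        obtain ⟨q'', hq'', h1, h2⟩ := hdir q hq q' hq'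
        refine ⟨q'', hq'', ?_⟩
        rw [map_add]
        conv_lhs => rw [← ha, ← hb]
        rw [← mul_apply_eq_comp, ← mul_apply_eq_comp, h1, h2, ha, hb]
      smul_mem' := by
        rintro r a ⟨q, hq, ha⟩
        exact ⟨q, hq, by rw [map_smul, ha]⟩ }
  have heM : K.topologicalClosure.starProjection ∈ M := by
    refine starProjection_mem h.vna K ?_
    rintro t ht v ⟨q, hq, hv⟩
    refine ⟨q, hq, ?_⟩
    have : q (t v) = t (q v) := congrArg (fun f : H →L[ℂ] H => f v) (ht q (hcs hq).1.1)
    rw [this, hv]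
  set e := K.topologicalClosure.starProjection with he
  have heP : IsStarProjection e := isStarProjection_starProjection
  have hle : ∀ q ∈ c, q ≤ e := by
    intro q hq
    rw [(hcs hq).1.2.le_iff_mul_eq_right heP]
    ext v
    refine Submodule.starProjection_eq_self_iff.2 (Submodule.le_topologicalClosure _ ⟨q, hq, ?_⟩)
    exact congrArg (fun f : H →L[ℂ] H => f v) (hcs hq).1.2.isIdempotentElem.eq
  refine ⟨e, ⟨⟨heM, heP⟩, ?_⟩, hle⟩
  have happrox : ∀ ε > 0, ‖e ξ‖ ≤ Real.sqrt (τ e).re + ε := by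
    intro ε hε
    have hmem : e ξ ∈ closure (K : Set H) := K.topologicalClosure.starProjection_apply_mem ξ
    obtain ⟨v, ⟨q, hq, hv⟩, hd⟩ := Metric.mem_closure_iff.1 hmem (ε / 2) (half_pos hε)
    have hqP := (hcs hq).1.2
    have h1 : q (e ξ) = q ξ := by
      have := (hqP.le_iff_mul_eq_left heP).1 (hle q hq)
      rw [← mul_apply_eq_comp, this]
    have h2 : ‖e ξ - q ξ‖ ≤ ε := by
      have e1 : e ξ - q ξ = (e ξ - v) - q (e ξ - v) := by rw [map_sub, h1, hv]; abel
      have hqn : ‖q (e ξ - v)‖ ≤ ‖e ξ - v‖ := by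
        refine (q.le_opNorm _).trans ?_
        have := IsStarProjection.norm_le q hqP
        nlinarith [norm_nonneg (e ξ - v)]
      rw [dist_eq_norm] at hd
      rw [e1]
      refine (norm_sub_le _ _).trans ?_
      linarith
    have h3 : ‖q ξ‖ ≤ Real.sqrt (τ e).re := by
      refine Real.le_sqrt_of_sq_le ((hcs hq).2.trans ?_)
      exact h.mono (hcs hq).1.1 heM (hle q hq)
    have := norm_le_norm_add_norm_sub (q ξ) (e ξ)
    rw [norm_sub_rev] at this
    have h4 : ‖e ξ‖ ≤ ‖q ξ‖ + ‖e ξ - q ξ‖ := by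
      have := norm_add_le (q ξ) (e ξ - q ξ); simpa using this
    linarith
  have h5 : ‖e ξ‖ ≤ Real.sqrt (τ e).re := le_of_forall_pos_le_add happrox
  calc ‖e ξ‖ ^ 2 ≤ Real.sqrt (τ e).re ^ 2 := by gcongr
    _ = _ := Real.sq_sqrt (h.re_pos_of_proj ⟨heM, heP⟩)

theorem proj_dominated (ξ : H) {p : H →L[ℂ] H} (hp : p ∈ projSet M)
    (hd : ∀ q ∈ projSet M, p * q = q → (τ q).re ≤ ‖q ξ‖ ^ 2) {x : H →L[ℂ] H} (hx : x ∈ M) :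
    sqNorm τ (x * p) ≤ ‖(x * p) ξ‖ ^ 2 := by
  set y := star (x * p) * (x * p) with hy
  have hv := h.vna
  have hyM : y ∈ M := mul_mem hv (star_mem hv (mul_mem hv hx hp.1)) (mul_mem hv hx hp.1)
  have hy0 : 0 ≤ y := star_mul_self_nonneg _
  have hpp := hp.2.isIdempotentElem.eq
  have hyp : y * p = y := by rw [hy, mul_assoc, mul_assoc, hpp]
  have hpy : p * y = y := by
    have := congrArg star hyp
    rwa [star_mul, hy0.isSelfAdjoint.star_eq, hp.2.isSelfAdjoint.star_eq] at this
  have hB := isVNA_vNgen {y}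
  have hyB : y ∈ vNgen {y} := subset_vNgen _ rfl
  have hBM : vNgen {y} ⊆ M := vNgen_subset hv (by simpa using hyM)
  have hcp : ∀ z ∈ vNgen {y}, Commute z p := by
    intro z hz
    refine (hz p ?_).symm
    rintro w (hw | ⟨w, hw, rfl⟩) <;> rw [Set.mem_singleton_iff] at hw <;> subst hw
    · rw [hyp, hpy]
    · rw [hy0.isSelfAdjoint.star_eq, hyp, hpy]
  have hspan : ∀ z ∈ Submodule.span NNReal (projSet (vNgen {y})),
      z ∈ vNgen {y} ∧ (τ (z * p)).re ≤ (inner ℂ ξ ((z * p) ξ)).re := by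
    intro z hz
    induction hz using Submodule.span_induction with
    | mem z hz =>
      refine ⟨hz.1, ?_⟩
      have hP : IsStarProjection (z * p) := hz.2.mul hp.2 (hcp z hz.1)
      rw [inner_proj_self hP, Complex.ofReal_re]
      refine hd _ ⟨mul_mem hv (hBM hz.1) hp.1, hP⟩ ?_
      rw [← mul_assoc, ← (hcp z hz.1).eq, mul_assoc, hpp]
    | zero => exact ⟨zero_mem hB, by simp⟩
    | add z w _ _ hz hw =>
      refine ⟨add_mem hB hz.1 hw.1, ?_⟩
      simp only [add_mul, map_add, _root_.add_apply, inner_add_right, Complex.add_re]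
      exact add_le_add hz.2 hw.2
    | smul c z _ hz =>
      have : c • z = (c : ℂ) • z := by rw [NNReal.smul_def, ← Complex.coe_smul]
      rw [this]
      refine ⟨smul_mem hB _ hz.1, ?_⟩
      simp only [smul_mul_assoc, map_smul, _root_.smul_apply, inner_smul_right,
        smul_eq_mul]
      rw [Complex.re_ofReal_mul, Complex.re_ofReal_mul]
      exact mul_le_mul_of_nonneg_left hz.2 c.2
  have hfin : (τ y).re ≤ (inner ℂ ξ (y ξ)).re := by
    refine le_of_forall_pos_le_add fun ε hε => ?_
    obtain ⟨z, hz, h1, h2⟩ := exists_span_proj_approx hB hyB hy0 hε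
    obtain ⟨hzB, hz2⟩ := hspan z hz
    have hdB := sub_mem hB hyB hzB
    have h3 := mul_proj_nonneg h1 hp.2 (hcp _ hdB)
    have h4 := re_inner_nonneg h3 ξ
    rw [sub_mul, hyp, _root_.sub_apply, inner_sub_right, Complex.sub_re] at h4
    have h5 : (y - z) * p ≤ ε • 1 := by
      have h6 := mul_proj_nonneg (sub_nonneg.2 h2) hp.2
        (((Commute.one_left p).smul_left ε).sub_left (hcp _ hdB))
      rw [sub_mul, sub_nonneg, smul_mul_assoc, one_mul] at h6
      exact h6.trans (smul_le_smul_of_nonneg_left hp.2.le_one hε.le)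
    have h6 := h.mono (mul_mem hv (hBM hdB) hp.1) (rsmul_mem hv ε hv.one_mem) h5
    rw [sub_mul, hyp, map_sub, Complex.sub_re, ← Complex.coe_smul, map_smul, h.map_one] at h6
    simp only [smul_eq_mul, mul_one, Complex.ofReal_re] at h6
    linarith
  rw [hy, inner_star_mul_self, Complex.ofReal_re] at hfin
  exact hfin

/-- Some nonzero corner of the trace is a vector functional with a bounded vector. -/
theorem exists_corner_vector [Nontrivial H] :
    ∃ p ∈ projSet M, p ≠ 0 ∧ ∃ ζ ξ : H, (∀ x ∈ M, τ (x * p) = inner ℂ ζ (x ξ)) ∧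
      ∀ x ∈ M, ‖x ζ‖ ^ 2 ≤ sqNorm τ x := by
  have hv := h.vna
  obtain ⟨ξ₁, hξ₁⟩ := exists_ne (0 : H)
  obtain ⟨ξ, hξ⟩ : ∃ ξ : H, 1 < ‖ξ‖ ^ 2 := by
    refine ⟨((2 / ‖ξ₁‖ : ℝ) : ℂ) • ξ₁, ?_⟩
    have : ‖ξ₁‖ ≠ 0 := norm_ne_zero_iff.2 hξ₁
    rw [norm_smul, Complex.norm_real, Real.norm_of_nonneg (by positivity), div_mul_cancel₀ _ this]
    norm_num
  obtain ⟨q, ⟨⟨hqM, hqP⟩, hq⟩, hmax⟩ := h.exists_maximal_proj ξ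
  set p := 1 - q with hp
  have hpM : p ∈ projSet M := ⟨sub_mem hv hv.one_mem hqM, hqP.one_sub⟩
  have hp0 : p ≠ 0 := by
    intro h0
    rw [hp, sub_eq_zero] at h0
    rw [← h0, h.map_one] at hq
    have : ‖ξ‖ ^ 2 ≤ 1 := by simpa using hq
    linarith
  have hd : ∀ r ∈ projSet M, p * r = r → (τ r).re ≤ ‖r ξ‖ ^ 2 := by
    intro r hr hpr
    by_contra! hlt
    have hqr : q * r = 0 := by
      rw [hp, sub_mul, one_mul, sub_eq_self] at hpr; exact hpr
    have hP : IsStarProjection (q + r) := hqP.add hr.2 hqr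
    have hmem : q + r ∈ {q | q ∈ projSet M ∧ ‖q ξ‖ ^ 2 ≤ (τ q).re} := by
      refine ⟨⟨add_mem hv hqM hr.1, hP⟩, ?_⟩
      have h1 := inner_proj_self hP ξ
      rw [_root_.add_apply, inner_add_right, inner_proj_self hqP,
        inner_proj_self hr.2, ← Complex.ofReal_add, Complex.ofReal_inj] at h1
      rw [_root_.add_apply, ← h1, map_add, Complex.add_re]
      exact add_le_add hq hlt.le
    have hle : q ≤ q + r := le_add_of_nonneg_right (proj_nonneg hr.2)
    have h2 : r ≤ 0 := by simpa using hmax hmem hle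
    have h3 : r = 0 := le_antisymm h2 (proj_nonneg hr.2)
    rw [h3] at hlt
    simp at hlt
  have hbd := fun x (hx : x ∈ M) => h.proj_dominated ξ hpM hd hx
  let T : toStarSubalgebra hv →ₗ[ℂ] H :=
    { toFun := fun x => ((x : H →L[ℂ] H) * p) ξ
      map_add' := fun x y => by simp
      map_smul' := fun c x => by simp }
  let f : toStarSubalgebra hv →ₗ[ℂ] ℂ :=
    { toFun := fun x => τ ((x : H →L[ℂ] H) * p)
      map_add' := fun x y => by simp [add_mul]
      map_smul' := fun c x => by simp }
  have key : ∀ w ∈ M, ∀ y ∈ M, ‖τ (star w * (y * p))‖ ≤ Real.sqrt (sqNorm τ w) * ‖(y * p) ξ‖ := by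
    intro w hw y hy
    refine le_of_sq_le_sq ?_ (by positivity)
    rw [mul_pow, Real.sq_sqrt (h.sqNorm_nonneg hw)]
    refine (h.cauchy hw (mul_mem hv hy hpM.1)).trans ?_
    exact mul_le_mul_of_nonneg_left (hbd y hy) (h.sqNorm_nonneg hw)
  have hf : ∀ y, ‖f y‖ ≤ 1 * ‖T y‖ := by
    intro y
    have := key 1 hv.one_mem y y.2
    have h1 : sqNorm τ (1 : H →L[ℂ] H) = 1 := by simp [sqNorm, h.map_one]
    rw [h1, Real.sqrt_one, star_one, one_mul] at this
    exact this
  obtain ⟨ζ, hζ, hζf⟩ := exists_riesz_vector T f 1 hf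
  have hrep : ∀ x ∈ M, τ (x * p) = inner ℂ ζ (x (p ξ)) := fun x hx => hζf ⟨x, hx⟩
  refine ⟨p, hpM, hp0, ζ, p ξ, hrep, fun x hx => ?_⟩
  have hcl : ∀ w ∈ T.range.topologicalClosure,
      ‖inner ℂ (x ζ) w‖ ≤ Real.sqrt (sqNorm τ x) * ‖w‖ := by
    intro w hw
    have hclosed : IsClosed {w : H | ‖inner ℂ (x ζ) w‖ ≤ Real.sqrt (sqNorm τ x) * ‖w‖} :=
      isClosed_le (by fun_prop) (by fun_prop)
    refine closure_minimal ?_ hclosed hw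
    rintro _ ⟨y, rfl⟩
    have h1 := hrep (star x * y) (mul_mem hv (star_mem hv hx) y.2)
    have h2 := key x hx y y.2
    rw [← mul_assoc, h1, mul_apply_eq_comp, inner_star_right] at h2
    exact h2
  have hxζ : x ζ ∈ T.range.topologicalClosure := by
    refine map_mem_closure x.continuous hζ ?_
    rintro _ ⟨y, rfl⟩
    exact ⟨⟨x * y, mul_mem hv hx y.2⟩, rfl⟩
  have h1 := hcl _ hxζ
  rw [inner_self_eq_norm_sq_to_K] at h1
  have h2 : ‖x ζ‖ ^ 2 ≤ Real.sqrt (sqNorm τ x) * ‖x ζ‖ := by simpa using h1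
  have h3 : ‖x ζ‖ ≤ Real.sqrt (sqNorm τ x) := by
    rcases (norm_nonneg (x ζ)).eq_or_lt with h0 | h0
    · rw [← h0]; positivity
    · rw [sq] at h2; exact le_of_mul_le_mul_right h2 h0
  calc ‖x ζ‖ ^ 2 ≤ Real.sqrt (sqNorm τ x) ^ 2 := by gcongr
    _ = _ := Real.sq_sqrt (h.sqNorm_nonneg hx)

/-- The bounded vectors of a finite factor are dense. -/
theorem dense_bddVec (hf : IsFactor M) : Dense (bddVec h : Set H) := by
  cases subsingleton_or_nontrivial H with
  | inl hs => exact fun w => subset_closure (by rw [Subsingleton.elim w 0]; exact (bddVec h).zero_mem)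
  | inr hn =>
    obtain ⟨p, hp, hp0, ζ, ξ, h1, h2⟩ := h.exists_corner_vector
    refine dense_of_invariant h.vna hf (bddVec h) (fun m hm v hv => bddVec_apply_mem h hv hm)
      (fun t ht v hv => bddVec_apply_mem' h hv ht) (v := ζ) ⟨1, zero_le_one, by simpa using h2⟩ ?_
    rintro rfl
    have := h1 1 h.vna.one_mem
    rw [one_mul, inner_zero_left] at this
    exact hp0 (h.eq_zero_of_nonneg hp.1 (proj_nonneg hp.2) this)

end IsTrace

/-- Convergence in the weak operator topology. -/
def WOTLim {ι : Type*} (l : Filter ι) (x : ι → H →L[ℂ] H) (y : H →L[ℂ] H) : Prop :=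
  ∀ ξ η, Tendsto (fun i => inner ℂ ξ (x i η)) l (𝓝 (inner ℂ ξ (y η)))

theorem nonneg_of_inner {y : H →L[ℂ] H} (h : ∀ ξ, 0 ≤ inner ℂ ξ (y ξ)) : 0 ≤ y := by
  rw [ContinuousLinearMap.nonneg_iff_isPositive, ContinuousLinearMap.isPositive_iff_complex]
  intro ξ
  have h1 := h ξ
  rw [← inner_conj_symm, Complex.nonneg_iff] at h1
  simp only [Complex.conj_re, Complex.conj_im] at h1
  exact ⟨Complex.ext rfl (by simp; linarith [h1.2]), h1.1⟩

namespace WOTLim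

variable {ι : Type*} {l : Filter ι} {x : ι → H →L[ℂ] H} {y : H →L[ℂ] H}

theorem mul_left (h : WOTLim l x y) (a : H →L[ℂ] H) : WOTLim l (fun i => a * x i) (a * y) := by
  intro ξ η
  simpa only [mul_apply_eq_comp, ← inner_star_left] using h (star a ξ) η

theorem mul_right (h : WOTLim l x y) (a : H →L[ℂ] H) : WOTLim l (fun i => x i * a) (y * a) :=
  fun ξ η => h ξ (a η)

theorem congr {x' : ι → H →L[ℂ] H} (h : WOTLim l x y) (hx : ∀ᶠ i in l, x i = x' i) :
    WOTLim l x' y := fun ξ η => (h ξ η).congr' (hx.mono fun i hi => by rw [hi])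

theorem unique [l.NeBot] {y' : H →L[ℂ] H} (h : WOTLim l x y) (h' : WOTLim l x y') : y = y' := by
  ext η
  exact ext_inner_left ℂ fun ξ => tendsto_nhds_unique (h ξ η) (h' ξ η)

theorem const (y : H →L[ℂ] H) : WOTLim l (fun _ => y) y := fun _ _ => tendsto_const_nhds

theorem mem [l.NeBot] {M : Set (H →L[ℂ] H)} (hM : IsVonNeumannAlgebra M) (h : WOTLim l x y)
    (hx : ∀ᶠ i in l, x i ∈ M) : y ∈ M := by
  refine mem_of_commute hM fun t ht => ?_
  refine (h.mul_left t).unique ((h.mul_right t).congr ?_)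
  filter_upwards [hx] with i hi
  exact ht _ hi

theorem nonneg [l.NeBot] (h : WOTLim l x y) (hx : ∀ᶠ i in l, 0 ≤ x i) : 0 ≤ y := by
  refine nonneg_of_inner fun ξ => ge_of_tendsto (h ξ ξ) ?_
  filter_upwards [hx] with i hi
  obtain ⟨k, hk, hkk, -⟩ := exists_sqrt hi
  rw [← hkk]
  nth_rw 1 [← hk]
  rw [inner_star_mul_self]
  exact_mod_cast sq_nonneg ‖k ξ‖

theorem norm_le [l.NeBot] (h : WOTLim l x y) {r : ℝ} (hr : 0 ≤ r) (hx : ∀ᶠ i in l, ‖x i‖ ≤ r) :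
    ‖y‖ ≤ r := by
  refine ContinuousLinearMap.opNorm_le_bound _ hr fun η => ?_
  have h1 : ‖(inner ℂ (y η) (y η) : ℂ)‖ ≤ ‖y η‖ * (r * ‖η‖) := by
    refine le_of_tendsto (h (y η) η).norm ?_
    filter_upwards [hx] with i hi
    refine (norm_inner_le_norm _ _).trans ?_
    gcongr
    exact ((x i).le_opNorm η).trans (by gcongr)
  rw [inner_self_eq_norm_sq_to_K] at h1
  have h2 : ‖y η‖ * ‖y η‖ ≤ ‖y η‖ * (r * ‖η‖) := by simpa [sq] using h1
  rcases (norm_nonneg (y η)).eq_or_lt with h0 | h0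
  · rw [← h0]; positivity
  · exact le_of_mul_le_mul_left h2 h0

end WOTLim

/-- The matrix coefficient `x ↦ ⟪ζ, x ξ⟫`. -/
def vecFunctional (ζ ξ : H) : (H →L[ℂ] H) →ₗ[ℂ] ℂ where
  toFun x := inner ℂ ζ (x ξ)
  map_add' x y := by simp
  map_smul' c x := by simp

theorem vecFunctional_apply (ζ ξ : H) (x : H →L[ℂ] H) :
    vecFunctional ζ ξ x = inner ℂ ζ (x ξ) := rfl

variable (H) in
/-- The linear functionals continuous for the weak operator topology. -/
def wotDual : Submodule ℂ ((H →L[ℂ] H) →ₗ[ℂ] ℂ) :=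
  Submodule.span ℂ (Set.range fun p : H × H => vecFunctional p.1 p.2)

theorem WOTLim.tendsto {ι : Type*} {l : Filter ι} {x : ι → H →L[ℂ] H} {y : H →L[ℂ] H}
    (h : WOTLim l x y) {f : (H →L[ℂ] H) →ₗ[ℂ] ℂ} (hf : f ∈ wotDual H) :
    Tendsto (fun i => f (x i)) l (𝓝 (f y)) := by
  induction hf using Submodule.span_induction with
  | mem f hf => obtain ⟨p, rfl⟩ := hf; exact h p.1 p.2
  | zero => exact tendsto_const_nhds
  | add f g _ _ hf hg => exact hf.add hg
  | smul c f _ hf => exact hf.const_mul c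

theorem wotDual_conj {f : (H →L[ℂ] H) →ₗ[ℂ] ℂ} (hf : f ∈ wotDual H) (a b : H →L[ℂ] H) :
    ∃ g ∈ wotDual H, ∀ x, g x = f (a * x * b) := by
  induction hf using Submodule.span_induction with
  | mem f hf =>
    obtain ⟨p, rfl⟩ := hf
    refine ⟨vecFunctional (star a p.1) (b p.2), Submodule.subset_span ⟨(_, _), rfl⟩, fun x => ?_⟩
    rw [vecFunctional_apply, inner_star_left]; rfl
  | zero => exact ⟨0, Submodule.zero_mem _, fun _ => rfl⟩
  | add f g _ _ hf hg =>
    obtain ⟨f', hf', h1⟩ := hf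
    obtain ⟨g', hg', h2⟩ := hg
    exact ⟨f' + g', Submodule.add_mem _ hf' hg', fun x => by simp [h1, h2]⟩
  | smul c f _ hf =>
    obtain ⟨f', hf', h1⟩ := hf
    exact ⟨c • f', Submodule.smul_mem _ c hf', fun x => by simp [h1]⟩

/-- A bounded set of families of operators closed in the weak operator topology has extreme
points. -/
theorem exists_extreme_family {J : Type*} {S : Set (J → H →L[ℂ] H)} (hne : S.Nonempty) {r : ℝ}
    (hr0 : 0 ≤ r) (hr : ∀ x ∈ S, ∀ j, ‖x j‖ ≤ r)
    (hcl : ∀ (U : Ultrafilter (J → H →L[ℂ] H)) (y : J → H →L[ℂ] H), (∀ᶠ x in U, x ∈ S) →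
      (∀ j, WOTLim (U : Filter (J → H →L[ℂ] H)) (fun x => x j) (y j)) → y ∈ S) :
    ∃ v ∈ S, ∀ y, v + y ∈ S → v - y ∈ S → y = 0 := by
  obtain ⟨s₀, hs₀⟩ := hne
  let Φ : (J → H →L[ℂ] H) → (J → H → H → ℂ) := fun x j ξ η => inner ℂ ξ (x j η)
  have hΦ : Function.Injective Φ := fun x y hxy => by
    ext j η
    exact ext_inner_left ℂ fun ξ => congrFun (congrFun (congrFun hxy j) ξ) η
  have hcomp : IsCompact (Φ '' S) := by
    rw [isCompact_iff_ultrafilter_le_nhds]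
    intro f hf
    have hg : ∀ φ : J → H → H → ℂ, ∃ x ∈ S, φ ∈ Φ '' S → Φ x = φ := by
      intro φ
      by_cases hφ : φ ∈ Φ '' S
      · obtain ⟨x, hx, hxφ⟩ := hφ
        exact ⟨x, hx, fun _ => hxφ⟩
      · exact ⟨s₀, hs₀, fun h => absurd h hφ⟩
    choose g hgS hgΦ using hg
    choose y _ hy using fun j => exists_wot_limit f (fun φ => g φ j) hr0 fun i => hr _ (hgS i) j
    have hyS : y ∈ S := by
      refine hcl (f.map g) y ?_ ?_
      · rw [Ultrafilter.coe_map, eventually_map]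
        exact Eventually.of_forall hgS
      · intro j ξ η
        rw [Ultrafilter.coe_map, tendsto_map'_iff]
        exact hy j ξ η
    refine ⟨Φ y, ⟨y, hyS, rfl⟩, ?_⟩
    have : Tendsto id (f : Filter (J → H → H → ℂ)) (𝓝 (Φ y)) := by
      rw [tendsto_pi_nhds]
      intro j
      rw [tendsto_pi_nhds]
      intro ξ
      rw [tendsto_pi_nhds]
      intro η
      refine (hy j ξ η).congr' ?_
      filter_upwards [hf (mem_principal_self _)] with φ hφ
      exact congrFun (congrFun (congrFun (hgΦ φ hφ) j) ξ) η
    exact this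
  obtain ⟨_, hv⟩ := hcomp.extremePoints_nonempty ⟨_, s₀, hs₀, rfl⟩
  rw [mem_extremePoints] at hv
  obtain ⟨⟨v, hvS, rfl⟩, hext⟩ := hv
  refine ⟨v, hvS, fun y h1 h2 => ?_⟩
  have := hext _ ⟨_, h1, rfl⟩ _ ⟨_, h2, rfl⟩ ⟨1 / 2, 1 / 2, by norm_num, by norm_num, by norm_num, by
    funext j ξ η
    simp only [Φ, Pi.add_apply, Pi.sub_apply, Pi.smul_apply, _root_.add_apply, _root_.sub_apply,
      inner_add_right, inner_sub_right, Complex.real_smul]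
    push_cast
    ring⟩
  have := hΦ this.1
  simpa using this

/-- A bounded set of operators closed in the weak operator topology has extreme points. -/
theorem exists_extreme {S : Set (H →L[ℂ] H)} (hne : S.Nonempty) {r : ℝ} (hr0 : 0 ≤ r)
    (hr : ∀ x ∈ S, ‖x‖ ≤ r)
    (hcl : ∀ (U : Ultrafilter (H →L[ℂ] H)) (y : H →L[ℂ] H), (∀ᶠ x in U, x ∈ S) →
      WOTLim (U : Filter (H →L[ℂ] H)) id y → y ∈ S) :
    ∃ v ∈ S, ∀ y, v + y ∈ S → v - y ∈ S → y = 0 := by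
  obtain ⟨v, hv, h⟩ := exists_extreme_family (S := {x : Unit → H →L[ℂ] H | x () ∈ S})
    (let ⟨x, hx⟩ := hne; ⟨fun _ => x, hx⟩) hr0 (fun x hx _ => hr _ hx) (by
      intro U y hU hy
      refine hcl (U.map fun x => x ()) _ (by
        rw [Ultrafilter.coe_map, eventually_map]; exact hU) ?_
      intro ξ η
      rw [Ultrafilter.coe_map, tendsto_map'_iff]
      exact hy () ξ η)
  exact ⟨v (), hv, fun y h1 h2 => congrFun (h (fun _ => y) h1 h2) ()⟩

theorem norm_le_one_of_star_mul {z : H →L[ℂ] H} (h : star z * z ≤ 1) : ‖z‖ ≤ 1 := by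
  have h1 := (CStarAlgebra.norm_le_one_iff_of_nonneg _ (star_mul_self_nonneg z)).2 h
  rw [CStarRing.norm_star_mul_self] at h1
  nlinarith [norm_nonneg z]

theorem star_mul_self_le {z : H →L[ℂ] H} {r : ℝ} (h : ‖z‖ ≤ r) :
    star z * z ≤ (r ^ 2) • 1 := by
  have h1 := CStarAlgebra.star_mul_le_algebraMap_norm_sq (a := z)
  rw [Algebra.algebraMap_eq_smul_one] at h1
  exact h1.trans (smul_le_smul_of_nonneg_right (by gcongr) zero_le_one)

theorem star_mul_self_le_one {z : H →L[ℂ] H} (h : ‖z‖ ≤ 1) : star z * z ≤ 1 := by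
  simpa using star_mul_self_le h

/-- In a factor, `f M e = 0` forces `f = 0` or `e = 0`. -/
theorem eq_zero_or_of_factor {M : Set (H →L[ℂ] H)} (hM : IsVonNeumannAlgebra M) (hf : IsFactor M)
    {e f : H →L[ℂ] H} (hfM : f ∈ M) (h : ∀ m ∈ M, f * m * e = 0) :
    f = 0 ∨ e = 0 := by
  by_contra! hcon
  obtain ⟨hf0, he0⟩ := hcon
  obtain ⟨ξ, hξ⟩ : ∃ ξ, e ξ ≠ 0 := by
    by_contra! h0
    exact he0 (by ext ξ; simpa using h0 ξ)
  let K : Submodule ℂ H :=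
    { carrier := {w | ∀ m ∈ M, f (m w) = 0}
      zero_mem' := by simp
      add_mem' := fun ha hb m hm => by rw [map_add, map_add, ha m hm, hb m hm, add_zero]
      smul_mem' := fun c a ha m hm => by rw [map_smul, map_smul, ha m hm, smul_zero] }
  have hd : Dense (K : Set H) := by
    refine dense_of_invariant hM hf K (fun m hm v hv m' hm' => hv (m' * m) (mul_mem hM hm' hm))
      (fun t ht v hv m hm => ?_) (v := e ξ) (fun m hm => ?_) hξ
    · have h1 : m (t v) = t (m v) := congrArg (fun f : H →L[ℂ] H => f v) (ht m hm)
      have h2 : f (t (m v)) = t (f (m v)) := congrArg (fun g : H →L[ℂ] H => g (m v)) (ht f hfM)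
      rw [h1, h2, hv m hm, map_zero]
    · exact congrArg (fun g : H →L[ℂ] H => g ξ) (h m hm)
  refine hf0 ?_
  ext w
  have hcl : IsClosed {w | f w = 0} := isClosed_eq f.continuous continuous_const
  have hsub : (K : Set H) ⊆ {w | f w = 0} := fun v hv => hv 1 hM.one_mem
  exact closure_minimal hsub hcl (hd w)

/-- Comparison of projections in a factor. -/
theorem exists_comparison {M : Set (H →L[ℂ] H)} (hM : IsVonNeumannAlgebra M) (hf : IsFactor M)
    {p r : H →L[ℂ] H} (hp : p ∈ projSet M) (hr : r ∈ projSet M) :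
    ∃ v ∈ M, v * p = v ∧ r * v = v ∧ v * star v * v = v ∧ (star v * v = p ∨ v * star v = r) := by
  have hpp := hp.2.isIdempotentElem.eq
  have hrr := hr.2.isIdempotentElem.eq
  have hps := hp.2.isSelfAdjoint.star_eq
  have hrs := hr.2.isSelfAdjoint.star_eq
  obtain ⟨v, ⟨hvM, hv1, hvp, hrv⟩, hext⟩ :=
    exists_extreme (S := {x | x ∈ M ∧ ‖x‖ ≤ 1 ∧ x * p = x ∧ r * x = x}) (r := 1)
      ⟨0, zero_mem hM, by simp, by simp, by simp⟩ zero_le_one (fun x hx => hx.2.1) (by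
        intro U y hU hy
        have h1 : ∀ᶠ x in (U : Filter (H →L[ℂ] H)), id x ∈ M := hU.mono fun x hx => hx.1
        have h2 : ∀ᶠ x in (U : Filter (H →L[ℂ] H)), ‖id x‖ ≤ 1 := hU.mono fun x hx => hx.2.1
        exact ⟨hy.mem hM h1, hy.norm_le zero_le_one h2,
          (hy.mul_right p).unique (hy.congr (hU.mono fun x hx => hx.2.2.1.symm)),
          (hy.mul_left r).unique (hy.congr (hU.mono fun x hx => hx.2.2.2.symm))⟩)
  set d := star v * v with hd
  have hdM : d ∈ M := mul_mem hM (star_mem hM hvM) hvM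
  have hd0 : 0 ≤ d := star_mul_self_nonneg v
  have hd1 : d ≤ 1 := star_mul_self_le_one hv1
  have hds : star d = d := hd0.isSelfAdjoint.star_eq
  have hdp : d * p = d := by rw [hd, mul_assoc, hvp]
  have hpd : p * d = d := by
    have := congrArg star hdp
    rwa [star_mul, hds, hps] at this
  have hsub : star (1 - d) = 1 - d := by rw [star_sub, star_one, hds]
  set b : H →L[ℂ] H := (1 / 2 : ℝ) • (1 - d) with hb
  have hbs : star b = b := by rw [hb, star_smul, hsub]; simp
  have hbM : b ∈ M := rsmul_mem hM _ (sub_mem hM hM.one_mem hdM)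
  have hbp : b * p = p * b := by
    simp only [hb, smul_mul_assoc, mul_smul_comm, sub_mul, mul_sub, one_mul, mul_one, hdp, hpd]
  have hvbp : v * b * p = v * b := by rw [mul_assoc, hbp, ← mul_assoc, hvp]
  have hrvb : r * (v * b) = v * b := by rw [← mul_assoc, hrv]
  have hvb : v * b = 0 := by
    refine hext _ ⟨add_mem hM hvM (mul_mem hM hvM hbM), ?_, ?_, ?_⟩
      ⟨sub_mem hM hvM (mul_mem hM hvM hbM), ?_, ?_, ?_⟩
    · refine norm_le_one_of_star_mul ?_
      have h4 : 0 ≤ (4 : ℝ) • (1 : H →L[ℂ] H) - d := by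
        have : (1 : H →L[ℂ] H) ≤ (4 : ℝ) • 1 := by
          conv_lhs => rw [← one_smul ℝ (1 : H →L[ℂ] H)]
          exact smul_le_smul_of_nonneg_right (by norm_num) zero_le_one
        exact sub_nonneg.2 (hd1.trans this)
      have h5 := conj_nonneg h4 (1 - d)
      rw [hsub] at h5
      have h6 : 1 - star (v + v * b) * (v + v * b) =
          (1 / 4 : ℝ) • ((1 - d) * ((4 : ℝ) • (1 : H →L[ℂ] H) - d) * (1 - d)) := by
        have e1 : star (v + v * b) * (v + v * b) = (1 + b) * d * (1 + b) := by
          rw [star_add, star_mul, hbs, hd]; noncomm_ring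
        rw [e1, hb]
        simp only [add_mul, mul_add, sub_mul, mul_sub, one_mul, mul_one, smul_mul_assoc,
          mul_smul_comm, smul_sub, smul_add, smul_smul, mul_assoc]
        module
      rw [← sub_nonneg, h6]
      exact smul_nonneg (by norm_num) h5
    · rw [add_mul, hvp, hvbp]
    · rw [mul_add, hrv, hrvb]
    · have e1 : v - v * b = v * ((1 / 2 : ℝ) • (1 + d)) := by
        rw [hb]; simp only [mul_smul_comm, mul_add, mul_sub, mul_one]; module
      have hn : ‖(1 : H →L[ℂ] H)‖ ≤ 1 := IsStarProjection.norm_le _ (IsStarProjection.one _)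
      have hdn : ‖d‖ ≤ 1 := (CStarAlgebra.norm_le_one_iff_of_nonneg _ hd0).2 hd1
      rw [e1]
      refine (norm_mul_le _ _).trans ?_
      rw [norm_smul]
      have := norm_add_le (1 : H →L[ℂ] H) d
      have h2 : ‖(1 / 2 : ℝ)‖ = 1 / 2 := by norm_num
      rw [h2]
      nlinarith [norm_nonneg v, norm_nonneg (1 + d)]
    · rw [sub_mul, hvp, hvbp]
    · rw [mul_sub, hrv, hrvb]
  have hvd : v * d = v := by
    rw [hb, mul_smul_comm, smul_eq_zero] at hvb
    rcases hvb with h0 | h0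
    · norm_num at h0
    · rw [mul_sub, mul_one, sub_eq_zero] at h0; exact h0.symm
  have hdd : d * d = d := by rw [hd, mul_assoc, hvd]
  have hsv : star v * r = star v := by
    have := congrArg star hrv
    rwa [star_mul, hrs] at this
  have hsd : star v * (v * star v) = star v := by
    have := congrArg star hvd
    rw [star_mul, hds] at this
    rw [← mul_assoc]; exact this
  have hpdP : IsStarProjection (p - d) := by
    refine ⟨?_, ?_⟩
    · rw [IsIdempotentElem, sub_mul, mul_sub, mul_sub, hpp, hpd, hdp, hdd]; abel
    · rw [IsSelfAdjoint, star_sub, hps, hds]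
  have hzero : ∀ m ∈ M, (r - v * star v) * m * (p - d) = 0 := by
    intro m hm
    set y₀ := (r - v * star v) * m * (p - d) with hy₀
    have hy₀M : y₀ ∈ M := mul_mem hM (mul_mem hM (sub_mem hM hr.1
      (mul_mem hM hvM (star_mem hM hvM))) hm) (sub_mem hM hp.1 hdM)
    set y : H →L[ℂ] H := ((‖y₀‖ + 1)⁻¹ : ℝ) • y₀ with hy
    have hpos : 0 < ‖y₀‖ + 1 := by positivity
    have hyM : y ∈ M := rsmul_mem hM _ hy₀M
    have hyn : ‖y‖ ≤ 1 := by
      rw [hy, norm_smul, Real.norm_of_nonneg (by positivity), inv_mul_le_iff₀ hpos]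
      linarith [norm_nonneg y₀]
    have hvy : star v * y = 0 := by
      have e : star v * (r - v * star v) = 0 := by rw [mul_sub, hsv, hsd, sub_self]
      have e' : star v * y₀ = 0 := by rw [hy₀, ← mul_assoc, ← mul_assoc, e, zero_mul, zero_mul]
      rw [hy, mul_smul_comm, e', smul_zero]
    have hyv : star y * v = 0 := by
      have := congrArg star hvy
      simpa using this
    have hypd : y * (p - d) = y := by
      have e : y₀ * (p - d) = y₀ := by rw [hy₀, mul_assoc _ (p - d), hpdP.isIdempotentElem.eq]
      rw [hy, smul_mul_assoc, e]
    have hyp : y * p = y := by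
      rw [← hypd, mul_assoc, sub_mul, hpp, hdp]
    have hry : r * y = y := by
      have e : r * (r - v * star v) = r - v * star v := by rw [mul_sub, hrr, ← mul_assoc, hrv]
      have e' : r * y₀ = y₀ := by rw [hy₀, ← mul_assoc, ← mul_assoc, e]
      rw [hy, mul_smul_comm, e']
    have hyy : star y * y ≤ p - d := by
      have h1 := conj_nonneg (sub_nonneg.2 (star_mul_self_le_one hyn)) (p - d)
      have e : (p - d) * (1 - star y * y) * (p - d) =
          (p - d) - (p - d) * (star y * y) * (p - d) := by
        rw [mul_sub (p - d) 1, mul_one, sub_mul _ _ (p - d), hpdP.isIdempotentElem.eq]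
      rw [hpdP.isSelfAdjoint.star_eq, e, sub_nonneg] at h1
      have h2 : (p - d) * (star y * y) * (p - d) = star y * y := by
        have := congrArg star hypd
        rw [star_mul, hpdP.isSelfAdjoint.star_eq] at this
        rw [← mul_assoc, this, mul_assoc, hypd]
      rwa [h2] at h1
    have hfin : d + star y * y ≤ 1 := by
      have := add_le_add_right hyy d
      refine this.trans ?_
      rw [add_sub_cancel]
      exact hp.2.le_one
    have : y = 0 := by
      refine hext y ⟨add_mem hM hvM hyM, ?_, ?_, ?_⟩ ⟨sub_mem hM hvM hyM, ?_, ?_, ?_⟩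
      · refine norm_le_one_of_star_mul ?_
        rw [star_add, add_mul, mul_add, mul_add, hvy, hyv, add_zero, zero_add]
        exact hfin
      · rw [add_mul, hvp, hyp]
      · rw [mul_add, hrv, hry]
      · refine norm_le_one_of_star_mul ?_
        rw [star_sub, sub_mul, mul_sub, mul_sub, hvy, hyv, sub_zero, zero_sub, sub_neg_eq_add]
        exact hfin
      · rw [sub_mul, hvp, hyp]
      · rw [mul_sub, hrv, hry]
    rw [hy, smul_eq_zero] at this
    rcases this with h0 | h0
    · exact absurd h0 (by positivity)
    · exact h0
  refine ⟨v, hvM, hvp, hrv, by rw [mul_assoc]; exact hvd, ?_⟩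
  rcases eq_zero_or_of_factor hM hf (sub_mem hM hr.1
    (mul_mem hM hvM (star_mem hM hvM))) hzero with h0 | h0
  · exact Or.inr (sub_eq_zero.1 h0).symm
  · exact Or.inl (sub_eq_zero.1 h0).symm

/-- A trace continuous for the weak operator topology, with a dense set of bounded vectors. -/
structure IsNormalTrace (M : Set (H →L[ℂ] H)) (τ : (H →L[ℂ] H) →ₗ[ℂ] ℂ) : Prop
    extends IsTrace M τ where
  wot : τ ∈ wotDual H
  dense : Dense (bddVec toIsTrace : Set H)

/-- The trace of a finite factor is weakly continuous. -/
theorem IsTrace.exists_wot [Nontrivial H] {M : Set (H →L[ℂ] H)} {τ : (H →L[ℂ] H) →ₗ[ℂ] ℂ}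
    (h : IsTrace M τ) (hf : IsFactor M) : ∃ f ∈ wotDual H, ∀ x ∈ M, τ x = f x := by
  have hv := h.vna
  obtain ⟨p, hp, hp0, ζ, ξ, hrep, -⟩ := h.exists_corner_vector
  have hτp : 0 < (τ p).re := by
    refine lt_of_le_of_ne (h.re_pos_of_proj hp) fun h0 => hp0 ?_
    refine h.eq_zero_of_nonneg hp.1 (proj_nonneg hp.2) (Complex.ext h0.symm ?_)
    exact h.im_eq_zero hp.1 hp.2.isSelfAdjoint
  have hW : vecFunctional ζ ξ ∈ wotDual H := Submodule.subset_span ⟨(ζ, ξ), rfl⟩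
  have key : ∀ n : ℕ, ∀ r ∈ projSet M, (τ r).re < n * (τ p).re →
      ∃ f ∈ wotDual H, ∀ x ∈ M, τ (x * r) = f x := by
    intro n
    induction n with
    | zero =>
      intro r hr hlt
      have := h.re_pos_of_proj hr
      simp at hlt
      linarith
    | succ n ih =>
      intro r hr hlt
      obtain ⟨v, hvM, hvp, hrv, hvvv, hor⟩ := exists_comparison hv hf hp hr
      have hsvM := star_mem hv hvM
      obtain ⟨g, hg, hgx⟩ := wotDual_conj hW (star v) v
      have h1 : ∀ x ∈ M, τ (x * (v * star v)) = g x := by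
        intro x hx
        have e1 : x * (v * star v) = (x * v) * star v := by rw [mul_assoc]
        have e2 : star v * (x * v) = star v * x * v * p := by
          rw [mul_assoc _ v p, hvp, mul_assoc]
        rw [hgx, vecFunctional_apply, ← hrep _ (mul_mem hv (mul_mem hv hsvM hx) hvM), e1,
          h.tracial _ (mul_mem hv hx hvM) _ hsvM, e2]
      rcases hor with hvv | hvv
      · have hq : IsStarProjection (v * star v) :=
          ⟨by rw [IsIdempotentElem, ← mul_assoc, hvvv], IsSelfAdjoint.mul_star_self v⟩
        have hqM : v * star v ∈ M := mul_mem hv hvM hsvM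
        have hle : v * star v ≤ r := (hq.le_iff_mul_eq_right hr.2).2 (by rw [← mul_assoc, hrv])
        have hP : IsStarProjection (r - v * star v) := (hq.le_iff_sub hr.2).1 hle
        obtain ⟨f, hf', hfx⟩ := ih (r - v * star v) ⟨sub_mem hv hr.1 hqM, hP⟩ (by
          rw [map_sub, h.tracial _ hvM _ hsvM, hvv, Complex.sub_re]
          push_cast at hlt
          linarith)
        refine ⟨f + g, Submodule.add_mem _ hf' hg, fun x hx => ?_⟩
        rw [LinearMap.add_apply, ← hfx x hx, ← h1 x hx, mul_sub, map_sub, sub_add_cancel]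
      · exact ⟨g, hg, fun x hx => by rw [← h1 x hx, hvv]⟩
  obtain ⟨n, hn⟩ := exists_nat_gt ((τ 1).re / (τ p).re)
  obtain ⟨f, hf', hfx⟩ := key n 1 ⟨hv.one_mem, IsStarProjection.one _⟩
    (by rwa [div_lt_iff₀ hτp] at hn)
  exact ⟨f, hf', fun x hx => by rw [← hfx x hx, mul_one]⟩

theorem exists_isNormalTrace {M : Set (H →L[ℂ] H)} {τ : (H →L[ℂ] H) → ℂ} (hM : IsII1Factor M τ) :
    ∃ σ : (H →L[ℂ] H) →ₗ[ℂ] ℂ, (∀ x ∈ M, σ x = τ x) ∧ IsNormalTrace M σ := by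
  obtain ⟨σ, hσ, h⟩ := exists_isTrace hM.vna hM.trace
  have hn : Nontrivial H := by
    by_contra hs
    rw [not_nontrivial_iff_subsingleton] at hs
    have : (1 : H →L[ℂ] H) = 0 := by ext w; exact Subsingleton.elim _ _
    have h1 := h.map_one
    rw [this, map_zero] at h1
    exact zero_ne_one h1
  obtain ⟨f, hf, hfx⟩ := h.exists_wot hM.factor
  have hv := hM.vna
  have h' : IsTrace M f :=
    { vna := hv
      map_one := by rw [← hfx _ hv.one_mem, h.map_one]
      nonneg := fun x hx => by
        rw [← hfx _ (mul_mem hv (star_mem hv hx) hx)]; exact h.nonneg x hx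
      tracial := fun x hx y hy => by
        rw [← hfx _ (mul_mem hv hx hy), ← hfx _ (mul_mem hv hy hx)]; exact h.tracial x hx y hy
      faithful := fun x hx h0 => h.faithful x hx (by
        rw [hfx _ (mul_mem hv (star_mem hv hx) hx), h0]) }
  exact ⟨f, fun x hx => by rw [← hfx x hx, hσ x hx], h', hf, h'.dense_bddVec hM.factor⟩

section Density

variable {ι : Type*} [Fintype ι]

/-- The diagonal action of an operator on a finite power of `H`. -/
def amp (ι : Type*) [Fintype ι] (x : H →L[ℂ] H) :
    PiLp 2 (fun _ : ι => H) →L[ℂ] PiLp 2 (fun _ : ι => H) :=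
  ((PiLp.continuousLinearEquiv 2 ℂ (fun _ : ι => H)).symm : _ →L[ℂ] PiLp 2 (fun _ : ι => H)) ∘L
    ContinuousLinearMap.pi fun i => x ∘L PiLp.proj 2 (fun _ : ι => H) i

theorem amp_apply (x : H →L[ℂ] H) (v : PiLp 2 (fun _ : ι => H)) (i : ι) :
    amp ι x v i = x (v i) := rfl

theorem star_amp (x : H →L[ℂ] H) : star (amp ι x) = amp ι (star x) := by
  rw [ContinuousLinearMap.star_eq_adjoint, eq_comm, ContinuousLinearMap.eq_adjoint_iff]
  intro v w
  simp only [PiLp.inner_apply, amp_apply, inner_star_left]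

/-- Von Neumann's density theorem for finitely many vectors. -/
theorem exists_approx (S : StarSubalgebra ℂ (H →L[ℂ] H)) {x : H →L[ℂ] H}
    (hx : x ∈ (S : Set (H →L[ℂ] H)).centralizer.centralizer) (η : ι → H) {ε : ℝ} (hε : 0 < ε) :
    ∃ y ∈ S, ∑ i, ‖(x - y) (η i)‖ ^ 2 < ε := by
  classical
  let E := PiLp 2 (fun _ : ι => H)
  let η' : E := WithLp.toLp 2 η
  let K : Submodule ℂ E :=
    { carrier := {v | ∃ y ∈ S, amp ι y η' = v}
      zero_mem' := ⟨0, S.zero_mem, by ext i; simp [amp_apply]⟩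
      add_mem' := by
        rintro _ _ ⟨y, hy, rfl⟩ ⟨z, hz, rfl⟩
        exact ⟨y + z, S.add_mem hy hz, by ext i; rfl⟩
      smul_mem' := by
        rintro c _ ⟨y, hy, rfl⟩
        exact ⟨c • y, S.smul_mem hy c, by ext i; rfl⟩ }
  have hKinv : ∀ s ∈ S, ∀ v ∈ K.topologicalClosure, amp ι s v ∈ K.topologicalClosure := by
    intro s hs v hv
    refine map_mem_closure (amp ι s).continuous hv ?_
    rintro _ ⟨y, hy, rfl⟩
    exact ⟨s * y, S.mul_mem hs hy, rfl⟩
  set P := K.topologicalClosure.starProjection with hP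
  have hPc : ∀ s ∈ S, ∀ v, amp ι s (P v) = P (amp ι s v) := by
    intro s hs v
    have := commute_starProjection K.topologicalClosure (hKinv s hs) (by
      rw [star_amp]; exact hKinv _ (S.star_mem' hs))
    exact congrArg (fun f : E →L[ℂ] E => f v) this.eq
  let inc : ι → H →L[ℂ] E := fun k =>
    ((PiLp.continuousLinearEquiv 2 ℂ (fun _ : ι => H)).symm : _ →L[ℂ] E) ∘L
      ContinuousLinearMap.single ℂ (fun _ : ι => H) k
  have hinc : ∀ (s : H →L[ℂ] H) k v, amp ι s (inc k v) = inc k (s v) := by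
    intro s k v
    ext i
    change s ((Pi.single k v : ι → H) i) = (Pi.single k (s v) : ι → H) i
    rcases eq_or_ne i k with rfl | hik
    · simp
    · simp [hik]
  have hsum : ∀ v : E, v = ∑ k, inc k (v k) := by
    intro v
    ext i
    rw [WithLp.ofLp_sum, Finset.sum_apply]
    change v i = ∑ k, (Pi.single k (v k) : ι → H) i
    rw [← Finset.sum_apply, Finset.univ_sum_single]
  have hPx : ∀ v, P (amp ι x v) = amp ι x (P v) := by
    have h1 : ∀ k v, P (inc k (x v)) = amp ι x (P (inc k v)) := by
      intro k v
      ext j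
      let t : H →L[ℂ] H := PiLp.proj 2 (fun _ : ι => H) j ∘L P ∘L inc k
      have ht : t ∈ (S : Set (H →L[ℂ] H)).centralizer := by
        intro s hs
        ext w
        change s (P (inc k w) j) = P (inc k (s w)) j
        rw [← hinc, ← hPc s hs, amp_apply]
      exact congrArg (fun f : H →L[ℂ] H => f v) (hx t ht)
    intro v
    conv_lhs => rw [hsum v]
    conv_rhs => rw [hsum v]
    rw [map_sum, map_sum, map_sum, map_sum]
    exact Finset.sum_congr rfl fun k _ => by rw [hinc, h1]
  have hη : η' ∈ K.topologicalClosure :=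
    subset_closure ⟨1, S.one_mem, by ext i; rfl⟩
  have hxη : amp ι x η' ∈ K.topologicalClosure := by
    have h1 := hPx η'
    rw [hP, Submodule.starProjection_eq_self_iff.2 hη, ← hP] at h1
    exact Submodule.starProjection_eq_self_iff.1 h1
  obtain ⟨_, ⟨y, hy, rfl⟩, hd⟩ := Metric.mem_closure_iff.1 hxη (Real.sqrt ε) (Real.sqrt_pos.2 hε)
  refine ⟨y, hy, ?_⟩
  rw [dist_eq_norm] at hd
  have h2 := (Real.lt_sqrt (norm_nonneg _)).1 hd
  rw [PiLp.norm_sq_eq_of_L2] at h2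
  exact h2

end Density

theorem wotDual_bound {f : (H →L[ℂ] H) →ₗ[ℂ] ℂ} (hf : f ∈ wotDual H) :
    ∃ (F : Finset H) (C : ℝ), 0 ≤ C ∧ ∀ z, ‖f (star z * z)‖ ≤ C * ∑ η ∈ F, ‖z η‖ ^ 2 := by
  classical
  induction hf using Submodule.span_induction with
  | mem f hf =>
    obtain ⟨p, rfl⟩ := hf
    refine ⟨{p.1, p.2}, 1, zero_le_one, fun z => ?_⟩
    have h1 : ‖z p.1‖ ^ 2 ≤ ∑ η ∈ ({p.1, p.2} : Finset H), ‖z η‖ ^ 2 :=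
      Finset.single_le_sum (f := fun η => ‖z η‖ ^ 2) (fun _ _ => sq_nonneg _) (by simp)
    have h2 : ‖z p.2‖ ^ 2 ≤ ∑ η ∈ ({p.1, p.2} : Finset H), ‖z η‖ ^ 2 :=
      Finset.single_le_sum (f := fun η => ‖z η‖ ^ 2) (fun _ _ => sq_nonneg _) (by simp)
    have h3 : ‖vecFunctional p.1 p.2 (star z * z)‖ ≤ ‖z p.1‖ * ‖z p.2‖ := by
      rw [vecFunctional_apply, mul_apply_eq_comp, inner_star_right]
      exact norm_inner_le_norm _ _
    nlinarith [sq_nonneg (‖z p.1‖ - ‖z p.2‖)]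
  | zero => exact ⟨∅, 0, le_rfl, fun z => by simp⟩
  | add f g _ _ hf hg =>
    obtain ⟨F, C, hC, h1⟩ := hf
    obtain ⟨G, D, hD, h2⟩ := hg
    refine ⟨F ∪ G, C + D, add_nonneg hC hD, fun z => (norm_add_le _ _).trans ?_⟩
    have h3 : ∑ η ∈ F, ‖z η‖ ^ 2 ≤ ∑ η ∈ F ∪ G, ‖z η‖ ^ 2 :=
      Finset.sum_le_sum_of_subset_of_nonneg Finset.subset_union_left fun _ _ _ => sq_nonneg _
    have h4 : ∑ η ∈ G, ‖z η‖ ^ 2 ≤ ∑ η ∈ F ∪ G, ‖z η‖ ^ 2 :=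
      Finset.sum_le_sum_of_subset_of_nonneg Finset.subset_union_right fun _ _ _ => sq_nonneg _
    rw [add_mul]
    exact add_le_add ((h1 z).trans (by gcongr)) ((h2 z).trans (by gcongr))
  | smul c f _ hf =>
    obtain ⟨F, C, hC, h1⟩ := hf
    refine ⟨F, ‖c‖ * C, by positivity, fun z => ?_⟩
    rw [LinearMap.smul_apply, norm_smul, mul_assoc]
    gcongr
    exact h1 z

namespace IsNormalTrace

variable {M : Set (H →L[ℂ] H)} {τ : (H →L[ℂ] H) →ₗ[ℂ] ℂ} (h : IsNormalTrace M τ)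
include h

/-- Approximation in `2`-norm of the elements of a double commutant. -/
theorem exists_sqNorm_lt (S : StarSubalgebra ℂ (H →L[ℂ] H)) {x : H →L[ℂ] H}
    (hx : x ∈ (S : Set (H →L[ℂ] H)).centralizer.centralizer) {ε : ℝ} (hε : 0 < ε) :
    ∃ y ∈ S, sqNorm τ (x - y) < ε := by
  obtain ⟨F, C, hC, hF⟩ := wotDual_bound h.wot
  obtain ⟨y, hy, hlt⟩ := exists_approx S hx (fun η : F => (η : H)) (ε := ε / (C + 1))
    (by positivity)
  refine ⟨y, hy, ?_⟩
  have h1 : sqNorm τ (x - y) ≤ C * ∑ η ∈ F, ‖(x - y) η‖ ^ 2 :=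
    ((le_abs_self _).trans (Complex.abs_re_le_norm _)).trans (hF _)
  rw [Finset.sum_coe_sort F (fun η => ‖(x - y) η‖ ^ 2), lt_div_iff₀ (by positivity)] at hlt
  have h2 : 0 ≤ ∑ η ∈ F, ‖(x - y) η‖ ^ 2 := Finset.sum_nonneg fun _ _ => sq_nonneg _
  linarith

/-- Von Neumann subalgebras are closed in `2`-norm. -/
theorem mem_of_approx {N : Set (H →L[ℂ] H)} (hN : IsVonNeumannAlgebra N) (hNM : N ⊆ M)
    {u : H →L[ℂ] H} (hu : u ∈ M) (hap : ∀ ε > 0, ∃ n ∈ N, sqNorm τ (u - n) < ε) : u ∈ N := by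
  have hv := h.vna
  refine mem_of_commute hN fun t ht => ?_
  have key : ∀ η ∈ bddVec h.toIsTrace, ∀ η' ∈ bddVec h.toIsTrace,
      inner ℂ η' ((u * t - t * u) η) = 0 := by
    rintro η ⟨C, hC0, hC⟩ η' ⟨D, hD0, hD⟩
    set K : ℝ := 2 * (D * (‖t‖ * ‖η‖) ^ 2 + C * (‖t‖ * ‖η'‖) ^ 2) with hK
    have hK0 : 0 ≤ K := by positivity
    have hle : ∀ ε > 0, ‖(inner ℂ η' ((u * t - t * u) η) : ℂ)‖ ^ 2 ≤ K * ε := by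
      intro ε hε
      obtain ⟨n, hn, hlt⟩ := hap ε hε
      have hz : u - n ∈ M := sub_mem hv hu (hNM hn)
      set z := u - n with hzd
      have e1 : u * t - t * u = z * t - t * z := by
        rw [hzd, sub_mul, mul_sub, ht n hn]; abel
      have e2 : (inner ℂ η' ((z * t - t * z) η) : ℂ) =
          inner ℂ (star z η') (t η) - inner ℂ (star t η') (z η) := by
        rw [_root_.sub_apply, inner_sub_right, inner_star_left, inner_star_left]; rfl
      have h1 : ‖star z η'‖ ^ 2 ≤ D * ε := by
        refine (hD _ (star_mem hv hz)).trans ?_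
        rw [h.sqNorm_star hz]
        gcongr
      have h2 : ‖z η‖ ^ 2 ≤ C * ε := (hC _ hz).trans (by gcongr)
      have h3 : ‖(inner ℂ η' ((u * t - t * u) η) : ℂ)‖ ≤
          ‖star z η'‖ * (‖t‖ * ‖η‖) + ‖z η‖ * (‖t‖ * ‖η'‖) := by
        rw [e1, e2]
        refine (norm_sub_le _ _).trans (add_le_add ?_ ?_)
        · refine (norm_inner_le_norm _ _).trans ?_
          gcongr
          exact t.le_opNorm η
        · refine (norm_inner_le_norm _ _).trans ?_
          rw [mul_comm]
          gcongr
          rw [← norm_star t]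
          exact (star t).le_opNorm η'
      calc ‖(inner ℂ η' ((u * t - t * u) η) : ℂ)‖ ^ 2
          ≤ (‖star z η'‖ * (‖t‖ * ‖η‖) + ‖z η‖ * (‖t‖ * ‖η'‖)) ^ 2 := by gcongr
        _ ≤ 2 * (‖star z η'‖ ^ 2 * (‖t‖ * ‖η‖) ^ 2 + ‖z η‖ ^ 2 * (‖t‖ * ‖η'‖) ^ 2) := by
          nlinarith [sq_nonneg (‖star z η'‖ * (‖t‖ * ‖η‖) - ‖z η‖ * (‖t‖ * ‖η'‖))]
        _ ≤ 2 * ((D * ε) * (‖t‖ * ‖η‖) ^ 2 + (C * ε) * (‖t‖ * ‖η'‖) ^ 2) := by gcongr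
        _ = K * ε := by rw [hK]; ring
    have h0 : ‖(inner ℂ η' ((u * t - t * u) η) : ℂ)‖ ^ 2 ≤ 0 := by
      refine le_of_forall_pos_le_add fun ε hε => ?_
      have := hle (ε / (K + 1)) (by positivity)
      have h5 : K * (ε / (K + 1)) ≤ ε := by
        rw [mul_div_assoc', div_le_iff₀ (by positivity)]
        nlinarith
      linarith
    simpa using h0.antisymm (sq_nonneg _)
  have h0 : ∀ η, (u * t - t * u) η = 0 := by
    have h1 : ∀ η ∈ bddVec h.toIsTrace, (u * t - t * u) η = 0 := by
      intro η hη
      refine h.dense.eq_zero_of_inner_right ℂ fun η' hη' => key η hη _ hη'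
    intro η
    have hcl : IsClosed {w | (u * t - t * u) w = 0} :=
      isClosed_eq (u * t - t * u).continuous continuous_const
    have hsub : (bddVec h.toIsTrace : Set H) ⊆ {w | (u * t - t * u) w = 0} := h1
    exact closure_minimal hsub hcl (h.dense η)
  have : u * t - t * u = 0 := by ext η; simpa using h0 η
  exact (sub_eq_zero.1 this).symm

end IsNormalTrace

/-- A von Neumann algebra is spanned by its positive contractions. -/
theorem subset_of_nonneg {P : Set (H →L[ℂ] H)} (hP : IsVonNeumannAlgebra P)
    (V : Submodule ℂ (H →L[ℂ] H)) (hV : ∀ x ∈ P, 0 ≤ x → x ≤ 1 → x ∈ V) : P ⊆ V := by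
  have h1 : ∀ x ∈ P, 0 ≤ x → x ∈ V := by
    intro x hx h0
    set c : ℝ := ‖x‖ + 1 with hc
    have hc0 : 0 < c := by positivity
    have hy : (c⁻¹ : ℝ) • x ∈ V := by
      refine hV _ (rsmul_mem hP _ hx) (smul_nonneg (by positivity) h0) ?_
      refine (CStarAlgebra.norm_le_one_iff_of_nonneg _ (smul_nonneg (by positivity) h0)).1 ?_
      rw [norm_smul, Real.norm_of_nonneg (by positivity), inv_mul_le_iff₀ hc0]
      linarith
    have := V.smul_of_tower_mem c hy
    rwa [smul_smul, mul_inv_cancel₀ hc0.ne', one_smul] at this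
  have h2 : ∀ x ∈ P, IsSelfAdjoint x → x ∈ V := by
    intro x hx hs
    obtain ⟨e, p, n, -, hp, hn, hpn, -, -, -, -, hcomm⟩ := exists_spectral_proj hs
    rw [hpn]
    exact V.sub_mem (h1 _ (mem_of_commute_of hP hx fun t ht => (hcomm t ht).2.1) hp)
      (h1 _ (mem_of_commute_of hP hx fun t ht => (hcomm t ht).2.2) hn)
  intro x hx
  have e : x = (1 / 2 : ℂ) • (x + star x) + (-Complex.I / 2) • (Complex.I • (x - star x)) := by
    rw [smul_smul]
    have : -Complex.I / 2 * Complex.I = 1 / 2 := by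
      rw [div_mul_eq_mul_div, neg_mul, Complex.I_mul_I]; norm_num
    rw [this]; module
  rw [e]
  have hsx := star_mem hP hx
  refine V.add_mem (V.smul_mem _ (h2 _ (add_mem hP hx hsx) (IsSelfAdjoint.add_star_self x)))
    (V.smul_mem _ (h2 _ (smul_mem hP _ (sub_mem hP hx hsx)) ?_))
  rw [IsSelfAdjoint, star_smul, star_sub, star_star, RCLike.star_def, Complex.conj_I]
  module

theorem IsTrace.mul_pos {M : Set (H →L[ℂ] H)} {τ : (H →L[ℂ] H) →ₗ[ℂ] ℂ} (h : IsTrace M τ)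
    {x m : H →L[ℂ] H} (hx : x ∈ M) (h0 : 0 ≤ x) (hm : m ∈ M) : 0 ≤ τ (x * (star m * m)) := by
  have hs := star_mem h.vna hm
  have h1 := h.pos (mul_mem h.vna (mul_mem h.vna (star_mem h.vna hs) hx) hs)
    (conj_nonneg h0 (star m))
  rwa [star_star, mul_assoc, h.tracial _ hm _ (mul_mem h.vna hx hs), mul_assoc] at h1

namespace IsNormalTrace

variable {M : Set (H →L[ℂ] H)} {τ : (H →L[ℂ] H) →ₗ[ℂ] ℂ} (h : IsNormalTrace M τ)
include h

theorem tendsto_mul {ι : Type*} {l : Filter ι} {x : ι → H →L[ℂ] H} {y : H →L[ℂ] H}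
    (hx : WOTLim l x y) (a b : H →L[ℂ] H) :
    Tendsto (fun i => τ (a * x i * b)) l (𝓝 (τ (a * y * b))) :=
  ((hx.mul_left a).mul_right b).tendsto h.wot

/-- Finite-dimensional approximation to the density of a functional dominated by the trace. -/
theorem exists_finite_density {P : Set (H →L[ℂ] H)} (hP : IsVonNeumannAlgebra P) (hPM : P ⊆ M)
    (φ : (H →L[ℂ] H) →ₗ[ℂ] ℂ) (h0 : ∀ m ∈ P, 0 ≤ φ (star m * m))
    (h1 : ∀ m ∈ P, φ (star m * m) ≤ τ (star m * m))
    (s : Finset {b : H →L[ℂ] H // b ∈ P ∧ IsSelfAdjoint b}) :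
    ∃ x ∈ P, 0 ≤ x ∧ x ≤ 1 ∧ ∀ b ∈ s, (τ (x * b)).re = (φ b).re := by
  have hv := h.vna
  have hpos : ∀ m ∈ P, 0 ≤ m → 0 ≤ φ m ∧ φ m ≤ τ m := by
    intro m hm hm0
    obtain ⟨k, hk, hks, rfl⟩ := exists_sqrt_mem hP hm hm0
    have := h0 k hk
    have h1 := h1 k hk
    rw [hks] at this h1
    exact ⟨this, h1⟩
  let W : Set (H →L[ℂ] H) := {x | x ∈ P ∧ 0 ≤ x ∧ x ≤ 1}
  let T : (H →L[ℂ] H) → (s → ℝ) := fun x b => (τ (x * b)).re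
  have hconv : Convex ℝ (T '' W) := by
    rintro _ ⟨x, ⟨hx, hx0, hx1⟩, rfl⟩ _ ⟨y, ⟨hy, hy0, hy1⟩, rfl⟩ a b ha hb hab
    refine ⟨a • x + b • y, ⟨add_mem hP (rsmul_mem hP _ hx) (rsmul_mem hP _ hy),
      add_nonneg (smul_nonneg ha hx0) (smul_nonneg hb hy0), ?_⟩, ?_⟩
    · rw [← one_smul ℝ (1 : H →L[ℂ] H), ← hab, add_smul]
      exact add_le_add (smul_le_smul_of_nonneg_left hx1 ha) (smul_le_smul_of_nonneg_left hy1 hb)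
    · funext c
      simp only [T, add_mul, smul_mul_assoc, map_add, LinearMap.map_smul_of_tower, Complex.add_re,
        Complex.smul_re, Pi.add_apply, Pi.smul_apply]
  have hclosed : IsClosed (T '' W) := by
    rw [isClosed_iff_ultrafilter]
    intro v U hU hW
    have hg : ∀ w : s → ℝ, ∃ x ∈ W, w ∈ T '' W → T x = w := by
      intro w
      by_cases hw : w ∈ T '' W
      · obtain ⟨x, hx, hxw⟩ := hw
        exact ⟨x, hx, fun _ => hxw⟩
      · exact ⟨0, ⟨zero_mem hP, le_rfl, zero_le_one⟩, fun h => absurd h hw⟩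
    choose g hgW hgT using hg
    obtain ⟨y, -, hy⟩ := exists_wot_limit U g zero_le_one fun i =>
      (CStarAlgebra.norm_le_one_iff_of_nonneg _ (hgW i).2.1).2 (hgW i).2.2
    have hy' : WOTLim (U : Filter (s → ℝ)) g y := hy
    refine ⟨y, ⟨hy'.mem hP (Eventually.of_forall fun i => (hgW i).1),
      hy'.nonneg (Eventually.of_forall fun i => (hgW i).2.1), ?_⟩, ?_⟩
    · have h2 : WOTLim (U : Filter (s → ℝ)) (fun i => 1 - g i) (1 - y) := fun ξ η => by
        simpa only [_root_.sub_apply, inner_sub_right] using tendsto_const_nhds.sub (hy' ξ η)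
      exact sub_nonneg.1 (h2.nonneg (Eventually.of_forall fun i => sub_nonneg.2 (hgW i).2.2))
    · funext b
      have h2 : Tendsto (fun w => T (g w) b) U (𝓝 (T y b)) := by
        have := h.tendsto_mul hy' 1 b
        simp only [one_mul] at this
        exact (Complex.continuous_re.tendsto _).comp this
      have h3 : Tendsto (fun w : s → ℝ => w b) U (𝓝 (v b)) :=
        ((continuous_apply b).tendsto v).mono_left hU
      refine tendsto_nhds_unique h2 (h3.congr' ?_)
      filter_upwards [hW] with w hw
      rw [hgT w hw]
  have hmem : (fun b : s => (φ b.1.1).re) ∈ T '' W := by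
    by_contra hc
    obtain ⟨f, u, hf, hu⟩ := geometric_hahn_banach_closed_point hconv hclosed hc
    classical
    set a : H →L[ℂ] H := ∑ b : s, (f (Pi.single b 1)) • b.1.1 with ha
    have hfv : ∀ v : s → ℝ, f v = ∑ b, v b * f (Pi.single b 1) := by
      intro v
      conv_lhs => rw [← Finset.univ_sum_single v]
      rw [map_sum]
      refine Finset.sum_congr rfl fun b _ => ?_
      rw [← smul_eq_mul, ← map_smul, ← Pi.single_smul, smul_eq_mul, mul_one]
    have hfT : ∀ x, f (T x) = (τ (x * a)).re := by
      intro x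
      rw [hfv, ha, Finset.mul_sum, map_sum, Complex.re_sum]
      refine Finset.sum_congr rfl fun b _ => ?_
      rw [mul_smul_comm, LinearMap.map_smul_of_tower, Complex.smul_re, smul_eq_mul, mul_comm]
    have hfc : f (fun b : s => (φ b.1.1).re) = (φ a).re := by
      rw [hfv, ha, map_sum, Complex.re_sum]
      refine Finset.sum_congr rfl fun b _ => ?_
      rw [LinearMap.map_smul_of_tower, Complex.smul_re, smul_eq_mul, mul_comm]
    have haP : a ∈ P := sum_mem hP fun b _ => rsmul_mem hP _ b.1.2.1
    have has : IsSelfAdjoint a := by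
      rw [ha, IsSelfAdjoint, star_sum]
      refine Finset.sum_congr rfl fun b _ => ?_
      rw [star_smul, b.1.2.2.star_eq, star_trivial]
    obtain ⟨e, p, n, he, hp, hn, hpn, hae, hep, -, -, hcomm⟩ := exists_spectral_proj has
    have heP := mem_of_commute_of hP haP fun t ht => (hcomm t ht).1
    have hpP := mem_of_commute_of hP haP fun t ht => (hcomm t ht).2.1
    have hnP := mem_of_commute_of hP haP fun t ht => (hcomm t ht).2.2
    have h2 := hf _ ⟨e, ⟨heP, proj_nonneg he, he.le_one⟩, rfl⟩
    rw [hfT, h.tracial _ (hPM heP) _ (hPM haP), hae] at h2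
    have h3 := (Complex.le_def.1 (hpos p hpP hp).2).1
    have h4 := (Complex.le_def.1 (hpos n hnP hn).1).1
    rw [hfc, hpn, map_sub, Complex.sub_re] at hu
    simp only [Complex.zero_re] at h4
    linarith
  obtain ⟨x, ⟨hx, hx0, hx1⟩, hxT⟩ := hmem
  exact ⟨x, hx, hx0, hx1, fun b hb => congrFun hxT ⟨b, hb⟩⟩

/-- A Radon–Nikodym theorem. -/
theorem exists_density {P : Set (H →L[ℂ] H)} (hP : IsVonNeumannAlgebra P) (hPM : P ⊆ M)
    (φ : (H →L[ℂ] H) →ₗ[ℂ] ℂ) (h0 : ∀ m ∈ P, 0 ≤ φ (star m * m))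
    (h1 : ∀ m ∈ P, φ (star m * m) ≤ τ (star m * m)) :
    ∃ x ∈ P, 0 ≤ x ∧ x ≤ 1 ∧ ∀ m ∈ P, φ m = τ (x * m) := by
  classical
  have hv := h.vna
  choose g hgP hg0 hg1 hg using h.exists_finite_density hP hPM φ h0 h1
  let U : Ultrafilter (Finset {b : H →L[ℂ] H // b ∈ P ∧ IsSelfAdjoint b}) := Ultrafilter.of atTop
  obtain ⟨x, -, hx⟩ := exists_wot_limit U g zero_le_one fun i =>
    (CStarAlgebra.norm_le_one_iff_of_nonneg _ (hg0 i)).2 (hg1 i)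
  have hx' : WOTLim (U : Filter (Finset _)) g x := hx
  have hxP : x ∈ P := hx'.mem hP (Eventually.of_forall hgP)
  have hx0 : 0 ≤ x := hx'.nonneg (Eventually.of_forall hg0)
  have hx1 : x ≤ 1 := (CStarAlgebra.norm_le_one_iff_of_nonneg _ hx0).1
    (hx'.norm_le zero_le_one (Eventually.of_forall fun i =>
      (CStarAlgebra.norm_le_one_iff_of_nonneg _ (hg0 i)).2 (hg1 i)))
  refine ⟨x, hxP, hx0, hx1, ?_⟩
  let V : Submodule ℂ (H →L[ℂ] H) := LinearMap.ker (φ - τ ∘ₗ LinearMap.mulLeft ℂ x)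
  have hV : ∀ m, m ∈ V ↔ φ m = τ (x * m) := fun m => by
    rw [LinearMap.mem_ker, LinearMap.sub_apply, sub_eq_zero]; rfl
  have hsub : P ⊆ V := by
    refine subset_of_nonneg hP V fun m hm hm0 _ => (hV m).2 ?_
    obtain ⟨k, hk, hks, hkm⟩ := exists_sqrt_mem hP hm hm0
    have h2 : 0 ≤ φ m := by
      have := h0 k hk
      rwa [hks, hkm] at this
    have h3 : 0 ≤ τ (x * m) := by
      have := h.mul_pos (hPM hxP) hx0 (hPM hk)
      rwa [hks, hkm] at this
    have h4 : (τ (x * m)).re = (φ m).re := by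
      have ht : Tendsto (fun s => (τ (g s * m)).re) U (𝓝 (τ (x * m)).re) := by
        have := h.tendsto_mul hx' 1 m
        simp only [one_mul] at this
        exact (Complex.continuous_re.tendsto _).comp this
      refine tendsto_nhds_unique ht (tendsto_const_nhds.congr' ?_)
      let b : {b : H →L[ℂ] H // b ∈ P ∧ IsSelfAdjoint b} := ⟨m, hm, hm0.isSelfAdjoint⟩
      have : {s | ({b} : Finset _) ≤ s} ∈ U := Ultrafilter.of_le atTop (mem_atTop _)
      filter_upwards [this] with s hs
      exact (hg s _ (Finset.singleton_subset_iff.1 hs)).symm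
    rw [Complex.nonneg_iff] at h2 h3
    exact Complex.ext h4.symm (h2.2.symm.trans h3.2)
  exact fun m hm => (hV m).1 (hsub hm)

/-- Existence of the conditional expectation. -/
theorem exists_condExp {N : Set (H →L[ℂ] H)} (hN : IsVonNeumannAlgebra N) (hNM : N ⊆ M)
    {x : H →L[ℂ] H} (hx : x ∈ M) : ∃ y ∈ N, ∀ n ∈ N, τ (n * (x - y)) = 0 := by
  have hv := h.vna
  let V : Submodule ℂ (H →L[ℂ] H) :=
    { carrier := {x | ∃ y ∈ N, ∀ n ∈ N, τ (n * (x - y)) = 0}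
      zero_mem' := ⟨0, zero_mem hN, by simp⟩
      add_mem' := by
        rintro a b ⟨y, hy, hya⟩ ⟨z, hz, hzb⟩
        refine ⟨y + z, add_mem hN hy hz, fun n hn => ?_⟩
        rw [add_sub_add_comm, mul_add, map_add, hya n hn, hzb n hn, add_zero]
      smul_mem' := by
        rintro c a ⟨y, hy, hya⟩
        refine ⟨c • y, smul_mem hN c hy, fun n hn => ?_⟩
        rw [← smul_sub, mul_smul_comm, map_smul, hya n hn, smul_zero] }
  refine subset_of_nonneg hv V (fun x hx hx0 hx1 => ?_) hx
  obtain ⟨y, hy, -, -, hxy⟩ := h.exists_density hN hNM (τ ∘ₗ LinearMap.mulLeft ℂ x)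
    (fun m hm => h.mul_pos hx hx0 (hNM hm)) (fun m hm => by
      have := h.mul_pos (sub_mem hv hv.one_mem hx) (sub_nonneg.2 hx1) (hNM hm)
      rwa [sub_mul, one_mul, map_sub, sub_nonneg] at this)
  refine ⟨y, hy, fun n hn => ?_⟩
  rw [h.tracial _ (hNM hn) _ (sub_mem hv hx (hNM hy)), sub_mul, map_sub, sub_eq_zero]
  exact hxy n hn

end IsNormalTrace

theorem mul_nonneg_of_commute {a b : H →L[ℂ] H} (ha : 0 ≤ a) (hb : 0 ≤ b) (h : Commute a b) :
    0 ≤ a * b := by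
  obtain ⟨k, hk, hkk, hc⟩ := exists_sqrt ha
  have := conj_nonneg hb k
  rwa [hk, mul_assoc, (hc b h.symm).eq, ← mul_assoc, hkk] at this

/-- An abelian von Neumann algebra. -/
structure IsAbelian (B : Set (H →L[ℂ] H)) : Prop extends IsVonNeumannAlgebra B where
  comm : ∀ a ∈ B, ∀ b ∈ B, Commute a b

namespace IsAbelian

variable {B : Set (H →L[ℂ] H)} (hB : IsAbelian B)
include hB

theorem one_mem_projSet : 1 ∈ projSet B := ⟨hB.one_mem, IsStarProjection.one _⟩

theorem zero_mem_projSet : 0 ∈ projSet B := ⟨zero_mem hB.toIsVonNeumannAlgebra,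
  IsStarProjection.zero _⟩

theorem mul_mem_projSet {e f : H →L[ℂ] H} (he : e ∈ projSet B) (hf : f ∈ projSet B) :
    e * f ∈ projSet B :=
  ⟨mul_mem hB.toIsVonNeumannAlgebra he.1 hf.1, he.2.mul hf.2 (hB.comm _ he.1 _ hf.1)⟩

theorem compl_mem_projSet {e : H →L[ℂ] H} (he : e ∈ projSet B) : 1 - e ∈ projSet B :=
  ⟨sub_mem hB.toIsVonNeumannAlgebra hB.one_mem he.1, he.2.one_sub⟩

end IsAbelian

/-- A finite partition of unity into projections of `B`. -/
structure Partition (B : Set (H →L[ℂ] H)) where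
  ι : Type
  fin : Fintype ι
  e : ι → H →L[ℂ] H
  mem : ∀ i, e i ∈ projSet B
  orth : ∀ i j, i ≠ j → e i * e j = 0
  sum : ∑ i, e i = 1

attribute [instance] Partition.fin

namespace Partition

variable {B : Set (H →L[ℂ] H)}

/-- The trivial partition. -/
def trivial (hB : IsAbelian B) : Partition B where
  ι := Unit
  fin := inferInstance
  e := fun _ => 1
  mem := fun _ => hB.one_mem_projSet
  orth := fun _ _ h => absurd rfl h
  sum := by simp

/-- The partition into a projection and its complement. -/
def pair (hB : IsAbelian B) {e : H →L[ℂ] H} (he : e ∈ projSet B) : Partition B where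
  ι := Bool
  fin := inferInstance
  e := fun b => cond b e (1 - e)
  mem := fun b => by cases b; exacts [hB.compl_mem_projSet he, he]
  orth := fun i j hij => by
    cases i <;> cases j
    · exact absurd rfl hij
    · exact he.2.one_sub_mul_self
    · exact he.2.mul_one_sub_self
    · exact absurd rfl hij
  sum := by simp

/-- The common refinement of two partitions. -/
def prod (hB : IsAbelian B) (F G : Partition B) : Partition B where
  ι := F.ι × G.ι
  fin := inferInstance
  e := fun p => F.e p.1 * G.e p.2
  mem := fun p => hB.mul_mem_projSet (F.mem _) (G.mem _)
  orth := fun p q hpq => by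
    have h1 : F.e p.1 * G.e p.2 * (F.e q.1 * G.e q.2) =
        (F.e p.1 * F.e q.1) * (G.e p.2 * G.e q.2) :=
      (hB.comm _ (G.mem _).1 _ (F.mem _).1).mul_mul_mul_comm _ _
    rw [h1]
    by_cases h : p.1 = q.1
    · rw [G.orth _ _ fun h' => hpq (Prod.ext h h'), mul_zero]
    · rw [F.orth _ _ h, zero_mul]
  sum := by
    rw [Fintype.sum_prod_type]
    simp only [← Finset.mul_sum, G.sum, mul_one, F.sum]

theorem exists_refining (hB : IsAbelian B) (s : Finset (H →L[ℂ] H)) :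
    ∃ F : Partition B, ∀ e ∈ s, e ∈ projSet B → ∀ i, e * F.e i = F.e i ∨ e * F.e i = 0 := by
  classical
  induction s using Finset.induction_on with
  | empty => exact ⟨trivial hB, by simp⟩
  | insert a s _ ih =>
    obtain ⟨F, hF⟩ := ih
    by_cases ha : a ∈ projSet B
    · refine ⟨prod hB (pair hB ha) F, fun e he heB i => ?_⟩
      change e * (cond i.1 a (1 - a) * F.e i.2) = cond i.1 a (1 - a) * F.e i.2 ∨
        e * (cond i.1 a (1 - a) * F.e i.2) = 0
      rcases Finset.mem_insert.1 he with rfl | he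
      · cases i.1
        · right; rw [cond_false, ← mul_assoc, ha.2.mul_one_sub_self, zero_mul]
        · left; rw [cond_true, ← mul_assoc, ha.2.isIdempotentElem.eq]
      · have hc : e * cond i.1 a (1 - a) = cond i.1 a (1 - a) * e :=
          hB.comm _ heB.1 _ ((pair hB ha).mem i.1).1
        rcases hF e he heB i.2 with h | h
        · left; rw [← mul_assoc, hc, mul_assoc, h]
        · right; rw [← mul_assoc, hc, mul_assoc, h, mul_zero]
    · refine ⟨F, fun e he heB => hF e ?_ heB⟩
      rcases Finset.mem_insert.1 he with rfl | he
      · exact absurd heB ha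
      · exact he

end Partition

/-- Finitely additive, positive, contractive, `B`-valued measures on the projections of `B`. -/
structure IsOpMeasure (B : Set (H →L[ℂ] H)) (β : (H →L[ℂ] H) → H →L[ℂ] H) : Prop where
  mem : ∀ e ∈ projSet B, β e ∈ B
  nonneg : ∀ e ∈ projSet B, 0 ≤ β e
  one_le : β 1 ≤ 1
  eq_zero : ∀ e ∉ projSet B, β e = 0
  add : ∀ q ∈ projSet B, ∀ F : Partition B, ∑ i, β (q * F.e i) = β q

namespace IsOpMeasure

variable {B : Set (H →L[ℂ] H)} {β : (H →L[ℂ] H) → H →L[ℂ] H}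

theorem add_compl (hβ : IsOpMeasure B β) (hB : IsAbelian B) {q e : H →L[ℂ] H} (hq : q ∈ projSet B)
    (he : e ∈ projSet B) : β (q * e) + β (q * (1 - e)) = β q := by
  have h := hβ.add q hq (Partition.pair hB he)
  change ∑ b : Bool, β (q * cond b e (1 - e)) = β q at h
  simpa using h

theorem norm_le (hβ : IsOpMeasure B β) (hB : IsAbelian B) (e : H →L[ℂ] H) : ‖β e‖ ≤ 1 := by
  by_cases he : e ∈ projSet B
  · refine (CStarAlgebra.norm_le_one_iff_of_nonneg _ (hβ.nonneg e he)).2 ?_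
    have h := hβ.add_compl hB hB.one_mem_projSet he
    rw [one_mul, one_mul] at h
    refine le_trans ?_ hβ.one_le
    rw [← h]
    exact le_add_of_nonneg_right (hβ.nonneg _ (hB.compl_mem_projSet he))
  · rw [hβ.eq_zero e he, norm_zero]; exact zero_le_one

theorem le_one (hβ : IsOpMeasure B β) (hB : IsAbelian B) {e : H →L[ℂ] H} (he : e ∈ projSet B) :
    β e ≤ 1 :=
  (CStarAlgebra.norm_le_one_iff_of_nonneg _ (hβ.nonneg e he)).1 (hβ.norm_le hB e)

theorem of_lim (hB : IsAbelian B) {ι : Type*} {l : Filter ι} [l.NeBot]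
    {b : ι → (H →L[ℂ] H) → H →L[ℂ] H} (hb : ∀ᶠ i in l, IsOpMeasure B (b i))
    (h : ∀ e, WOTLim l (fun i => b i e) (β e)) : IsOpMeasure B β where
  mem e he := (h e).mem hB.toIsVonNeumannAlgebra (hb.mono fun i hi => hi.mem e he)
  nonneg e he := (h e).nonneg (hb.mono fun i hi => hi.nonneg e he)
  one_le := by
    have h2 : WOTLim l (fun i => 1 - b i 1) (1 - β 1) := fun ξ η => by
      simpa only [_root_.sub_apply, inner_sub_right] using tendsto_const_nhds.sub (h 1 ξ η)
    exact sub_nonneg.1 (h2.nonneg (hb.mono fun i hi => sub_nonneg.2 hi.one_le))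
  eq_zero e he := (h e).unique ((WOTLim.const 0).congr (hb.mono fun i hi => (hi.eq_zero e he).symm))
  add q hq F := by
    have h2 : WOTLim l (fun i => ∑ j, b i (q * F.e j)) (∑ j, β (q * F.e j)) := fun ξ η => by
      simpa only [_root_.sum_apply, inner_sum] using tendsto_finsetSum _ fun j _ =>
        h (q * F.e j) ξ η
    exact h2.unique ((h q).congr (hb.mono fun i hi => (hi.add q hq F).symm))

/-- The multiplicativity defect of `β` at `e`. -/
def defect (B : Set (H →L[ℂ] H)) (β : (H →L[ℂ] H) → H →L[ℂ] H) (e f : H →L[ℂ] H) : H →L[ℂ] H :=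
  open Classical in if f ∈ projSet B then β (e * f) - β e * β f else 0

theorem defect_of_mem {e f : H →L[ℂ] H} (hf : f ∈ projSet B) :
    defect B β e f = β (e * f) - β e * β f := if_pos hf

theorem defect_of_notMem {e f : H →L[ℂ] H} (hf : f ∉ projSet B) :
    defect B β e f = 0 := if_neg hf

theorem defect_add (hβ : IsOpMeasure B β) (hB : IsAbelian B) {e : H →L[ℂ] H}
    (he : e ∈ projSet B) {q : H →L[ℂ] H} (hq : q ∈ projSet B) (F : Partition B) :
    ∑ i, defect B β e (q * F.e i) = defect B β e q := by
  have h1 : ∀ i, defect B β e (q * F.e i) = β (e * q * F.e i) - β e * β (q * F.e i) := fun i => by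
    rw [defect_of_mem (hB.mul_mem_projSet hq (F.mem i)), mul_assoc]
  simp only [h1, Finset.sum_sub_distrib, ← Finset.mul_sum]
  rw [hβ.add _ (hB.mul_mem_projSet he hq), hβ.add _ hq, defect_of_mem hq]

theorem add_defect (hβ : IsOpMeasure B β) (hB : IsAbelian B) {e : H →L[ℂ] H}
    (he : e ∈ projSet B) : IsOpMeasure B (β + defect B β e) where
  mem f hf := by
    have hv := hB.toIsVonNeumannAlgebra
    rw [Pi.add_apply, defect_of_mem hf]
    exact VNA.add_mem hv (hβ.mem f hf) (sub_mem hv (hβ.mem _ (hB.mul_mem_projSet he hf))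
      (mul_mem hv (hβ.mem e he) (hβ.mem f hf)))
  nonneg f hf := by
    have hv := hB.toIsVonNeumannAlgebra
    rw [Pi.add_apply, defect_of_mem hf]
    have e1 : β f + (β (e * f) - β e * β f) = β (e * f) + (1 - β e) * β f := by noncomm_ring
    rw [e1]
    refine add_nonneg (hβ.nonneg _ (hB.mul_mem_projSet he hf)) (mul_nonneg_of_commute
      (sub_nonneg.2 (hβ.le_one hB he)) (hβ.nonneg f hf) ?_)
    exact hB.comm _ (sub_mem hv hv.one_mem (hβ.mem e he)) _ (hβ.mem f hf)
  one_le := by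
    have hv := hB.toIsVonNeumannAlgebra
    rw [Pi.add_apply, defect_of_mem hB.one_mem_projSet, mul_one, ← sub_nonneg]
    have e1 : 1 - (β 1 + (β e - β e * β 1)) = (1 - β e) * (1 - β 1) := by noncomm_ring
    rw [e1]
    have h1 := hβ.mem 1 hB.one_mem_projSet
    exact mul_nonneg_of_commute (sub_nonneg.2 (hβ.le_one hB he)) (sub_nonneg.2 hβ.one_le)
      (hB.comm _ (sub_mem hv hv.one_mem (hβ.mem e he)) _ (sub_mem hv hv.one_mem h1))
  eq_zero f hf := by rw [Pi.add_apply, hβ.eq_zero f hf, defect_of_notMem hf, add_zero]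
  add q hq F := by
    simp only [Pi.add_apply, Finset.sum_add_distrib]
    rw [hβ.add q hq, hβ.defect_add hB he hq]

theorem sub_defect (hβ : IsOpMeasure B β) (hB : IsAbelian B) {e : H →L[ℂ] H}
    (he : e ∈ projSet B) : IsOpMeasure B (β - defect B β e) where
  mem f hf := by
    have hv := hB.toIsVonNeumannAlgebra
    rw [Pi.sub_apply, defect_of_mem hf]
    exact sub_mem hv (hβ.mem f hf) (sub_mem hv (hβ.mem _ (hB.mul_mem_projSet he hf))
      (mul_mem hv (hβ.mem e he) (hβ.mem f hf)))
  nonneg f hf := by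
    rw [Pi.sub_apply, defect_of_mem hf]
    have h1 := hβ.add_compl hB hf he
    rw [(hB.comm _ hf.1 _ he.1).eq] at h1
    have e1 : β f - (β (e * f) - β e * β f) = β (f * (1 - e)) + β e * β f := by
      rw [← h1]; abel
    rw [e1]
    exact add_nonneg (hβ.nonneg _ (hB.mul_mem_projSet hf (hB.compl_mem_projSet he)))
      (mul_nonneg_of_commute (hβ.nonneg e he) (hβ.nonneg f hf)
        (hB.comm _ (hβ.mem e he) _ (hβ.mem f hf)))
  one_le := by
    have hv := hB.toIsVonNeumannAlgebra
    rw [Pi.sub_apply, defect_of_mem hB.one_mem_projSet, mul_one]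
    refine le_trans ?_ hβ.one_le
    rw [sub_le_self_iff]
    have e1 : β e - β e * β 1 = β e * (1 - β 1) := by noncomm_ring
    rw [e1]
    exact mul_nonneg_of_commute (hβ.nonneg e he) (sub_nonneg.2 hβ.one_le)
      (hB.comm _ (hβ.mem e he) _ (sub_mem hv hv.one_mem (hβ.mem 1 hB.one_mem_projSet)))
  eq_zero f hf := by rw [Pi.sub_apply, hβ.eq_zero f hf, defect_of_notMem hf, sub_zero]
  add q hq F := by
    simp only [Pi.sub_apply, Finset.sum_sub_distrib]
    rw [hβ.add q hq, hβ.defect_add hB he hq]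

end IsOpMeasure

/-- The Riemann sum `∑ τ(β(eᵢ) x* eᵢ x)` of a measure along a partition. -/
def partSum {B : Set (H →L[ℂ] H)} (τ : (H →L[ℂ] H) →ₗ[ℂ] ℂ) (x : H →L[ℂ] H)
    (β : (H →L[ℂ] H) → H →L[ℂ] H) (F : Partition B) : ℝ :=
  ∑ i, (τ (β (F.e i) * (star x * F.e i * x))).re

namespace IsNormalTrace

variable {M : Set (H →L[ℂ] H)} {τ : (H →L[ℂ] H) →ₗ[ℂ] ℂ} (h : IsNormalTrace M τ)
  {B : Set (H →L[ℂ] H)} (hB : IsAbelian B) (hBM : B ⊆ M) {x : H →L[ℂ] H} (hx : x ∈ M)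
include h

theorem tendsto_partSum {ι : Type*} {l : Filter ι} {b : ι → (H →L[ℂ] H) → H →L[ℂ] H}
    {β : (H →L[ℂ] H) → H →L[ℂ] H} (hb : ∀ e, WOTLim l (fun i => b i e) (β e)) (F : Partition B) :
    Tendsto (fun i => partSum τ x (b i) F) l (𝓝 (partSum τ x β F)) := by
  refine tendsto_finsetSum _ fun j _ => ?_
  have := h.tendsto_mul (hb (F.e j)) 1 (star x * F.e j * x)
  simp only [one_mul] at this
  exact (Complex.continuous_re.tendsto _).comp this

include hB hBM hx

theorem partSum_prod_le {β : (H →L[ℂ] H) → H →L[ℂ] H} (hβ : IsOpMeasure B β) (F G : Partition B) :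
    partSum τ x β (F.prod hB G) ≤ partSum τ x β F := by
  have hv := h.vna
  change ∑ p : F.ι × G.ι, (τ (β (F.e p.1 * G.e p.2) * (star x * (F.e p.1 * G.e p.2) * x))).re ≤ _
  rw [Fintype.sum_prod_type]
  refine Finset.sum_le_sum fun i _ => ?_
  conv_rhs => rw [← hβ.add _ (F.mem i) G, Finset.sum_mul, map_sum, Complex.re_sum]
  refine Finset.sum_le_sum fun j _ => ?_
  set q := F.e i * (1 - G.e j) with hq
  have hqB : q ∈ projSet B := hB.mul_mem_projSet (F.mem i) (hB.compl_mem_projSet (G.mem j))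
  have hFG := hB.mul_mem_projSet (F.mem i) (G.mem j)
  have h1 := h.mul_pos (hBM (hβ.mem _ hFG)) (hβ.nonneg _ hFG) (mul_mem hv (hBM hqB.1) hx)
  have e1 : star (q * x) * (q * x) = star x * q * x := by
    have hqq := hqB.2.isIdempotentElem.eq
    rw [star_mul, hqB.2.isSelfAdjoint.star_eq]
    calc star x * q * (q * x) = star x * (q * q) * x := by noncomm_ring
      _ = star x * q * x := by rw [hqq]
  have e2 : star x * F.e i * x = star x * (F.e i * G.e j) * x + star x * q * x := by
    rw [hq]; noncomm_ring
  rw [e1] at h1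
  rw [e2, mul_add, map_add, Complex.add_re]
  exact le_add_of_nonneg_right (Complex.nonneg_iff.1 h1).1

theorem partSum_prod_le' {β : (H →L[ℂ] H) → H →L[ℂ] H} (hβ : IsOpMeasure B β)
    (F G : Partition B) : partSum τ x β (F.prod hB G) ≤ partSum τ x β G := by
  refine le_of_eq_of_le ?_ (h.partSum_prod_le hB hBM hx hβ G F)
  change ∑ p : F.ι × G.ι, (τ (β (F.e p.1 * G.e p.2) * (star x * (F.e p.1 * G.e p.2) * x))).re =
    ∑ p : G.ι × F.ι, (τ (β (G.e p.1 * F.e p.2) * (star x * (G.e p.1 * F.e p.2) * x))).re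
  refine Fintype.sum_equiv (Equiv.prodComm _ _) _ _ fun p => ?_
  rw [Equiv.prodComm_apply, Prod.fst_swap, Prod.snd_swap,
    (hB.comm _ (F.mem p.1).1 _ (G.mem p.2).1).eq]

omit hBM hx in
theorem isOpMeasure_lim {ι : Type*} (U : Ultrafilter ι) {b : ι → (H →L[ℂ] H) → H →L[ℂ] H}
    {β : (H →L[ℂ] H) → H →L[ℂ] H} {r : ℝ}
    (hb : ∀ r' < r, ∀ᶠ i in (U : Filter ι),
      IsOpMeasure B (b i) ∧ ∀ F : Partition B, r' ≤ partSum τ x (b i) F)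
    (hβ : ∀ e, WOTLim (U : Filter ι) (fun i => b i e) (β e)) :
    IsOpMeasure B β ∧ ∀ F : Partition B, r ≤ partSum τ x β F := by
  refine ⟨IsOpMeasure.of_lim hB ((hb (r - 1) (by linarith)).mono fun i hi => hi.1) hβ,
    fun F => ?_⟩
  refine le_of_forall_lt fun r' hr' => ?_
  obtain ⟨r'', h1, h2⟩ := exists_between hr'
  exact h1.trans_le (ge_of_tendsto (h.tendsto_partSum hβ F) ((hb r'' h2).mono fun i hi => hi.2 F))

/-- Among the measures maximising the lower bound on Riemann sums there is a multiplicative one. -/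
theorem exists_multiplicative {β₀ : (H →L[ℂ] H) → H →L[ℂ] H} (hβ₀ : IsOpMeasure B β₀) {c : ℝ}
    (hc : ∀ F : Partition B, c ≤ partSum τ x β₀ F) :
    ∃ β, IsOpMeasure B β ∧ (∀ F : Partition B, c ≤ partSum τ x β F) ∧
      ∀ e ∈ projSet B, ∀ f ∈ projSet B, β (e * f) = β e * β f := by
  have hv := h.vna
  let S : ℝ → Set ((H →L[ℂ] H) → H →L[ℂ] H) := fun r =>
    {β | IsOpMeasure B β ∧ ∀ F : Partition B, r ≤ partSum τ x β F}
  let R : Set ℝ := {r | (S r).Nonempty}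
  have hcR : c ∈ R := ⟨β₀, hβ₀, hc⟩
  have hbdd : BddAbove R := by
    refine ⟨sqNorm τ x, ?_⟩
    rintro r ⟨β, hβ, hr⟩
    refine (hr (Partition.trivial hB)).trans ?_
    change ∑ _ : Unit, (τ (β 1 * (star x * 1 * x))).re ≤ _
    have h1 := h.mul_pos (sub_mem hv hv.one_mem (hBM (hβ.mem 1 hB.one_mem_projSet)))
      (sub_nonneg.2 hβ.one_le) hx
    rw [sub_mul, one_mul, map_sub, Complex.nonneg_iff, Complex.sub_re] at h1
    simp only [Finset.univ_unique, Finset.sum_const, Finset.card_singleton, one_smul, mul_one]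
    exact sub_nonneg.1 h1.1
  set m := sSup R with hm
  have hcm : c ≤ m := le_csSup hbdd hcR
  have hmS : (S m).Nonempty := by
    have h1 : ∀ n : ℕ, ∃ β, β ∈ S (m - 1 / (n + 1)) := by
      intro n
      obtain ⟨r, ⟨β, hβ, hr⟩, hlt⟩ := exists_lt_of_lt_csSup ⟨c, hcR⟩
        (sub_lt_self m (show (0 : ℝ) < 1 / (n + 1) by positivity))
      exact ⟨β, hβ, fun F => hlt.le.trans (hr F)⟩
    choose b hb using h1
    choose β _ hβ using fun e => exists_wot_limit (hyperfilter ℕ) (fun n => b n e) zero_le_one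
      fun n => (hb n).1.norm_le hB e
    refine ⟨β, h.isOpMeasure_lim hB (hyperfilter ℕ) (fun r' hr' => ?_) hβ⟩
    have h2 : Tendsto (fun n : ℕ => m - 1 / ((n : ℝ) + 1)) (hyperfilter ℕ) (𝓝 (m - 0)) :=
      (tendsto_const_nhds.sub tendsto_one_div_add_atTop_nhds_zero_nat).mono_left
        Nat.hyperfilter_le_atTop
    rw [sub_zero] at h2
    filter_upwards [h2.eventually (eventually_ge_nhds hr')] with n hn
    exact ⟨(hb n).1, fun F => hn.trans ((hb n).2 F)⟩
  obtain ⟨β, hβ, hext⟩ := exists_extreme_family hmS zero_le_one (fun β hβ e => hβ.1.norm_le hB e)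
    fun U y hU hy => h.isOpMeasure_lim hB U (fun r' hr' => hU.mono fun b hb =>
      ⟨hb.1, fun F => hr'.le.trans (hb.2 F)⟩) hy
  refine ⟨β, hβ.1, fun F => hcm.trans (hβ.2 F), fun e he f hf => ?_⟩
  have hdir : ∀ β₁ β₂, IsOpMeasure B β₁ → IsOpMeasure B β₂ →
      (∀ F : Partition B, partSum τ x β₁ F + partSum τ x β₂ F = 2 * partSum τ x β F) →
      β₁ ∈ S m := by
    intro β₁ β₂ h1 h2 h12
    refine ⟨h1, fun F₀ => ?_⟩
    by_contra! hlt
    have h3 : 2 * m - partSum τ x β₁ F₀ ∈ R := by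
      refine ⟨β₂, h2, fun F => ?_⟩
      have h4 := h.partSum_prod_le hB hBM hx h1 F₀ F
      have h5 := h.partSum_prod_le' hB hBM hx h2 F₀ F
      have h6 := h12 (F₀.prod hB F)
      have h7 := hβ.2 (F₀.prod hB F)
      linarith
    have := le_csSup hbdd h3
    linarith
  have hplus := hβ.1.add_defect hB he
  have hminus := hβ.1.sub_defect hB he
  have hsum : ∀ F : Partition B, partSum τ x (β + IsOpMeasure.defect B β e) F +
      partSum τ x (β - IsOpMeasure.defect B β e) F = 2 * partSum τ x β F := by
    intro F
    simp only [partSum, Pi.add_apply, Pi.sub_apply, add_mul, sub_mul, map_add, map_sub,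
      Complex.add_re, Complex.sub_re, Finset.sum_add_distrib, Finset.sum_sub_distrib]
    ring
  have h0 := hext _ (hdir _ _ hplus hminus hsum)
    (hdir _ _ hminus hplus fun F => by rw [add_comm]; exact hsum F)
  have := congrFun h0 f
  rw [IsOpMeasure.defect_of_mem hf, Pi.zero_apply, sub_eq_zero] at this
  exact this

end IsNormalTrace

theorem norm_proj_le_one {e : H →L[ℂ] H} (he : IsStarProjection e) : ‖e‖ ≤ 1 :=
  (CStarAlgebra.norm_le_one_iff_of_nonneg _ (proj_nonneg he)).2
    (sub_nonneg.1 (proj_nonneg he.one_sub))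

theorem compress_le (x : H →L[ℂ] H) {e p : H →L[ℂ] H} (he : IsStarProjection e)
    (hp : IsStarProjection p) : p * (star x * e * x) * p ≤ (‖x‖ ^ 2) • p := by
  have h3 : ‖e * x‖ ≤ ‖x‖ := (norm_mul_le _ _).trans
    (mul_le_of_le_one_left (norm_nonneg x) (norm_proj_le_one he))
  have h4 := conj_nonneg (sub_nonneg.2 (star_mul_self_le h3)) p
  have hii := he.isIdempotentElem.eq
  have h5 : star (e * x) * (e * x) = star x * e * x := by
    rw [star_mul, he.isSelfAdjoint.star_eq]
    calc _ = star x * (e * e) * x := by noncomm_ring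
      _ = _ := by rw [hii]
  rw [h5, hp.isSelfAdjoint.star_eq, mul_sub, sub_mul, mul_smul_comm, mul_one, smul_mul_assoc,
    hp.isIdempotentElem.eq] at h4
  exact sub_nonneg.1 h4

namespace IsOpMeasure

variable {B : Set (H →L[ℂ] H)} {β : (H →L[ℂ] H) → H →L[ℂ] H}

theorem map_zero (hβ : IsOpMeasure B β) (hB : IsAbelian B) : β 0 = 0 := by
  have := hβ.add_compl hB hB.zero_mem_projSet hB.zero_mem_projSet
  simpa using this

/-- The averaged operator `∑ eᵢ x β(eᵢ)` of a measure along a partition. -/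
def twist (x : H →L[ℂ] H) (β : (H →L[ℂ] H) → H →L[ℂ] H) (F : Partition B) : H →L[ℂ] H :=
  ∑ i, F.e i * x * β (F.e i)

variable (hβ : IsOpMeasure B β) (hB : IsAbelian B)
  (hm : ∀ e ∈ projSet B, ∀ f ∈ projSet B, β (e * f) = β e * β f)
include hβ hB hm

theorem mem_projSet {e : H →L[ℂ] H} (he : e ∈ projSet B) : β e ∈ projSet B := by
  refine ⟨hβ.mem e he, ?_, (hβ.nonneg e he).isSelfAdjoint⟩
  rw [IsIdempotentElem, ← hm e he e he, he.2.isIdempotentElem.eq]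

theorem star_twist_mul_twist (x : H →L[ℂ] H) (F : Partition B) :
    star (twist x β F) * twist x β F =
      ∑ i, β (F.e i) * (star x * F.e i * x) * β (F.e i) := by
  rw [twist, star_sum, Finset.sum_mul_sum]
  refine Finset.sum_congr rfl fun i _ => ?_
  have hi : star (F.e i * x * β (F.e i)) = β (F.e i) * star x * F.e i := by
    rw [star_mul, star_mul, (hβ.mem_projSet hB hm (F.mem i)).2.isSelfAdjoint.star_eq,
      (F.mem i).2.isSelfAdjoint.star_eq, mul_assoc]
  rw [Finset.sum_eq_single i, hi]
  · have hii := (F.mem i).2.isIdempotentElem.eq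
    calc β (F.e i) * star x * F.e i * (F.e i * x * β (F.e i))
        = β (F.e i) * star x * (F.e i * F.e i) * x * β (F.e i) := by noncomm_ring
      _ = _ := by rw [hii]; noncomm_ring
  · intro j _ hj
    have hij := F.orth i j hj.symm
    rw [hi]
    calc β (F.e i) * star x * F.e i * (F.e j * x * β (F.e j))
        = β (F.e i) * star x * (F.e i * F.e j) * x * β (F.e j) := by noncomm_ring
      _ = _ := by rw [hij]; noncomm_ring
  · simp

theorem norm_twist_le (x : H →L[ℂ] H) (F : Partition B) : ‖twist x β F‖ ≤ ‖x‖ := by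
  have h1 : star (twist x β F) * twist x β F ≤ (‖x‖ ^ 2) • (1 : H →L[ℂ] H) := by
    rw [star_twist_mul_twist hβ hB hm]
    calc _ ≤ ∑ i, (‖x‖ ^ 2) • β (F.e i) := Finset.sum_le_sum fun i _ =>
          compress_le x (F.mem i).2 (hβ.mem_projSet hB hm (F.mem i)).2
      _ = (‖x‖ ^ 2) • β 1 := by
        rw [← Finset.smul_sum, ← hβ.add 1 hB.one_mem_projSet F]; simp only [one_mul]
      _ ≤ _ := smul_le_smul_of_nonneg_left hβ.one_le (sq_nonneg _)
  have h2 := norm_le_of_le_smul_one (star_mul_self_nonneg _) (sq_nonneg _) h1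
  rw [CStarRing.norm_star_mul_self, ← sq] at h2
  exact (sq_le_sq₀ (norm_nonneg _) (norm_nonneg _)).1 h2

theorem mul_twist (x : H →L[ℂ] H) {e : H →L[ℂ] H} (he : e ∈ projSet B) (F : Partition B)
    (hF : ∀ i, e * F.e i = F.e i ∨ e * F.e i = 0) : e * twist x β F = twist x β F * β e := by
  rw [twist, Finset.mul_sum, Finset.sum_mul]
  refine Finset.sum_congr rfl fun i _ => ?_
  have h1 : F.e i * x * β (F.e i) * β e = F.e i * x * β (e * F.e i) := by
    rw [mul_assoc, ← hm _ (F.mem i) _ he, (hB.comm _ (F.mem i).1 _ he.1).eq]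
  have h2 : e * (F.e i * x * β (F.e i)) = e * F.e i * x * β (F.e i) := by noncomm_ring
  rw [h1, h2]
  rcases hF i with h | h <;> rw [h]
  simp [hβ.map_zero hB]

end IsOpMeasure

theorem IsNormalTrace.exists_intertwiner {M P B : Set (H →L[ℂ] H)} {τ : (H →L[ℂ] H) →ₗ[ℂ] ℂ}
    (h : IsNormalTrace M τ) (hP : IsVonNeumannAlgebra P) (hPM : P ⊆ M) (hB : IsAbelian B)
    (hBP : B ⊆ P) {x : H →L[ℂ] H} (hx : x ∈ P) {β₀ : (H →L[ℂ] H) → H →L[ℂ] H}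
    (hβ₀ : IsOpMeasure B β₀) {c : ℝ} (hc : ∀ F : Partition B, c ≤ partSum τ x β₀ F) :
    ∃ w ∈ P, ∃ β : (H →L[ℂ] H) → H →L[ℂ] H,
      (∀ e ∈ projSet B, β e ∈ projSet B ∧ e * w = w * β e) ∧ c ≤ (τ (star x * w)).re ∧
      ∀ f ∈ wotDual H, (∀ e ∈ projSet B, ∀ q ∈ projSet B, f (e * x * q) = 0) → f w = 0 := by
  obtain ⟨β, hβ, hcβ, hm⟩ := h.exists_multiplicative hB (hBP.trans hPM) (hPM hx) hβ₀ hc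
  choose F hF using Partition.exists_refining hB
  obtain ⟨w, -, hw⟩ := exists_wot_limit (Ultrafilter.of (atTop : Filter (Finset (H →L[ℂ] H))))
    (fun s => IsOpMeasure.twist x β (F s)) (norm_nonneg x)
    fun s => hβ.norm_twist_le hB hm x (F s)
  replace hw : WOTLim (Ultrafilter.of (atTop : Filter (Finset (H →L[ℂ] H))) : Filter _)
    (fun s => IsOpMeasure.twist x β (F s)) w := hw
  refine ⟨w, hw.mem hP (Eventually.of_forall fun s => ?_), β, fun e he =>
    ⟨hβ.mem_projSet hB hm he, ?_⟩, ?_, fun f hf h0 => ?_⟩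
  · exact sum_mem hP fun i _ => mul_mem hP (mul_mem hP (hBP ((F s).mem i).1) hx)
      (hBP (hβ.mem _ ((F s).mem i)))
  · refine (hw.mul_left e).unique ((hw.mul_right (β e)).congr ?_)
    filter_upwards [Ultrafilter.of_le atTop (mem_atTop ({e} : Finset (H →L[ℂ] H)))] with s hs
    exact (hβ.mul_twist hB hm x he (F s) fun i => hF s e (by simpa using hs) he i).symm
  · have h1 := h.tendsto_mul hw (star x) 1
    refine ge_of_tendsto ((Complex.continuous_re.tendsto _).comp (by simpa only [mul_one] using h1))
      (Eventually.of_forall fun s => (hcβ (F s)).trans_eq ?_)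
    rw [partSum, Function.comp, IsOpMeasure.twist, Finset.mul_sum, map_sum, Complex.re_sum]
    refine Finset.sum_congr rfl fun i _ => ?_
    have hv := h.vna
    have hi := hPM (hBP ((F s).mem i).1)
    rw [h.tracial _ (hPM (hBP (hβ.mem _ ((F s).mem i)))) _
      (mul_mem hv (mul_mem hv (star_mem hv (hPM hx)) hi) (hPM hx))]
    congr 2
  · refine tendsto_nhds_unique (hw.tendsto hf) (tendsto_const_nhds.congr fun s => ?_)
    rw [IsOpMeasure.twist, map_sum]
    exact (Finset.sum_eq_zero fun i _ => h0 _ ((F s).mem i) _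
      (hβ.mem_projSet hB hm ((F s).mem i))).symm

theorem exists_inv_sqrt {B : Set (H →L[ℂ] H)} (hB : IsAbelian B) {d : H →L[ℂ] H} (hdB : d ∈ B)
    (hd : 0 ≤ d) (hd0 : d ≠ 0) :
    ∃ p ∈ projSet B, p ≠ 0 ∧ ∃ b ∈ B, 0 ≤ b ∧ b * p = b ∧ b * d * b = p := by
  have hv := hB.toIsVonNeumannAlgebra
  set r := ‖d‖ / 2 with hr
  have hr0 : 0 < r := by have := norm_pos_iff.2 hd0; positivity
  have hrs : IsSelfAdjoint (r • (1 : H →L[ℂ] H)) := (IsSelfAdjoint.all r).smul (IsSelfAdjoint.one _)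
  obtain ⟨p, x, n, hp, hx, hn, hxn, hap, hpx, -, -, hc⟩ :=
    exists_spectral_proj (hd.isSelfAdjoint.sub hrs)
  have hc1 : ∀ t, Commute t d → Commute t p := fun t ht =>
    (hc t (ht.sub_right ((Commute.one_right t).smul_right r))).1
  have hpB : p ∈ projSet B := ⟨mem_of_commute_of hv hdB hc1, hp⟩
  have hdp : d * p = x + r • p := by
    rw [← hap, sub_mul, smul_mul_assoc, one_mul, sub_add_cancel]
  refine ⟨p, hpB, fun hp0 => ?_, ?_⟩
  · rw [hp0, zero_mul] at hpx
    have h1 : d ≤ r • 1 := by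
      rw [← sub_nonpos, hxn, ← hpx, zero_sub]; exact neg_nonpos.2 hn
    have := norm_le_of_le_smul_one hd hr0.le h1
    linarith
  have hxd : ∀ t, Commute t d → Commute t x := fun t ht =>
    (hc t (ht.sub_right ((Commute.one_right t).smul_right r))).2.1
  set D := x + r • (1 : H →L[ℂ] H) with hD
  have hDd : ∀ t, Commute t d → Commute t D := fun t ht =>
    (hxd t ht).add_right ((Commute.one_right t).smul_right r)
  obtain ⟨u, hu⟩ : IsUnit D := CStarAlgebra.isUnit_of_le (r • (1 : H →L[ℂ] H))
    (le_add_of_nonneg_left hx) (IsStrictlyPositive.smul hr0 isStrictlyPositive_one)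
  have hDs : star D = D := ((hx.isSelfAdjoint).add hrs).star_eq
  have hDinv : ∀ t, Commute t D → Commute t ↑u⁻¹ := fun t ht =>
    Commute.units_inv_right (by rwa [hu])
  have hus : star (↑u⁻¹ : H →L[ℂ] H) = ↑u⁻¹ := by
    have : star u = u := Units.ext (by rw [Units.coe_star, hu, hDs])
    rw [← Units.coe_star, star_inv, this]
  have hu0 : 0 ≤ (↑u⁻¹ : H →L[ℂ] H) := by
    have := conj_nonneg (hx.trans (le_add_of_nonneg_right (a := x) (smul_nonneg hr0.le zero_le_one)))
      (↑u⁻¹ : H →L[ℂ] H)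
    rwa [← hD, hus, ← hu, Units.inv_mul, one_mul] at this
  set k := cfc Real.sqrt (↑u⁻¹ : H →L[ℂ] H) with hk
  have hk0 : 0 ≤ k := cfc_nonneg fun t _ => Real.sqrt_nonneg t
  have hkk : k * k = ↑u⁻¹ := by
    rw [hk, ← cfc_mul Real.sqrt Real.sqrt _]
    conv_rhs => rw [← cfc_id ℝ (↑u⁻¹ : H →L[ℂ] H) hu0.isSelfAdjoint]
    exact cfc_congr fun t ht => Real.mul_self_sqrt (spectrum_nonneg_of_nonneg hu0 ht)
  have hkd : ∀ t, Commute t d → Commute t k := fun t ht =>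
    (hu0.isSelfAdjoint.commute_cfc (hDinv t (hDd t ht)).symm _).symm
  have hkB := mem_of_commute_of hv hdB hkd
  have hkp := hB.comm _ hkB _ hpB.1
  have hpp := hp.isIdempotentElem.eq
  have hxp : x * p = x := by rw [← hap, mul_assoc, hpp]
  refine ⟨k * p, mul_mem hv hkB hpB.1, mul_nonneg_of_commute hk0 (proj_nonneg hp) hkp,
    by rw [mul_assoc, hpp], ?_⟩
  have hDp : d * p = D * p := by rw [hdp, hD, add_mul, hxp, smul_mul_assoc, one_mul]
  have hkD : Commute k D := (hDd k (hkd d (Commute.refl d)).symm)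
  have hpd : Commute p d := (hB.comm _ hpB.1 _ hdB)
  calc k * p * d * (k * p) = k * (p * d) * (k * p) := by rw [← mul_assoc k p d]
    _ = k * (p * d) * (p * k) := by rw [← hkp.eq]
    _ = k * (d * p) * (p * k) := by rw [hpd.eq]
    _ = k * D * (p * p) * k := by rw [hDp]; noncomm_ring
    _ = D * (k * (p * k)) := by rw [hpp, hkD.eq]; simp only [mul_assoc]
    _ = D * (k * k) * p := by rw [← hkp.eq]; simp only [mul_assoc]
    _ = p := by rw [hkk, ← hu, Units.mul_inv, one_mul]

theorem isMasa_isAbelian {P B : Set (H →L[ℂ] H)} (hP : IsVonNeumannAlgebra P) (hB : IsMasa P B) :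
    IsAbelian B where
  toIsVonNeumannAlgebra := by
    have h1 := isVNA_inter hP (isVNA_centralizer hB.2.1)
    have h2 : P ∩ B.centralizer = B := by
      conv_rhs => rw [← hB.2.2]
      exact Set.ext fun x => and_congr_right fun _ => forall₂_congr fun a _ => eq_comm
    rwa [h2] at h1
  comm a ha b hb := by
    rw [← hB.2.2] at ha
    exact ha.2 b hb

theorem mem_masa {P B : Set (H →L[ℂ] H)} (hP : IsVonNeumannAlgebra P) (hB : IsMasa P B)
    {x : H →L[ℂ] H} (hx : x ∈ P) (h : ∀ e ∈ projSet B, x * e = e * x) : x ∈ B := by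
  rw [← hB.2.2]
  exact ⟨hx, fun a ha => commute_of_projSet (isMasa_isAbelian hP hB).toIsVonNeumannAlgebra h ha⟩

namespace IsNormalTrace

variable {M P B : Set (H →L[ℂ] H)} {τ : (H →L[ℂ] H) →ₗ[ℂ] ℂ} (h : IsNormalTrace M τ)
  (hP : IsVonNeumannAlgebra P) (hPM : P ⊆ M) (hB : IsMasa P B)
include h hP hPM

omit hP in
theorem eq_of_forall_trace (hP : IsVonNeumannAlgebra P) {x y : H →L[ℂ] H} (hx : x ∈ P) (hy : y ∈ P)
    (hxy : ∀ m ∈ P, τ (x * m) = τ (y * m)) : x = y := by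
  have hs := sub_mem hP hx hy
  rw [← sub_eq_zero, ← star_eq_zero]
  refine h.faithful _ (hPM (star_mem hP hs)) ?_
  rw [star_star, sub_mul, map_sub, hxy _ (star_mem hP hs), sub_self]

include hB

/-- The expectation of a measure with values in the commutant of `B` takes values in `B`. -/
theorem exists_opMeasure {D : (H →L[ℂ] H) → H →L[ℂ] H} (hDM : ∀ e ∈ projSet B, D e ∈ M)
    (hDB : ∀ e ∈ projSet B, ∀ a ∈ projSet B, Commute (D e) a) (hD0 : ∀ e ∈ projSet B, 0 ≤ D e)
    (hD1 : ∀ e ∈ projSet B, D e ≤ 1)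
    (hadd : ∀ q ∈ projSet B, ∀ F : Partition B, ∑ i, D (q * F.e i) = D q) :
    ∃ β, IsOpMeasure B β ∧ ∀ e ∈ projSet B, ∀ m ∈ P, τ (β e * m) = τ (D e * m) := by
  classical
  have hv := h.vna
  have hA := isMasa_isAbelian hP hB
  have hex : ∀ e, ∃ x, (e ∈ projSet B → x ∈ P ∧ 0 ≤ x ∧ x ≤ 1 ∧ ∀ m ∈ P, τ (x * m) = τ (D e * m)) ∧
      (e ∉ projSet B → x = 0) := by
    intro e
    by_cases he : e ∈ projSet B
    · obtain ⟨x, hxP, hx0, hx1, hx⟩ := h.exists_density hP hPM (τ ∘ₗ LinearMap.mulLeft ℂ (D e))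
        (fun m hm => h.mul_pos (hDM e he) (hD0 e he) (hPM hm)) (fun m hm => by
          have := h.mul_pos (sub_mem hv hv.one_mem (hDM e he)) (sub_nonneg.2 (hD1 e he)) (hPM hm)
          rw [sub_mul, one_mul, map_sub, sub_nonneg] at this
          exact this)
      exact ⟨x, fun _ => ⟨hxP, hx0, hx1, fun m hm => (hx m hm).symm⟩, fun h' => absurd he h'⟩
    · exact ⟨0, fun h' => absurd h' he, fun _ => rfl⟩
  choose β hβ hβ0 using hex
  have hmem : ∀ e ∈ projSet B, β e ∈ B := by
    intro e he
    obtain ⟨hP', -, -, ht⟩ := hβ e he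
    refine mem_masa hP hB hP' fun a ha => ?_
    have haP := hB.1 ha.1
    refine h.eq_of_forall_trace hPM hP (mul_mem hP hP' haP) (mul_mem hP haP hP') fun m hm => ?_
    rw [mul_assoc, ht _ (mul_mem hP haP hm), mul_assoc a,
      h.tracial _ (hPM haP) _ (hPM (mul_mem hP hP' hm)), mul_assoc, ht _ (mul_mem hP hm haP),
      ← mul_assoc, ← mul_assoc,
      h.tracial _ (mul_mem hv (hDM e he) (hPM hm)) _ (hPM haP), ← mul_assoc, (hDB e he a ha).eq]
  refine ⟨β, ⟨hmem, fun e he => (hβ e he).2.1, (hβ 1 hA.one_mem_projSet).2.2.1, hβ0,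
    fun q hq F => ?_⟩, fun e he => (hβ e he).2.2.2⟩
  have hqF := fun i => hA.mul_mem_projSet hq (F.mem i)
  refine h.eq_of_forall_trace hPM hP (sum_mem hP fun i _ => (hβ _ (hqF i)).1) (hβ q hq).1
    fun m hm => ?_
  rw [(hβ q hq).2.2.2 m hm, ← hadd q hq F, Finset.sum_mul, Finset.sum_mul, map_sum, map_sum]
  exact Finset.sum_congr rfl fun i _ => (hβ _ (hqF i)).2.2.2 m hm

omit hP hPM hB in
theorem sqNorm_sum (F : Partition B) (t : F.ι → H →L[ℂ] H)
    (ht : ∀ i, F.e i * t i = t i) : sqNorm τ (∑ i, t i) = ∑ i, sqNorm τ (t i) := by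
  rw [sqNorm, star_sum, Finset.sum_mul_sum, map_sum, Complex.re_sum]
  refine Finset.sum_congr rfl fun i _ => ?_
  rw [Finset.sum_eq_single i, sqNorm]
  · intro j _ hj
    rw [← ht i, ← ht j, star_mul, (F.mem i).2.isSelfAdjoint.star_eq, mul_assoc,
      ← mul_assoc (F.e i), F.orth i j hj.symm, zero_mul, mul_zero]
  · simp

/-- If `τ(x g*) ≠ 0` and all `g* e g` commute with `B`, then the average `w` of `x` intertwines. -/
theorem exists_intertwiner_of {x g : H →L[ℂ] H} (hx : x ∈ P) (hg : g ∈ M)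
    (hgB : ∀ e ∈ projSet B, ∀ a ∈ projSet B, Commute (star g * e * g) a)
    (h0 : τ (x * star g) ≠ 0) :
    ∃ w ∈ P, ∃ β : (H →L[ℂ] H) → H →L[ℂ] H,
      (∀ e ∈ projSet B, β e ∈ projSet B ∧ e * w = w * β e) ∧ τ (star x * w) ≠ 0 ∧
      ∀ f ∈ wotDual H, (∀ e ∈ projSet B, ∀ q ∈ projSet B, f (e * x * q) = 0) → f w = 0 := by
  have hv := h.vna
  have hA := isMasa_isAbelian hP hB
  have hxM := hPM hx
  have hsg := star_mem hv hg
  have hg0 : 0 < ‖g‖ := norm_pos_iff.2 fun hg0 => h0 (by rw [hg0, star_zero, mul_zero, map_zero])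
  set κ : ℝ := (‖g‖ ^ 2)⁻¹ with hκ
  have hκ0 : 0 < κ := by positivity
  have hBM := hB.1.trans hPM
  obtain ⟨β₀, hβ₀, hτ⟩ := h.exists_opMeasure hP hPM hB (D := fun e => κ • (star g * e * g))
    (fun e he => rsmul_mem hv κ (mul_mem hv (mul_mem hv hsg (hBM he.1)) hg))
    (fun e he a ha => (hgB e he a ha).smul_left κ)
    (fun e he => smul_nonneg hκ0.le (conj_nonneg (proj_nonneg he.2) g))
    (fun e he => by
      have h1 := compress_le g he.2 (IsStarProjection.one _)
      rw [one_mul, mul_one] at h1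
      have h2 := smul_le_smul_of_nonneg_left h1 hκ0.le
      rwa [smul_smul, hκ, inv_mul_cancel₀ (by positivity), one_smul] at h2)
    (fun q hq F => by
      rw [← Finset.smul_sum, ← Finset.sum_mul, ← Finset.mul_sum, ← Finset.mul_sum, F.sum, mul_one])
  have hc : ∀ F : Partition B, κ * ‖τ (x * star g)‖ ^ 2 ≤ partSum τ x β₀ F := by
    intro F
    have heM := fun i => hBM (F.mem i).1
    have hsa := fun i => (F.mem i).2.isSelfAdjoint.star_eq
    have hid := fun i => (F.mem i).2.isIdempotentElem.eq
    have htM := fun i => mul_mem hv (mul_mem hv (mul_mem hv (heM i) hxM) hsg) (heM i)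
    have e1 : partSum τ x β₀ F = κ * sqNorm τ (∑ i, F.e i * x * star g * F.e i) := by
      rw [h.sqNorm_sum F _ (fun i => by simp only [← mul_assoc, hid i]), partSum, Finset.mul_sum]
      refine Finset.sum_congr rfl fun i _ => ?_
      rw [hτ _ (F.mem i) _ (mul_mem hP (mul_mem hP (star_mem hP hx) (hB.1 (F.mem i).1)) hx),
        smul_mul_assoc, sqNorm]
      have e2 : star (F.e i * x * star g * F.e i) * (F.e i * x * star g * F.e i) =
          F.e i * (g * star x * F.e i * x * star g * F.e i) := by
        rw [star_mul, star_mul, star_mul, star_star, hsa]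
        calc _ = F.e i * (g * star x * (F.e i * F.e i) * x * star g * F.e i) := by noncomm_ring
          _ = _ := by rw [hid]
      have e3 : star g * F.e i * g * (star x * F.e i * x) =
          star g * F.e i * (g * star x * F.e i * x) := by noncomm_ring
      have hgm : g * star x * F.e i * x ∈ M :=
        mul_mem hv (mul_mem hv (mul_mem hv hg (star_mem hv hxM)) (heM i)) hxM
      rw [e2, h.tracial _ (heM i) _ (mul_mem hv (mul_mem hv hgm hsg) (heM i)), e3,
        show τ (κ • (star g * F.e i * (g * star x * F.e i * x))) =
          κ • τ (star g * F.e i * (g * star x * F.e i * x)) from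
            (τ.restrictScalars ℝ).map_smul κ _, h.tracial _ (mul_mem hv hsg (heM i)) _ hgm,
        Complex.real_smul, Complex.re_ofReal_mul, mul_assoc _ (F.e i) (F.e i), hid,
        mul_assoc _ (star g)]
    rw [e1]
    refine mul_le_mul_of_nonneg_left ?_ hκ0.le
    have h1 := h.cauchy hv.one_mem (sum_mem hv (s := Finset.univ) fun i _ => htM i)
    have h2 : sqNorm τ 1 = 1 := by rw [sqNorm, star_one, one_mul, h.map_one, Complex.one_re]
    rw [h2, one_mul, star_one, one_mul] at h1
    have h3 : τ (∑ i, F.e i * x * star g * F.e i) = τ (x * star g) := by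
      rw [map_sum]
      have h4 : ∀ i, τ (F.e i * x * star g * F.e i) = τ (F.e i * (x * star g)) := fun i => by
        rw [h.tracial _ (mul_mem hv (mul_mem hv (heM i) hxM) hsg) _ (heM i)]
        simp only [← mul_assoc, hid i]
      simp only [h4]
      rw [← map_sum, ← Finset.sum_mul, F.sum, one_mul]
    rwa [h3] at h1
  obtain ⟨w, hw, β, hβ, hre, hf⟩ := h.exists_intertwiner hP hPM hA hB.1 hx hβ₀ hc
  refine ⟨w, hw, β, hβ, fun h1 => ?_, hf⟩
  rw [h1, Complex.zero_re] at hre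
  have : 0 < κ * ‖τ (x * star g)‖ ^ 2 := by
    have := norm_pos_iff.2 h0
    positivity
  linarith

end IsNormalTrace

theorem mem_normalizerSet_iff {P B : Set (H →L[ℂ] H)} {u : H →L[ℂ] H} :
    u ∈ normalizerSet P B ↔ u ∈ P ∧ IsUnitary u ∧ (∀ a ∈ B, u * a * star u ∈ B) ∧
      ∀ a ∈ B, star u * a * u ∈ B := by
  refine and_congr_right fun _ => and_congr_right fun hu => ?_
  have h1 : ∀ a, star u * (u * a * star u) * u = a := fun a => by
    calc _ = (star u * u) * a * (star u * u) := by noncomm_ring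
      _ = a := by rw [hu.1, one_mul, mul_one]
  have h2 : ∀ a, u * (star u * a * u) * star u = a := fun a => by
    calc _ = (u * star u) * a * (u * star u) := by noncomm_ring
      _ = a := by rw [hu.2, one_mul, mul_one]
  constructor
  · intro h
    refine ⟨fun a ha => h ▸ Set.mem_image_of_mem _ ha, fun a ha => ?_⟩
    rw [← h] at ha
    obtain ⟨b, hb, rfl⟩ := ha
    rwa [h1]
  · rintro ⟨h3, h4⟩
    refine Set.Subset.antisymm (Set.image_subset_iff.2 h3) fun a ha => ⟨_, h4 a ha, h2 a⟩

theorem star_mem_normalizerSet {P B : Set (H →L[ℂ] H)} (hP : IsVonNeumannAlgebra P)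
    {u : H →L[ℂ] H} (hu : u ∈ normalizerSet P B) : star u ∈ normalizerSet P B := by
  rw [mem_normalizerSet_iff] at hu ⊢
  refine ⟨star_mem hP hu.1, ⟨?_, ?_⟩, ?_, ?_⟩
  · rw [star_star]; exact hu.2.1.2
  · rw [star_star]; exact hu.2.1.1
  · rw [star_star]; exact hu.2.2.2
  · rw [star_star]; exact hu.2.2.1

theorem conj_mem_projSet {P B : Set (H →L[ℂ] H)} {u : H →L[ℂ] H} (hu : u ∈ normalizerSet P B)
    {e : H →L[ℂ] H} (he : e ∈ projSet B) : star u * e * u ∈ projSet B := by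
  rw [mem_normalizerSet_iff] at hu
  refine ⟨hu.2.2.2 e he.1, ?_, ?_⟩
  · have hee := he.2.isIdempotentElem.eq
    calc star u * e * u * (star u * e * u) = star u * e * (u * star u) * e * u := by noncomm_ring
      _ = star u * (e * e) * u := by rw [hu.2.1.2]; noncomm_ring
      _ = star u * e * u := by rw [hee]
  · rw [IsSelfAdjoint, star_mul, star_mul, star_star, he.2.isSelfAdjoint.star_eq, mul_assoc]

theorem mul_mem_normalizerSet_of_mem {P B : Set (H →L[ℂ] H)} (hP : IsVonNeumannAlgebra P) (hBP : B ⊆ P)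
    (hB : IsVonNeumannAlgebra B) {u w : H →L[ℂ] H} (hu : u ∈ normalizerSet P B)
    (hw : w ∈ B) (hwu : IsUnitary w) : u * w ∈ normalizerSet P B := by
  rw [mem_normalizerSet_iff] at hu ⊢
  have hsw := star_mem hB hw
  refine ⟨mul_mem hP hu.1 (hBP hw), ⟨?_, ?_⟩, fun a ha => ?_, fun a ha => ?_⟩
  · rw [star_mul, mul_assoc, ← mul_assoc (star u), hu.2.1.1, one_mul, hwu.1]
  · rw [star_mul, mul_assoc, ← mul_assoc w, hwu.2, one_mul, hu.2.1.2]
  · have := hu.2.2.1 _ (mul_mem hB (mul_mem hB hw ha) hsw)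
    rw [star_mul]
    simpa only [mul_assoc] using this
  · have := mul_mem hB (mul_mem hB hsw (hu.2.2.2 _ ha)) hw
    rw [star_mul]
    simpa only [mul_assoc] using this

theorem isUnitary_two_smul_sub_one {e : H →L[ℂ] H} (he : IsStarProjection e) :
    IsUnitary ((2 : ℂ) • e - 1) := by
  have hee := he.isIdempotentElem.eq
  have h1 : star ((2 : ℂ) • e - 1) = (2 : ℂ) • e - 1 := by
    rw [star_sub, star_smul, he.isSelfAdjoint.star_eq, star_one]
    congr 2
    norm_num
  have h2 : ((2 : ℂ) • e - 1) * ((2 : ℂ) • e - 1) = 1 := by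
    have : (2 : ℂ) • e = e + e := two_smul ℂ e
    rw [this]
    calc (e + e - 1) * (e + e - 1) = 4 • (e * e) - 4 • e + 1 := by noncomm_ring
      _ = 1 := by rw [hee, sub_self, zero_add]
  exact ⟨by rw [h1, h2], by rw [h1, h2]⟩

/-- `x` is orthogonal to the normalizing unitaries of `B` in `P`. -/
def Perp (P B : Set (H →L[ℂ] H)) (τ : (H →L[ℂ] H) →ₗ[ℂ] ℂ) (x : H →L[ℂ] H) : Prop :=
  ∀ n ∈ normalizerSet P B, τ (star n * x) = 0

namespace IsNormalTrace

variable {M P B : Set (H →L[ℂ] H)} {τ : (H →L[ℂ] H) →ₗ[ℂ] ℂ} (h : IsNormalTrace M τ)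
  (hP : IsVonNeumannAlgebra P) (hPM : P ⊆ M) (hB : IsMasa P B)
include h hP hPM

theorem perp_star {x : H →L[ℂ] H} (hx : x ∈ P) (hp : Perp P B τ x) : Perp P B τ (star x) := by
  intro n hn
  have h1 := hp _ (star_mem_normalizerSet hP hn)
  rw [star_star] at h1
  have hnM := hPM hn.1
  rw [h.tracial _ (star_mem h.vna hnM) _ (star_mem h.vna (hPM hx)), ← star_mul,
    h.map_star (mul_mem h.vna hnM (hPM hx)), h1, star_zero]

include hB

omit h hPM in
theorem perp_mul {x n e : H →L[ℂ] H} (hp : Perp P B τ x) (hn : n ∈ normalizerSet P B)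
    (he : e ∈ projSet B) : τ (star (n * e) * x) = 0 := by
  have hA := (isMasa_isAbelian hP hB).toIsVonNeumannAlgebra
  have h1 := hp _ hn
  have h2 := hp _ (mul_mem_normalizerSet_of_mem hP hB.1 hA hn
    (sub_mem hA (smul_mem hA 2 he.1) hA.one_mem) (isUnitary_two_smul_sub_one he.2))
  have e1 : n * e = (2⁻¹ : ℂ) • (n + n * ((2 : ℂ) • e - 1)) := by
    rw [mul_sub, mul_smul_comm, mul_one, add_sub_cancel, smul_smul]
    norm_num
  rw [e1, star_smul, star_add, smul_mul_assoc, add_mul, map_smul, map_add, h1, h2, add_zero,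
    smul_zero]

theorem perp_conj {x n e q : H →L[ℂ] H} (hx : x ∈ P) (hp : Perp P B τ x)
    (hn : n ∈ normalizerSet P B) (he : e ∈ projSet B) (hq : q ∈ projSet B) :
    τ (star n * (e * x * q)) = 0 := by
  have hA := isMasa_isAbelian hP hB
  have hv := h.vna
  have h1 := perp_mul hP hB hp hn (hA.mul_mem_projSet (conj_mem_projSet hn he) hq)
  have e1 : n * (star n * e * n * q) = e * n * q := by
    calc n * (star n * e * n * q) = (n * star n) * e * n * q := by noncomm_ring
      _ = _ := by rw [hn.2.1.2, one_mul]
  have hm := fun {a b} => mul_mem (x := a) (y := b) hv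
  have hnM := star_mem hv (hPM hn.1)
  have heM := hPM (hB.1 he.1)
  have hqM := hPM (hB.1 hq.1)
  rw [e1, star_mul, star_mul, he.2.isSelfAdjoint.star_eq, hq.2.isSelfAdjoint.star_eq] at h1
  rw [← h1, mul_assoc q, h.tracial q hqM _ (hm (hm hnM heM) (hPM hx))]
  simp only [mul_assoc]

/-- Replacing one intertwiner by one which intertwines on both sides. -/
theorem exists_double_intertwiner {x g : H →L[ℂ] H} (hx : x ∈ P) (hp : Perp P B τ x) (hg : g ∈ M)
    (hgB : ∀ e ∈ projSet B, ∀ a ∈ projSet B, Commute (star g * e * g) a)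
    (h0 : τ (x * star g) ≠ 0) :
    ∃ z ∈ P, z ≠ 0 ∧ Perp P B τ z ∧ ∃ β β' : (H →L[ℂ] H) → H →L[ℂ] H,
      ∀ e ∈ projSet B, β e ∈ projSet B ∧ β' e ∈ projSet B ∧ e * z = z * β e ∧
        z * e = β' e * z := by
  have hA := isMasa_isAbelian hP hB
  have hv := h.vna
  have key : ∀ {y w : H →L[ℂ] H}, y ∈ P → Perp P B τ y → (∀ f ∈ wotDual H,
      (∀ e ∈ projSet B, ∀ q ∈ projSet B, f (e * y * q) = 0) → f w = 0) → Perp P B τ w := by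
    intro y w hyP hy hw n hn
    obtain ⟨f, hf, hfx⟩ := wotDual_conj h.wot (star n) 1
    simp only [mul_one] at hfx
    rw [← hfx]
    refine hw f hf fun e he q hq => ?_
    rw [hfx]
    exact h.perp_conj hP hPM hB hyP hy hn he hq
  obtain ⟨w, hwP, β, hβ, hτw, hw⟩ := h.exists_intertwiner_of hP hPM hB hx hg hgB h0
  have hs : ∀ e ∈ projSet B, star w * e = β e * star w := fun e he => by
    have := congrArg star (hβ e he).2
    rwa [star_mul, star_mul, he.2.isSelfAdjoint.star_eq, (hβ e he).1.2.isSelfAdjoint.star_eq]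
      at this
  have hswP := star_mem hP hwP
  obtain ⟨z, hzP, β', hβ', hτz, hz⟩ := h.exists_intertwiner_of hP hPM hB hswP
    (star_mem hv (hPM hwP)) (fun e he a ha => by
      rw [star_star]
      calc w * e * star w * a = w * e * (star w * a) := by rw [mul_assoc]
        _ = w * (e * β a) * star w := by rw [hs a ha]; simp only [mul_assoc]
        _ = (w * β a) * e * star w := by
          rw [hA.comm _ he.1 _ (hβ a ha).1.1]; simp only [mul_assoc]
        _ = a * (w * e * star w) := by rw [← (hβ a ha).2]; simp only [mul_assoc])
    (fun h1 => hτw (by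
      rw [star_star] at h1
      rw [h.faithful w (hPM hwP) h1, mul_zero, map_zero]))
  rw [star_star] at hτz
  have hzperp := key hswP (h.perp_star hP hPM hwP (key hx hp hw)) hz
  refine ⟨star z, star_mem hP hzP, fun h1 => hτz (by rw [star_eq_zero.1 h1, mul_zero, map_zero]),
    h.perp_star hP hPM hzP hzperp, β, β', fun e he => ⟨(hβ e he).1, (hβ' e he).1, ?_, ?_⟩⟩
  · have h1 : z * e = β e * z := by
      ext ξ
      refine ext_inner_left ℂ fun ζ => ?_
      obtain ⟨f₁, hf₁, h₁⟩ := wotDual_conj (Submodule.subset_span ⟨(ζ, ξ), rfl⟩ :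
        vecFunctional ζ ξ ∈ wotDual H) 1 e
      obtain ⟨f₂, hf₂, h₂⟩ := wotDual_conj (Submodule.subset_span ⟨(ζ, ξ), rfl⟩ :
        vecFunctional ζ ξ ∈ wotDual H) (β e) 1
      have h3 := hz (f₁ - f₂) (_root_.sub_mem hf₁ hf₂) fun a ha q hq => by
        rw [LinearMap.sub_apply, h₁, h₂, sub_eq_zero]
        congr 1
        calc 1 * (a * star w * q) * e = a * star w * (q * e) := by noncomm_ring
          _ = a * (star w * e) * q := by rw [hA.comm _ hq.1 _ he.1]; simp only [mul_assoc]
          _ = (a * β e) * star w * q := by rw [hs e he]; simp only [mul_assoc]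
          _ = β e * (a * star w * q) * 1 := by
            rw [hA.comm _ ha.1 _ (hβ e he).1.1, mul_one]; simp only [mul_assoc]
      rw [LinearMap.sub_apply, h₁, h₂, sub_eq_zero, one_mul, mul_one] at h3
      exact h3
    have := congrArg star h1
    rwa [star_mul, star_mul, he.2.isSelfAdjoint.star_eq, (hβ e he).1.2.isSelfAdjoint.star_eq]
      at this
  · have := congrArg star (hβ' e he).2
    rwa [star_mul, star_mul, he.2.isSelfAdjoint.star_eq, (hβ' e he).1.2.isSelfAdjoint.star_eq]
      at this

end IsNormalTrace

/-- A partial isometry moving a projection of `B` to an orthogonal one extends to a symmetry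
normalizing `B`. -/
theorem exists_normalizer_of_orthogonal {P B : Set (H →L[ℂ] H)} (hP : IsVonNeumannAlgebra P)
    (hBP : B ⊆ P) (hB : IsAbelian B) {v p : H →L[ℂ] H} (hv : v ∈ P) (hpB : p ∈ projSet B)
    (hvv : star v * v = p) (hvp : v * p = v) (hl : ∀ a ∈ B, v * a * star v ∈ B)
    (hr : ∀ a ∈ B, star v * a * v ∈ B) (h0 : v * p * star v * p = 0) :
    ∃ u ∈ normalizerSet P B, v * p = u * p := by
  have hp := hpB.2.isSelfAdjoint.star_eq
  have hpp := hpB.2.isIdempotentElem.eq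
  have hA := hB.toIsVonNeumannAlgebra
  set q := v * star v with hq
  have hqB : q ∈ B := by have := hl p hpB.1; rwa [hvp] at this
  have hqs : star q = q := by rw [hq, star_mul, star_star]
  have hpv : p * star v = star v := by
    have := congrArg star hvp; rwa [star_mul, hp] at this
  have hqv : q * v = v := by rw [hq, mul_assoc, hvv, hvp]
  have hvq : star v * q = star v := by
    have := congrArg star hqv; rwa [star_mul, hqs] at this
  have hqp : q * p = 0 := by rw [hvp] at h0; exact h0
  have hpq : p * q = 0 := by rw [← (hB.comm _ hqB _ hpB.1).eq]; exact hqp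
  have hqq : q * q = q := by rw [hq, ← mul_assoc]; rw [← hq, hqv]
  have hpv0 : p * v = 0 := by rw [← hqv, ← mul_assoc, hpq, zero_mul]
  have hvp0 : star v * p = 0 := by
    have := congrArg star hpv0; rwa [star_mul, hp, star_zero] at this
  have hvv0 : v * v = 0 := by rw [← hvp, mul_assoc, ← mul_assoc p, hpv0, zero_mul, mul_zero]
  have hvv0' : star v * star v = 0 := by rw [← star_mul, hvv0, star_zero]
  have hqsv : q * star v = 0 := by rw [hq, mul_assoc, hvv0', mul_zero]
  have hvq0 : v * q = 0 := by rw [hq, ← mul_assoc, hvv0, zero_mul]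
  have hrB : 1 - p - q ∈ B := sub_mem hA (sub_mem hA hA.one_mem hpB.1) hqB
  set u := v + star v + (1 - p - q) with hu
  have hus : star u = u := by
    rw [hu, star_add, star_add, star_sub, star_sub, star_star, star_one, hp, hqs, add_comm v]
  have huu : u * u = 1 := by
    simp only [hu, add_mul, mul_add, sub_mul, mul_sub, mul_one, one_mul, hvv0, hvv0', hvp, hvq0,
      hvp0, hvq, hpv, hpv0, hqv, hqsv, hpp, hpq, hqp, hqq, hvv, ← hq]
    abel
  have hconj : ∀ a ∈ B, u * a * u ∈ B := by
    intro a ha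
    have hap := (hB.comm _ ha _ hpB.1).eq
    have haq := (hB.comm _ ha _ hqB).eq
    have z1 : v * a * v = 0 := by
      have : v * a * (q * v) = 0 := by
        rw [← mul_assoc, mul_assoc v a q, haq, ← mul_assoc v, hvq0]; simp
      rwa [hqv] at this
    have z2 : star v * a * star v = 0 := by
      have : star v * a * (p * star v) = 0 := by
        rw [← mul_assoc, mul_assoc (star v) a p, hap, ← mul_assoc (star v), hvp0]; simp
      rwa [hpv] at this
    have z3 : v * a * (1 - p - q) = 0 := by
      have : a * (1 - p - q) = (1 - p - q) * a := (hB.comm _ ha _ hrB).eq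
      rw [mul_assoc, this, ← mul_assoc, mul_sub, mul_sub, mul_one, hvp, hvq0]; simp
    have z4 : star v * a * (1 - p - q) = 0 := by
      have : a * (1 - p - q) = (1 - p - q) * a := (hB.comm _ ha _ hrB).eq
      rw [mul_assoc, this, ← mul_assoc, mul_sub, mul_sub, mul_one, hvp0, hvq]; simp
    have z5 : (1 - p - q) * a * v = 0 := by
      have : (1 - p - q) * a = a * (1 - p - q) := (hB.comm _ hrB _ ha).eq
      rw [this, mul_assoc, sub_mul, sub_mul, one_mul, hpv0, hqv]; simp
    have z6 : (1 - p - q) * a * star v = 0 := by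
      have : (1 - p - q) * a = a * (1 - p - q) := (hB.comm _ hrB _ ha).eq
      rw [this, mul_assoc, sub_mul, sub_mul, one_mul, hpv, hqsv]; simp
    have e1 : u * a * u = v * a * star v + star v * a * v + (1 - p - q) * a * (1 - p - q) := by
      rw [hu]
      generalize 1 - p - q = r at z3 z4 z5 z6
      simp only [add_mul, mul_add, z1, z2, z3, z4, z5, z6]
      abel
    rw [e1]
    exact VNA.add_mem hA (VNA.add_mem hA (hl a ha) (hr a ha)) (mul_mem hA (mul_mem hA hrB ha) hrB)
  refine ⟨u, mem_normalizerSet_iff.2 ⟨?_, ⟨?_, ?_⟩, ?_, ?_⟩, ?_⟩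
  · exact VNA.add_mem hP (VNA.add_mem hP hv (star_mem hP hv)) (hBP hrB)
  · rw [hus, huu]
  · rw [hus, huu]
  · rw [hus]; exact hconj
  · rw [hus]; exact hconj
  · rw [hu]
    simp only [add_mul, sub_mul, one_mul, hvp0, hpp, hqp]
    abel

namespace IsNormalTrace

variable {M P B : Set (H →L[ℂ] H)} {τ : (H →L[ℂ] H) →ₗ[ℂ] ℂ} (h : IsNormalTrace M τ)
  (hP : IsVonNeumannAlgebra P) (hPM : P ⊆ M) (hB : IsMasa P B)
include h hP hPM hB

theorem exists_normalizer_of_partial {v p : H →L[ℂ] H} (hv : v ∈ P) (hpB : p ∈ projSet B)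
    (hp0 : p ≠ 0) (hvv : star v * v = p) (hvp : v * p = v) (hl : ∀ a ∈ B, v * a * star v ∈ B)
    (hr : ∀ a ∈ B, star v * a * v ∈ B) :
    ∃ u ∈ normalizerSet P B, ∃ q ∈ projSet B, q ≠ 0 ∧ p * q = q ∧ v * q = u * q := by
  have hB' := isMasa_isAbelian hP hB
  have hA := hB'.toIsVonNeumannAlgebra
  have hp := hpB.2.isSelfAdjoint.star_eq
  have hpp := hpB.2.isIdempotentElem.eq
  by_cases hcase : ∃ q ∈ projSet B, q ≠ 0 ∧ p * q = q ∧ v * q * star v * q = 0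
  · obtain ⟨q, hq, hq0, hpq, hvq⟩ := hcase
    have hqs := hq.2.isSelfAdjoint.star_eq
    have hqq := hq.2.isIdempotentElem.eq
    have hsvq : star (v * q) = q * star v := by rw [star_mul, hqs]
    obtain ⟨u, hu, huq⟩ := exists_normalizer_of_orthogonal hP hB.1 hB' (v := v * q) (p := q)
      (mul_mem hP hv (hB.1 hq.1)) hq
      (by rw [hsvq, mul_assoc, ← mul_assoc (star v), hvv, hpq, hqq]) (by rw [mul_assoc, hqq])
      (fun a ha => by
        have := hl _ (mul_mem hA (mul_mem hA hq.1 ha) hq.1)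
        rw [hsvq]
        simpa only [mul_assoc] using this)
      (fun a ha => by
        have := mul_mem hA (mul_mem hA hq.1 (hr a ha)) hq.1
        rw [hsvq]
        simpa only [mul_assoc] using this)
      (by
        rw [hsvq]
        calc v * q * q * (q * star v) * q = v * (q * q * q) * star v * q := by noncomm_ring
          _ = 0 := by rw [hqq, hqq, hvq])
    rw [mul_assoc, hqq] at huq
    exact ⟨u, hu, q, hq, hq0, hpq, huq⟩
  · push Not at hcase
    have hθ : ∀ e ∈ projSet B, v * e * star v ∈ projSet B := fun e he => by
      refine ⟨hl e he.1, ?_, ?_⟩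
      · have hep := (hB'.comm _ hpB.1 _ he.1).eq
        have hee := he.2.isIdempotentElem.eq
        calc v * e * star v * (v * e * star v) = v * e * (star v * v) * e * star v := by
              noncomm_ring
          _ = v * (e * (p * e)) * star v := by rw [hvv]; noncomm_ring
          _ = v * p * e * star v := by rw [hep, ← mul_assoc e, hee, ← hep]; noncomm_ring
          _ = v * e * star v := by rw [hvp]
      · rw [IsSelfAdjoint, star_mul, star_mul, star_star, he.2.isSelfAdjoint.star_eq, mul_assoc]
    have hfix : ∀ e ∈ projSet B, p * e = e → v * e * star v = e := by
      intro e he hpe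
      set θ := v * e * star v with hθe
      have hθB := hθ e he
      have hee := he.2.isIdempotentElem.eq
      have hrB := hB'.mul_mem_projSet he (hB'.compl_mem_projSet hθB)
      have hr0 : e * (1 - θ) = 0 := by
        by_contra hne
        refine hcase _ hrB hne (by rw [← mul_assoc, hpe]) ?_
        have hc := (hB'.comm _ hrB.1 _ he.1).eq
        have h1 : v * (e * (1 - θ)) * star v * θ = v * (e * (1 - θ)) * star v := by
          calc v * (e * (1 - θ)) * star v * θ = v * (e * (1 - θ)) * (star v * v) * e * star v := by
                rw [hθe]; noncomm_ring
            _ = v * (e * (1 - θ) * (p * e)) * star v := by rw [hvv]; noncomm_ring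
            _ = v * (e * (1 - θ)) * star v := by rw [hpe, hc, ← mul_assoc e, hee]
        rw [← h1]
        have hθ0 : θ * (1 - θ) = 0 := hθB.2.mul_one_sub_self
        rw [(hB'.comm _ he.1 _ (hB'.compl_mem_projSet hθB).1).eq, mul_assoc _ θ, ← mul_assoc θ, hθ0,
          zero_mul, mul_zero]
      have h2 : e * θ = e := by
        rw [mul_sub, mul_one, sub_eq_zero] at hr0; exact hr0.symm
      have hM := fun {x} (hx : x ∈ B) => hPM (hB.1 hx)
      have h3 : θ - e = θ * (1 - e) := by
        rw [mul_sub, mul_one, ← (hB'.comm _ he.1 _ hθB.1).eq, h2]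
      have h4 := h.eq_zero_of_nonneg (sub_mem h.vna (hM hθB.1) (hM he.1))
        (by rw [h3]; exact proj_nonneg (hB'.mul_mem_projSet hθB (hB'.compl_mem_projSet he)).2)
        (by
          rw [map_sub, h.tracial _ (mul_mem h.vna (hPM hv) (hM he.1)) _
            (star_mem h.vna (hPM hv)), ← mul_assoc, hvv, hpe, sub_self])
      exact sub_eq_zero.1 h4
    have hvB : v ∈ B := by
      refine mem_masa hP hB hv fun f hf => ?_
      have hpf := hB'.mul_mem_projSet hpB hf
      have h1 := hfix _ hpf (by rw [← mul_assoc, hpp])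
      have h2 := hfix p hpB hpp
      have hc := (hB'.comm _ hpB.1 _ hf.1).eq
      have h3 : p * v = v := by
        conv_lhs => rw [← h2]
        rw [mul_assoc, hvv, mul_assoc, hpp, hvp]
      calc v * f = v * p * f * p := by rw [mul_assoc _ f, ← hc, ← mul_assoc, mul_assoc v, hpp, hvp]
        _ = v * (p * f) * star v * v := by rw [← hvv]; simp only [mul_assoc]
        _ = f * (p * v) := by rw [h1, hc, mul_assoc]
        _ = f * v := by rw [h3]
    have hsv : v * star v = p := by
      have := hfix p hpB hpp
      rwa [hvp] at this
    have hcv := hB'.comm _ (star_mem hA hvB) _ hvB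
    have h1p := sub_mem hA hA.one_mem hpB.1
    have hpv : p * v = v := by rw [(hB'.comm _ hpB.1 _ hvB).eq, hvp]
    have hpsv : p * star v = star v := by
      have := congrArg star hvp; rwa [star_mul, hp] at this
    have hsvp : star v * p = star v := by
      have := congrArg star hpv; rwa [star_mul, hp] at this
    have hnB : v + (1 - p) ∈ B := VNA.add_mem hA hvB h1p
    have hun : IsUnitary (v + (1 - p)) := by
      have hs : star (v + (1 - p)) = star v + (1 - p) := by
        rw [star_add, star_sub, star_one, hp]
      constructor <;> rw [hs] <;> simp only [add_mul, mul_add, sub_mul, mul_sub, mul_one, one_mul,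
        hvv, hsv, hpv, hvp, hpsv, hsvp, hpp] <;> abel
    refine ⟨v + (1 - p), mem_normalizerSet_iff.2 ⟨hB.1 hnB, hun, fun a ha => ?_, fun a ha => ?_⟩,
      p, hpB, hp0, hpp, ?_⟩
    · exact mul_mem hA (mul_mem hA hnB ha) (star_mem hA hnB)
    · exact mul_mem hA (mul_mem hA (star_mem hA hnB) ha) hnB
    · rw [add_mul, sub_mul, one_mul, hpp, sub_self, add_zero]

/-- An element of `P` orthogonal to the normalizers of `B` in `P` is orthogonal to every unitary
`v` of `M` for which `v* B v` commutes with `B`, up to the relative commutant of `B`. -/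
theorem trace_eq_zero_of_perp {x y v : H →L[ℂ] H} (hx : x ∈ P) (hp : Perp P B τ x) (hv : v ∈ M)
    (hvB : ∀ e ∈ projSet B, ∀ a ∈ projSet B, Commute (star v * e * v) a)
    (hy : y ∈ M) (hyB : ∀ a ∈ projSet B, Commute y a) : τ (star v * (x * y)) = 0 := by
  have hB' := isMasa_isAbelian hP hB
  have hA := hB'.toIsVonNeumannAlgebra
  have hM := h.vna
  by_contra h0
  have hsy : ∀ a ∈ projSet B, Commute (star y) a := fun a ha => by
    have := (hyB a ha).star_star
    rwa [ha.2.isSelfAdjoint.star_eq] at this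
  obtain ⟨z, hzP, hz0, hzp, β, β', hβ⟩ := h.exists_double_intertwiner hP hPM hB hx hp
    (mul_mem hM hv (star_mem hM hy)) (fun e he a ha => by
      rw [star_mul, star_star]
      have e1 : y * star v * e * (v * star y) = y * (star v * e * v) * star y := by
        simp only [mul_assoc]
      rw [e1]
      exact ((hyB a ha).mul_left (hvB e he a ha)).mul_left (hsy a ha))
    (by
      rw [star_mul, star_star, ← mul_assoc,
        h.tracial _ (mul_mem hM (hPM hx) hy) _ (star_mem hM hv)]
      exact h0)
  have hszP := star_mem hP hzP
  have hβs : ∀ e ∈ projSet B, star z * e = β e * star z := fun e he => by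
    have := congrArg star (hβ e he).2.2.1
    rwa [star_mul, star_mul, he.2.isSelfAdjoint.star_eq, (hβ e he).1.2.isSelfAdjoint.star_eq]
      at this
  have hβs' : ∀ e ∈ projSet B, e * star z = star z * β' e := fun e he => by
    have := congrArg star (hβ e he).2.2.2
    rwa [star_mul, star_mul, he.2.isSelfAdjoint.star_eq, (hβ e he).2.1.2.isSelfAdjoint.star_eq]
      at this
  have hzl : ∀ a ∈ B, z * a * star z ∈ B := fun a ha => by
    refine mem_masa hP hB (mul_mem hP (mul_mem hP hzP (hB.1 ha)) hszP) fun e he => ?_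
    calc z * a * star z * e = z * (a * β e) * star z := by
          rw [mul_assoc, hβs e he]; simp only [mul_assoc]
      _ = (z * β e) * a * star z := by
          rw [hB'.comm _ ha _ (hβ e he).1.1]; simp only [mul_assoc]
      _ = e * (z * a * star z) := by rw [← (hβ e he).2.2.1]; simp only [mul_assoc]
  have hzr : ∀ a ∈ B, star z * a * z ∈ B := fun a ha => by
    refine mem_masa hP hB (mul_mem hP (mul_mem hP hszP (hB.1 ha)) hzP) fun e he => ?_
    calc star z * a * z * e = star z * (a * β' e) * z := by
          rw [mul_assoc, (hβ e he).2.2.2]; simp only [mul_assoc]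
      _ = (star z * β' e) * a * z := by
          rw [hB'.comm _ ha _ (hβ e he).2.1.1]; simp only [mul_assoc]
      _ = e * (star z * a * z) := by rw [← hβs' e he]; simp only [mul_assoc]
  have hdB : star z * z ∈ B := by have := hzr 1 hA.one_mem; rwa [mul_one] at this
  obtain ⟨p, hpB, hp0, b, hbB, hb0, hbp, hbdb⟩ := exists_inv_sqrt hB' hdB (star_mul_self_nonneg z)
    (fun h1 => hz0 (CStarRing.star_mul_self_eq_zero_iff z |>.1 h1))
  have hbs : star b = b := hb0.isSelfAdjoint.star_eq
  have hszb : star (z * b) = b * star z := by rw [star_mul, hbs]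
  obtain ⟨n, hn, q, hq, hq0, hpq, hnq⟩ := h.exists_normalizer_of_partial hP hPM hB (v := z * b)
    (mul_mem hP hzP (hB.1 hbB)) hpB hp0 (by rw [hszb, ← hbdb]; simp only [mul_assoc])
    (by rw [mul_assoc, hbp])
    (fun a ha => by
      have := hzl _ (mul_mem hA (mul_mem hA hbB ha) hbB)
      rw [hszb]
      simpa only [mul_assoc] using this)
    (fun a ha => by
      have := mul_mem hA (mul_mem hA hbB (hzr a ha)) hbB
      rw [hszb]
      simpa only [mul_assoc] using this)
  have h1 := perp_mul hP hB hzp hn hq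
  have e1 : star (z * b * q) * z = q * b * (star z * z) := by
    rw [star_mul, hszb, hq.2.isSelfAdjoint.star_eq]; simp only [mul_assoc]
  rw [← hnq, e1] at h1
  have hqb := hB'.comm _ hq.1 _ hbB
  have hqbB := mul_mem hA hq.1 hbB
  have h2 := h.eq_zero_of_nonneg (hPM (hB.1 (mul_mem hA hqbB hdB)))
    (mul_nonneg_of_commute (mul_nonneg_of_commute (proj_nonneg hq.2) hb0 hqb)
      (star_mul_self_nonneg z) (hB'.comm _ hqbB _ hdB)) h1
  have h3 : q * p = 0 := by
    rw [← hbdb]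
    calc q * (b * (star z * z) * b) = q * b * (star z * z) * b := by simp only [mul_assoc]
      _ = 0 := by rw [h2, zero_mul]
  exact hq0 (by rw [← hpq, (hB'.comm _ hpB.1 _ hq.1).eq, h3])

end IsNormalTrace

theorem isUnitary_star {u : H →L[ℂ] H} (hu : IsUnitary u) : IsUnitary (star u) :=
  ⟨by rw [star_star]; exact hu.2, by rw [star_star]; exact hu.1⟩

/-- A unitary conjugating generators into the algebra they generate preserves this algebra. -/
theorem conj_mem_vNgen {S : Set (H →L[ℂ] H)} {u : H →L[ℂ] H} (hu : IsUnitary u)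
    (hS : ∀ b ∈ S, u * b * star u ∈ vNgen S) {a : H →L[ℂ] H} (ha : a ∈ vNgen S) :
    u * a * star u ∈ vNgen S := by
  have hv := isVNA_vNgen S
  have hS' : ∀ b ∈ S ∪ star '' S, u * b * star u ∈ vNgen S := by
    rintro b (hb | ⟨b, hb, rfl⟩)
    · exact hS b hb
    · have := star_mem hv (hS b hb)
      rwa [star_mul, star_mul, star_star, ← mul_assoc] at this
  refine mem_of_commute hv fun t ht => ?_
  have h1 : star u * t * u ∈ (S ∪ star '' S).centralizer := fun b hb => by
    have h2 := ht _ (hS' b hb)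
    calc b * (star u * t * u) = star u * u * b * star u * t * u := by
          rw [hu.1, one_mul]; simp only [mul_assoc]
      _ = star u * (u * b * star u * t) * u := by simp only [mul_assoc]
      _ = star u * t * u * b * (star u * u) := by rw [h2]; simp only [mul_assoc]
      _ = star u * t * u * b := by rw [hu.1, mul_one]
  have h3 := ha _ h1
  calc t * (u * a * star u) = u * star u * t * u * a * star u := by
        rw [hu.2, one_mul]; simp only [mul_assoc]
    _ = u * (star u * t * u * a) * star u := by simp only [mul_assoc]
    _ = u * a * star u * t * (u * star u) := by rw [h3]; simp only [mul_assoc]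
    _ = u * a * star u * t := by rw [hu.2, mul_one]

/-- A selfadjoint commuting family generates a commutative von Neumann algebra. -/
theorem commute_of_mem_vNgen {S : Set (H →L[ℂ] H)} (hs : ∀ x ∈ S, star x ∈ S)
    (hc : ∀ x ∈ S, ∀ y ∈ S, x * y = y * x) {a b : H →L[ℂ] H} (ha : a ∈ vNgen S)
    (hb : b ∈ vNgen S) : Commute a b := by
  have h1 : vNgen S ⊆ S.centralizer :=
    vNgen_subset (isVNA_centralizer hs) fun x hx y hy => hc y hy x hx
  have h2 : vNgen S ⊆ (vNgen S).centralizer :=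
    vNgen_subset (isVNA_commutant (isVNA_vNgen S)) fun x hx y hy => (h1 hy x hx).symm
  exact h2 hb a ha

theorem normAlg_subset {P B : Set (H →L[ℂ] H)} (hP : IsVonNeumannAlgebra P) : normAlg P B ⊆ P :=
  vNgen_subset hP fun _ hu => hu.1

/-- Products, with factors taken from the members of a family indexed by a given finset. -/
inductive IsProductOver {I : Type*} [DecidableEq I] (P : I → Set (H →L[ℂ] H)) :
    Finset I → (H →L[ℂ] H) → Prop
  | one : IsProductOver P ∅ 1
  | mul {i : I} {F : Finset I} {x t : H →L[ℂ] H} (hi : i ∉ F) (hx : x ∈ P i)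
      (ht : IsProductOver P F t) : IsProductOver P (insert i F) (x * t)

theorem IsProductOver.cons {I : Type*} [DecidableEq I] {P : I → Set (H →L[ℂ] H)}
    (hP : ∀ i, IsVonNeumannAlgebra (P i))
    (hcomm : ∀ i j, i ≠ j → ∀ x ∈ P i, ∀ y ∈ P j, x * y = y * x) {F : Finset I} {t : H →L[ℂ] H}
    (ht : IsProductOver P F t) {i : I} {x : H →L[ℂ] H} (hx : x ∈ P i) :
    IsProductOver P (insert i F) (x * t) := by
  induction ht with
  | one => exact .mul (Finset.notMem_empty i) hx .one
  | @mul j F z t hj hz ht ih =>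
    by_cases hij : i = j
    · subst hij
      rw [Finset.insert_idem, ← mul_assoc]
      exact .mul hj (mul_mem (hP i) hx hz) ht
    · rw [← mul_assoc, hcomm i j hij x hx z hz, mul_assoc, Finset.insert_comm]
      exact .mul (by simp [hj, Ne.symm hij]) hz ih

theorem mem_span_of_mem_adjoin {I : Type*} [DecidableEq I] {P : I → Set (H →L[ℂ] H)}
    (hP : ∀ i, IsVonNeumannAlgebra (P i))
    (hcomm : ∀ i j, i ≠ j → ∀ x ∈ P i, ∀ y ∈ P j, x * y = y * x) {t : H →L[ℂ] H}
    (ht : t ∈ StarAlgebra.adjoin ℂ (⋃ i, P i)) :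
    t ∈ Submodule.span ℂ {t | ∃ F, IsProductOver P F t} := by
  have h1 : (⋃ i, P i) ∪ star (⋃ i, P i) = ⋃ i, P i := by
    refine Set.union_eq_self_of_subset_right fun x hx => ?_
    obtain ⟨i, hi⟩ := Set.mem_iUnion.1 (Set.mem_star.1 hx)
    exact Set.mem_iUnion.2 ⟨i, by simpa using star_mem (hP i) hi⟩
  have h2 : t ∈ Algebra.adjoin ℂ (⋃ i, P i) := by
    have : t ∈ (StarAlgebra.adjoin ℂ (⋃ i, P i)).toSubalgebra := ht
    rwa [StarAlgebra.adjoin_toSubalgebra, h1] at this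
  rw [← Subalgebra.mem_toSubmodule, Algebra.adjoin_eq_span] at h2
  refine Submodule.span_mono (fun y hy => ?_) h2
  induction hy using Submonoid.closure_induction_left with
  | one => exact ⟨∅, .one⟩
  | mul_left x hx y _ ih =>
    obtain ⟨i, hi⟩ := Set.mem_iUnion.1 hx
    obtain ⟨F, hF⟩ := ih
    exact ⟨insert i F, hF.cons hP hcomm hi⟩

theorem mul_mem_normalizerSet {P B : Set (H →L[ℂ] H)} (hP : IsVonNeumannAlgebra P)
    {u w : H →L[ℂ] H} (hu : u ∈ normalizerSet P B) (hw : w ∈ normalizerSet P B) :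
    u * w ∈ normalizerSet P B := by
  rw [mem_normalizerSet_iff] at hu hw ⊢
  refine ⟨mul_mem hP hu.1 hw.1, ⟨?_, ?_⟩, fun a ha => ?_, fun a ha => ?_⟩
  · rw [star_mul, mul_assoc, ← mul_assoc (star u), hu.2.1.1, one_mul, hw.2.1.1]
  · rw [star_mul, mul_assoc, ← mul_assoc w, hw.2.1.2, one_mul, hu.2.1.2]
  · have := hu.2.2.1 _ (hw.2.2.1 a ha)
    rw [star_mul]
    simpa only [mul_assoc] using this
  · have := hw.2.2.2 _ (hu.2.2.2 a ha)
    rw [star_mul]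
    simpa only [mul_assoc] using this

/-- The star algebra generated by the normalizing unitaries is their linear span. -/
theorem mem_span_normalizerSet {P B : Set (H →L[ℂ] H)} (hP : IsVonNeumannAlgebra P)
    {t : H →L[ℂ] H} (ht : t ∈ StarAlgebra.adjoin ℂ (normalizerSet P B)) :
    t ∈ Submodule.span ℂ (normalizerSet P B) := by
  have h1 : normalizerSet P B ∪ star (normalizerSet P B) = normalizerSet P B := by
    refine Set.union_eq_self_of_subset_right fun x hx => ?_
    simpa using star_mem_normalizerSet hP (Set.mem_star.1 hx)
  have h2 : t ∈ Algebra.adjoin ℂ (normalizerSet P B) := by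
    have : t ∈ (StarAlgebra.adjoin ℂ (normalizerSet P B)).toSubalgebra := ht
    rwa [StarAlgebra.adjoin_toSubalgebra, h1] at this
  rw [← Subalgebra.mem_toSubmodule, Algebra.adjoin_eq_span] at h2
  refine Submodule.span_mono (fun y hy => ?_) h2
  induction hy using Submonoid.closure_induction with
  | mem x hx => exact hx
  | one => exact mem_normalizerSet_iff.2 ⟨hP.one_mem, ⟨by simp, by simp⟩, by simp, by simp⟩
  | mul x y _ _ hx hy => exact mul_mem_normalizerSet hP hx hy

namespace IsNormalTrace

variable {M : Set (H →L[ℂ] H)} {τ : (H →L[ℂ] H) →ₗ[ℂ] ℂ} (h : IsNormalTrace M τ)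
include h

theorem exists_adjoin_sqNorm_lt {S : Set (H →L[ℂ] H)} {x : H →L[ℂ] H} (hx : x ∈ vNgen S) {ε : ℝ}
    (hε : 0 < ε) : ∃ y ∈ StarAlgebra.adjoin ℂ S, sqNorm τ (x - y) < ε := by
  refine h.exists_sqNorm_lt _ (Set.centralizer_subset (Set.centralizer_subset ?_) hx) hε
  rintro y (hy | ⟨y, hy, rfl⟩)
  · exact StarAlgebra.subset_adjoin ℂ S hy
  · exact (StarAlgebra.adjoin ℂ S).star_mem' (StarAlgebra.subset_adjoin ℂ S hy)

/-- Orthogonality to the normalizing unitaries extends to the algebra they generate. -/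
theorem trace_eq_zero_of_mem_normAlg {A : Set (H →L[ℂ] H)} {z v : H →L[ℂ] H}
    (hz : z ∈ M) (hn : ∀ n ∈ normalizerSet M A, τ (star n * z) = 0) (hv : v ∈ normAlg M A) :
    τ (star v * z) = 0 := by
  have hM := h.vna
  have hv' := normAlg_subset hM hv
  by_contra h0
  have hpos : 0 < ‖τ (star v * z)‖ ^ 2 := by positivity
  have hz0 := h.sqNorm_nonneg hz
  obtain ⟨y, hy, hyε⟩ := h.exists_adjoin_sqNorm_lt hv
    (show 0 < ‖τ (star v * z)‖ ^ 2 / (sqNorm τ z + 1) by positivity)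
  have hys := mem_span_normalizerSet hM hy
  have hyM : y ∈ M ∧ τ (star y * z) = 0 := by
    refine Submodule.span_induction (fun n hn' => ⟨hn'.1, hn n hn'⟩) ⟨zero_mem hM, by simp⟩
      (fun a b _ _ ha hb => ⟨VNA.add_mem hM ha.1 hb.1, ?_⟩)
      (fun c a _ ha => ⟨smul_mem hM c ha.1, ?_⟩) hys
    · rw [star_add, add_mul, map_add, ha.2, hb.2, add_zero]
    · rw [star_smul, smul_mul_assoc, map_smul, ha.2, smul_zero]
  have hc := h.cauchy (sub_mem hM hv' hyM.1) hz
  rw [star_sub, sub_mul, map_sub, hyM.2, sub_zero] at hc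
  rw [lt_div_iff₀ (by positivity)] at hyε
  have := h.sqNorm_nonneg (sub_mem hM hv' hyM.1)
  nlinarith

/-- Products of elements of commuting factors agree, up to the orthogonal complement of `V`, with
elements of `N`. -/
theorem exists_orthogonal_of_isProductOver {I : Type*} [DecidableEq I]
    {P : I → Set (H →L[ℂ] H)} (hP : ∀ i, IsVonNeumannAlgebra (P i)) (hPM : ∀ i, P i ⊆ M)
    (hcomm : ∀ i j, i ≠ j → ∀ x ∈ P i, ∀ y ∈ P j, x * y = y * x)
    {Q : I → Set (H →L[ℂ] H)} (hQ : ∀ i, IsVonNeumannAlgebra (Q i)) (hQP : ∀ i, Q i ⊆ P i)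
    {N V : Set (H →L[ℂ] H)} (hN : IsVonNeumannAlgebra N) (hQN : ∀ i, Q i ⊆ N)
    (hV : ∀ v ∈ V, ∀ i, ∀ x ∈ P i, (∀ n ∈ Q i, τ (n * x) = 0) → ∀ y ∈ M,
      (∀ z ∈ P i, y * z = z * y) → τ (star v * (x * y)) = 0)
    {F : Finset I} {t : H →L[ℂ] H} (ht : IsProductOver P F t) :
    t ∈ M ∧ (∀ j ∉ F, ∀ x ∈ P j, t * x = x * t) ∧
    ∃ s ∈ N, (∀ j ∉ F, ∀ x ∈ P j, s * x = x * s) ∧ ∀ v ∈ V, ∀ y ∈ M,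
      (∀ i ∈ F, ∀ x ∈ P i, y * x = x * y) → τ (star v * ((t - s) * y)) = 0 := by
  have hM := h.vna
  induction ht with
  | one => exact ⟨hM.one_mem, by simp, 1, hN.one_mem, by simp, by simp⟩
  | @mul i F x t hi hx ht ih =>
    obtain ⟨htM, htc, s, hsN, hsc, hs⟩ := ih
    obtain ⟨e, heQ, he⟩ := h.exists_condExp (hQ i) ((hQP i).trans (hPM i)) (hPM i hx)
    have heP := hQP i heQ
    have hprod : ∀ {a b : H →L[ℂ] H}, a ∈ P i → (∀ j ∉ F, ∀ x ∈ P j, b * x = x * b) →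
        ∀ j ∉ insert i F, ∀ x ∈ P j, a * b * x = x * (a * b) := by
      intro a b ha hb j hj z hz
      rw [Finset.mem_insert, not_or] at hj
      rw [mul_assoc, hb j hj.2 z hz, ← mul_assoc, hcomm i j (Ne.symm hj.1) a ha z hz, mul_assoc]
    refine ⟨mul_mem hM (hPM i hx) htM, hprod hx htc, e * s, mul_mem hN (hQN i heQ) hsN,
      hprod heP hsc, fun v hv y hy hyc => ?_⟩
    have h1 := hV v hv i (x - e) (sub_mem (hP i) hx heP) he (t * y) (mul_mem hM htM hy)
      (fun z hz => by
        rw [mul_assoc, hyc i (Finset.mem_insert_self i F) z hz, ← mul_assoc, htc i hi z hz,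
          mul_assoc])
    have h2 := hs v hv (e * y) (mul_mem hM (hPM i heP) hy) (fun j hj z hz => by
      have hij : i ≠ j := fun hij => hi (hij ▸ hj)
      rw [mul_assoc, hyc j (Finset.mem_insert_of_mem hj) z hz, ← mul_assoc,
        hcomm i j hij e heP z hz, mul_assoc])
    have h3 : (x * t - e * s) * y = (x - e) * (t * y) + (t - s) * (e * y) := by
      have h4 : t * (e * y) = e * (t * y) := by
        rw [← mul_assoc, htc i hi e heP, mul_assoc]
      have h5 : s * (e * y) = e * (s * y) := by
        rw [← mul_assoc, hsc i hi e heP, mul_assoc]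
      rw [sub_mul, sub_mul, sub_mul, h4, h5]
      simp only [mul_assoc]
      abel
    rw [h3, mul_add, map_add, h1, h2, add_zero]

end IsNormalTrace

end VNA

/-- For MASAs `Aᵢ ⊆ Mᵢ` in II₁ factors realized inside the infinite tensor
product `M = ⊗̄_{i ∈ I} Mᵢ` over a countable index set `I`, one has
`⊗̄ᵢ N_{Mᵢ}(Aᵢ)'' = N_M (⊗̄ᵢ Aᵢ)''`. -/
theorem normalizing_algebra_of_infinite_tensor_product
    {H : Type*} [NormedAddCommGroup H] [InnerProductSpace ℂ H] [CompleteSpace H]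
    (I : Type*) [Countable I]
    (M : Set (H →L[ℂ] H)) (Mi Ai : I → Set (H →L[ℂ] H)) (τ : (H →L[ℂ] H) → ℂ)
    (hM : IsII1Factor M τ)
    (hMi : ∀ i, IsVonNeumannAlgebra (Mi i))
    (hMif : ∀ i, IsFactor (Mi i))
    (hMii : ∀ i, IsInfiniteDimensionalSet (Mi i))
    (hMiM : ∀ i, Mi i ⊆ M)
    (hcomm : ∀ i j, i ≠ j → ∀ x ∈ Mi i, ∀ y ∈ Mi j, x * y = y * x)
    (hgen : M = vNgen (⋃ i, Mi i))
    (htrace : ∀ (k : ℕ) (ι : Fin k → I), Function.Injective ι →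
      ∀ x : Fin k → (H →L[ℂ] H), (∀ j, x j ∈ Mi (ι j)) →
        τ (List.ofFn x).prod = (List.ofFn fun j => τ (x j)).prod)
    (hAi : ∀ i, IsMasa (Mi i) (Ai i)) :
    vNgen (⋃ i, normAlg (Mi i) (Ai i)) = normAlg M (vNgen (⋃ i, Ai i)) := by
  classical
  obtain ⟨σ, -, hσ⟩ := VNA.exists_isNormalTrace hM
  have hMv := hM.vna
  have hAb := fun i => VNA.isMasa_isAbelian (hMi i) (hAi i)
  have hAM : vNgen (⋃ i, Ai i) ⊆ M :=
    VNA.vNgen_subset hMv (Set.iUnion_subset fun i => (hAi i).1.trans (hMiM i))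
  have hAA : ∀ i, Ai i ⊆ vNgen (⋃ i, Ai i) := fun i =>
    (Set.subset_iUnion Ai i).trans (VNA.subset_vNgen _)
  have hAc : ∀ a ∈ vNgen (⋃ i, Ai i), ∀ b ∈ vNgen (⋃ i, Ai i), Commute a b := by
    refine fun a ha b hb => VNA.commute_of_mem_vNgen (fun x hx => ?_) (fun x hx y hy => ?_) ha hb
    · obtain ⟨i, hi⟩ := Set.mem_iUnion.1 hx
      exact Set.mem_iUnion.2 ⟨i, (hAi i).2.1 x hi⟩
    · obtain ⟨i, hi⟩ := Set.mem_iUnion.1 hx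
      obtain ⟨j, hj⟩ := Set.mem_iUnion.1 hy
      by_cases hij : i = j
      · subst hij
        exact (hAb i).comm x hi y hj
      · exact hcomm i j hij x ((hAi i).1 hi) y ((hAi j).1 hj)
  have hnorm : ∀ i, normalizerSet (Mi i) (Ai i) ⊆ normalizerSet M (vNgen (⋃ i, Ai i)) := by
    have key : ∀ i, ∀ u ∈ Mi i, IsUnitary u → (∀ a ∈ Ai i, u * a * star u ∈ Ai i) →
        ∀ a ∈ vNgen (⋃ i, Ai i), u * a * star u ∈ vNgen (⋃ i, Ai i) := by
      refine fun i u hu huu hua a ha => VNA.conj_mem_vNgen huu (fun b hb => ?_) ha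
      obtain ⟨j, hj⟩ := Set.mem_iUnion.1 hb
      by_cases hij : i = j
      · subst hij
        exact hAA i (hua b hj)
      · rw [hcomm i j hij u hu b ((hAi j).1 hj), mul_assoc, huu.2, mul_one]
        exact hAA j hj
    intro i u hu
    rw [VNA.mem_normalizerSet_iff] at hu ⊢
    refine ⟨hMiM i hu.1, hu.2.1, key i u hu.1 hu.2.1 hu.2.2.1, fun a ha => ?_⟩
    have := key i (star u) (VNA.star_mem (hMi i) hu.1) (VNA.isUnitary_star hu.2.1)
      (by simpa only [star_star] using hu.2.2.2) a ha
    rwa [star_star] at this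
  have hsub : vNgen (⋃ i, normAlg (Mi i) (Ai i)) ⊆ normAlg M (vNgen (⋃ i, Ai i)) :=
    VNA.vNgen_subset (VNA.isVNA_vNgen _) (Set.iUnion_subset fun i =>
      VNA.vNgen_subset (VNA.isVNA_vNgen _) ((hnorm i).trans (VNA.subset_vNgen _)))
  refine subset_antisymm hsub (VNA.vNgen_subset (VNA.isVNA_vNgen _) fun u hu => ?_)
  have hWM : normAlg M (vNgen (⋃ i, Ai i)) ⊆ M := VNA.normAlg_subset hMv
  have hW := VNA.isVNA_vNgen (normalizerSet M (vNgen (⋃ i, Ai i)))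
  have huW : u ∈ normAlg M (vNgen (⋃ i, Ai i)) := VNA.subset_vNgen _ hu
  have hV : ∀ v ∈ normAlg M (vNgen (⋃ i, Ai i)), ∀ i, ∀ x ∈ Mi i,
      (∀ n ∈ normAlg (Mi i) (Ai i), σ (n * x) = 0) → ∀ y ∈ M,
      (∀ z ∈ Mi i, y * z = z * y) → σ (star v * (x * y)) = 0 := by
    intro v hv i x hx hxn y hy hyc
    refine hσ.trace_eq_zero_of_mem_normAlg (VNA.mul_mem hMv (hMiM i hx) hy) (fun n hn => ?_) hv
    rw [VNA.mem_normalizerSet_iff] at hn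
    refine hσ.trace_eq_zero_of_perp (hMi i) (hMiM i) (hAi i) hx (fun w hw => ?_) hn.1
      (fun e he a ha => ?_) hy fun a ha => hyc a ((hAi i).1 ha.1)
    · exact hxn _ (VNA.star_mem (VNA.isVNA_vNgen _) (VNA.subset_vNgen _ hw))
    · exact hAc _ (hn.2.2.2 e (hAA i he.1)) a (hAA i ha.1)
  have hspan : ∀ t ∈ Submodule.span ℂ {t | ∃ F, VNA.IsProductOver Mi F t},
      t ∈ M ∧ ∃ s ∈ vNgen (⋃ i, normAlg (Mi i) (Ai i)),
        ∀ v ∈ normAlg M (vNgen (⋃ i, Ai i)), σ (star v * (t - s)) = 0 := by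
    intro t ht
    induction ht using Submodule.span_induction with
    | mem t ht =>
      obtain ⟨F, hF⟩ := ht
      obtain ⟨htM, -, s, hs, -, hst⟩ := hσ.exists_orthogonal_of_isProductOver hMi hMiM hcomm
        (fun i => VNA.isVNA_vNgen _) (fun i => VNA.normAlg_subset (hMi i)) (VNA.isVNA_vNgen _)
        (fun i => (Set.subset_iUnion (fun i => normAlg (Mi i) (Ai i)) i).trans
          (VNA.subset_vNgen _)) hV hF
      refine ⟨htM, s, hs, fun v hv => ?_⟩
      have := hst v hv 1 hMv.one_mem (by simp)
      rwa [mul_one] at this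
    | zero => exact ⟨VNA.zero_mem hMv, 0, VNA.zero_mem (VNA.isVNA_vNgen _), by simp⟩
    | add a b _ _ ha hb =>
      obtain ⟨haM, s, hs, hsa⟩ := ha
      obtain ⟨hbM, r, hr, hrb⟩ := hb
      refine ⟨VNA.add_mem hMv haM hbM, s + r, VNA.add_mem (VNA.isVNA_vNgen _) hs hr,
        fun v hv => ?_⟩
      rw [add_sub_add_comm, mul_add, map_add, hsa v hv, hrb v hv, add_zero]
    | smul c a _ ha =>
      obtain ⟨haM, s, hs, hsa⟩ := ha
      refine ⟨VNA.smul_mem hMv c haM, c • s, VNA.smul_mem (VNA.isVNA_vNgen _) c hs,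
        fun v hv => ?_⟩
      rw [← smul_sub, mul_smul_comm, map_smul, hsa v hv, smul_zero]
  refine hσ.mem_of_approx (VNA.isVNA_vNgen _) (hsub.trans hWM) hu.1 fun ε hε => ?_
  obtain ⟨t, ht, htε⟩ := hσ.exists_adjoin_sqNorm_lt (hgen ▸ hu.1) hε
  obtain ⟨htM, s, hs, hst⟩ := hspan t (VNA.mem_span_of_mem_adjoin hMi hcomm ht)
  refine ⟨s, hs, lt_of_le_of_lt ?_ htε⟩
  have hus := VNA.sub_mem hW huW (hsub hs)
  have husM := hWM hus
  have hutM := VNA.sub_mem hMv hu.1 htM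
  have h1 : σ (star (u - s) * (u - t)) = σ (star (u - s) * (u - s)) := by
    rw [← sub_eq_zero, ← map_sub, ← mul_sub, show u - t - (u - s) = -(t - s) by abel, mul_neg,
      map_neg, hst _ hus, neg_zero]
  have h2 := hσ.cauchy husM hutM
  have h3 := hσ.sqNorm_nonneg husM
  have h4 := hσ.sqNorm_nonneg hutM
  rw [h1, hσ.eq_sqNorm husM, Complex.norm_real, Real.norm_of_nonneg h3, sq] at h2
  rcases h3.eq_or_lt with h5 | h5
  · rwa [← h5]
  · exact le_of_mul_le_mul_left h2 h5
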